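/- arXiv:1509.02978 — 6 statements merged into one kernel-verified Lean document; each statement's English description precedes it below -/
import Mathlib

section
/- Let k be an algebraically closed field of characteristic not two, let n ≥ 1, let R = k[X]/(Xⁿ), let 𝔪 = (X)R be its maximal ideal, and let M be the R-module R ⊕ 𝔪 ⊕ 𝔪² ⊕ ⋯ ⊕ 𝔪^{n-1}. Then the abelianization of the automorphism group of the R-module M is isomorphic to (kˣ)^n, the direct sum of n copies of the multiplicative group of k. -/
noncomputable section

set_option synthInstance.maxHeartbeats 1000000
set_option maxHeartbeats 1000000

universe u

/-- The truncated polynomial ring `R = k[X]/(Xⁿ)`. -/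
abbrev TruncPoly (k : Type u) [Field k] (n : ℕ) : Type u :=
  Polynomial k ⧸ Ideal.span {(Polynomial.X : Polynomial k) ^ n}

/-- The maximal ideal `𝔪 = (X)` of `k[X]/(Xⁿ)`. -/
abbrev TruncPoly.maxIdeal (k : Type u) [Field k] (n : ℕ) : Ideal (TruncPoly k n) :=
  Ideal.span {Ideal.Quotient.mk (Ideal.span {(Polynomial.X : Polynomial k) ^ n}) Polynomial.X}

/-- The elements of a monoid that are commutator-subgroup elements of its group of units. -/
def commutatorUnits (E : Type*) [Monoid E] : Submonoid E :=
  (commutator Eˣ).toSubmonoid.map (Units.coeHom E)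

theorem mem_commutatorUnits {E : Type*} [Monoid E] {y : E} :
    y ∈ commutatorUnits E ↔ ∃ u ∈ commutator Eˣ, (u : E) = y := Iff.rfl

open scoped commutatorElement in
theorem one_add_mem_commutatorUnits {R E : Type*} [CommRing R] [Ring E] [Algebra R E] {c : R}
    (hc : IsUnit c) (hc1 : IsUnit (c - 1)) {e f : E} (hee : e * e = e) (hef : e * f = f)
    (hfe : f * e = 0) : 1 + f ∈ commutatorUnits E := by
  obtain ⟨d, hd⟩ := hc.exists_right_inv
  obtain ⟨b, hb⟩ := hc1.exists_right_inv
  have hff : f * f = 0 := by rw [← hef, mul_assoc, ← mul_assoc f, hfe]; simp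
  have key : ∀ p q : R, p * q = 1 → (1 + (p - 1) • e) * (1 + (q - 1) • e) = 1 := by
    intro p q h
    have : (1 + (p - 1) • e) * (1 + (q - 1) • e) = 1 + (p * q - 1) • e := by
      simp only [mul_add, add_mul, one_mul, mul_one, smul_mul_assoc, mul_smul_comm, hee]
      module
    rw [this, h]
    simp
  let T : Eˣ := ⟨1 + (c - 1) • e, 1 + (d - 1) • e, key c d hd, key d c (by rw [mul_comm, hd])⟩
  let U : Eˣ := ⟨1 + b • f, 1 - b • f,
    by simp [mul_sub, add_mul, hff], by simp [mul_add, sub_mul, hff]⟩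
  refine mem_commutatorUnits.2 ⟨⁅T, U⁆, Subgroup.commutator_mem_commutator (Subgroup.mem_top _)
    (Subgroup.mem_top _), ?_⟩
  have hTU : ((T * U : Eˣ) : E) = (1 + f) * ((U * T : Eˣ) : E) := by
    have : (T * U : E) = (1 + (c - 1) • e) + b • f + ((c - 1) * b) • f := by
      simp only [T, U, mul_add, add_mul, one_mul, mul_one, smul_mul_assoc, mul_smul_comm, hef]
      module
    rw [Units.val_mul, this, hb]
    simp only [Units.val_mul, T, U, mul_add, add_mul, one_mul, mul_one, smul_mul_assoc,
      mul_smul_comm, hfe, hff, smul_zero, mul_zero]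
    module
  have : ((⁅T, U⁆ : Eˣ) : E) = ((T * U : Eˣ) : E) * (((U * T)⁻¹ : Eˣ) : E) := by
    rw [commutatorElement_def, mul_assoc, ← mul_inv_rev, Units.val_mul]
  rw [this, hTU, mul_assoc, ← Units.val_mul, mul_inv_cancel, Units.val_one, mul_one]

theorem one_add_mul_mem_commutatorUnits {R E : Type*} [CommRing R] [Ring E] [Algebra R E] {c : R}
    (hc : IsUnit c) (hc1 : IsUnit (c - 1)) {e f a b : E} (hee : e * e = e) (hff : f * f = f)
    (hea : e * a = a) (hae : a * e = 0) (hfb : f * b = b) (hbf : b * f = 0)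
    (h : 1 + b * a ∈ commutatorUnits E) : 1 + a * b ∈ commutatorUnits E := by
  obtain ⟨v, hv, hvb⟩ := mem_commutatorUnits.1 h
  have hbb : b * b = 0 := by rw [← hfb, mul_assoc, ← mul_assoc b, hbf]; simp
  have h1 : b * a * (v⁻¹ : Eˣ) = 1 - (v⁻¹ : Eˣ) := by
    rw [eq_sub_of_add_eq' hvb.symm, sub_mul]; simp
  have h2 : (v⁻¹ : Eˣ) * (b * a) = 1 - (v⁻¹ : Eˣ) := by
    rw [eq_sub_of_add_eq' hvb.symm, mul_sub]; simp
  let u : Eˣ := ⟨1 + a * b, 1 - a * (v⁻¹ : Eˣ) * b, by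
      have : (1 + a * b) * (1 - a * (v⁻¹ : Eˣ) * b) =
        1 + a * b - a * (v⁻¹ : Eˣ) * b - a * (b * a * (v⁻¹ : Eˣ)) * b := by noncomm_ring
      rw [this, h1]; noncomm_ring, by
      have : (1 - a * (v⁻¹ : Eˣ) * b) * (1 + a * b) =
        1 + a * b - a * (v⁻¹ : Eˣ) * b - a * ((v⁻¹ : Eˣ) * (b * a)) * b := by noncomm_ring
      rw [this, h2]; noncomm_ring⟩
  have huf : (u⁻¹ : Eˣ) * f = f := by
    have : (u : E) * f = f := by
      simp only [u, add_mul, one_mul, mul_assoc, hbf, mul_zero, add_zero]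
    rw [Units.inv_mul_eq_iff_eq_mul, this]
  obtain ⟨α, hα, hαa⟩ := mem_commutatorUnits.1 (one_add_mem_commutatorUnits hc hc1 hee hea hae)
  obtain ⟨β, hβ, hβb⟩ := mem_commutatorUnits.1 (one_add_mem_commutatorUnits hc hc1 hff hfb hbf)
  obtain ⟨γ, hγ, hγb⟩ := mem_commutatorUnits.1
    (one_add_mem_commutatorUnits (f := b * (u⁻¹ : Eˣ)) hc hc1 hff (by rw [← mul_assoc, hfb])
      (by rw [mul_assoc, huf, hbf]))
  have huv : γ * u * α = α * β * v := by
    ext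
    simp only [Units.val_mul, hγb, hαa, hβb, hvb]
    rw [add_mul 1, mul_assoc b, Units.inv_mul]
    have : b * (b * a) = 0 := by rw [← mul_assoc, hbb, zero_mul]
    simp only [u, mul_add, add_mul, one_mul, mul_one, mul_assoc, this, mul_zero]
    abel
  refine mem_commutatorUnits.2 ⟨u, ?_, rfl⟩
  have : u = γ⁻¹ * (α * β * v) * α⁻¹ := by rw [← huv]; group
  rw [this]
  exact mul_mem (mul_mem (inv_mem hγ) (mul_mem (mul_mem hα hβ) hv)) (inv_mem hα)

/-- In a ring with a multiplicative filtration `J` that reaches zero, membership of `1 + h` in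
`commutatorUnits` for all `h ∈ J 1` can be checked on summands. -/
theorem one_add_mem_commutatorUnits_of_filtration {E ι : Type*} [Ring E] (J : ℕ → AddSubgroup E)
    (hanti : ∀ s, J (s + 1) ≤ J s) (hmul : ∀ s t a b, a ∈ J s → b ∈ J t → a * b ∈ J (s + t))
    (htop : ∀ a, a ∈ J 0) {N : ℕ} (hN : ∀ a ∈ J N, a = 0) (S : Finset ι) (p : ι → E → E)
    (hp : ∀ s, ∀ h ∈ J s, ∀ i, p i h ∈ J s) (hsum : ∀ h, ∑ i ∈ S, p i h = h)
    (hone : ∀ h ∈ J 1, ∀ i, 1 + p i h ∈ commutatorUnits E) {h : E} (hh : h ∈ J 1) :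
    1 + h ∈ commutatorUnits E := by
  have hle : ∀ s, J (s + 1) ≤ J 1 := by
    intro s
    induction s with
    | zero => exact le_rfl
    | succ s ih => exact (hanti _).trans ih
  have main : ∀ d s, s + d = N → ∀ h ∈ J (s + 1), 1 + h ∈ commutatorUnits E := by
    intro d
    induction d with
    | zero =>
      rintro s rfl h hh
      rw [hN h (hanti _ hh), add_zero]
      exact one_mem _
    | succ d ih =>
      intro s hs h hh
      have hadd : ∀ a ∈ J (s + 1), ∀ b ∈ J (s + 1), 1 + a ∈ commutatorUnits E →
          1 + b ∈ commutatorUnits E → 1 + (a + b) ∈ commutatorUnits E := by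
        intro a ha b hb ha' hb'
        obtain ⟨α, hα, hαa⟩ := mem_commutatorUnits.1 ha'
        obtain ⟨β, hβ, hβb⟩ := mem_commutatorUnits.1 hb'
        have hab : a * b ∈ J (s + 1 + 1) := by
          have := hmul 1 (s + 1) a b (hle _ ha) hb
          rwa [add_comm 1] at this
        have hc : -(((α * β)⁻¹ : Eˣ) * (a * b)) ∈ J (s + 1 + 1) := by
          have := hmul 0 (s + 1 + 1) (((α * β)⁻¹ : Eˣ) : E) _ (htop _) hab
          rw [zero_add] at this
          exact neg_mem this
        have := mul_mem (mul_mem ha' hb') (ih (s + 1) (by omega) _ hc)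
        have heq : (1 + a) * (1 + b) * (1 + -(((α * β)⁻¹ : Eˣ) * (a * b))) = 1 + (a + b) := by
          rw [← hαa, ← hβb, ← Units.val_mul, mul_add, mul_neg, Units.mul_inv_cancel_left,
            Units.val_mul, hαa, hβb]
          noncomm_ring
        rwa [heq] at this
      have : ∀ T : Finset ι, ∑ i ∈ T, p i h ∈ J (s + 1) ∧
          1 + ∑ i ∈ T, p i h ∈ commutatorUnits E := by
        classical
        intro T
        induction T using Finset.induction_on with
        | empty => simp [one_mem]
        | insert i T hi iT =>
          rw [Finset.sum_insert hi]
          exact ⟨add_mem (hp _ h hh i) iT.1,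
            hadd _ (hp _ h hh i) _ iT.1 (hone h (hle _ hh) i) iT.2⟩
      simpa only [hsum] using (this S).2
  exact main N 0 (zero_add N) h hh

/-- `R` behaves like `k[x]/(xⁿ)` with augmentation `ε`. -/
structure IsTruncated {R k : Type*} [CommRing R] [Field k] (x : R) (n : ℕ) (ε : R →+* k) :
    Prop where
  map_eq_zero : ε x = 0
  dvd_of_map_eq_zero : ∀ a, ε a = 0 → x ∣ a
  pow_eq_zero : x ^ n = 0
  dvd_of_pow_mul_eq_zero : ∀ i ≤ n, ∀ a, x ^ i * a = 0 → x ^ (n - i) ∣ a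

theorem IsTruncated.map_eq_map {R k : Type*} [CommRing R] [Field k] {x : R} {n : ℕ} {ε : R →+* k}
    (H : IsTruncated x n ε) {i : ℕ} (hi : i < n) {a b : R} (h : x ^ i * a = x ^ i * b) :
    ε a = ε b := by
  have h0 : x ^ (n - i) ∣ a - b :=
    H.dvd_of_pow_mul_eq_zero i hi.le _ (by rw [mul_sub, h, sub_self])
  obtain ⟨c, hc⟩ := (dvd_pow_self x (by omega : n - i ≠ 0)).trans h0
  rw [← sub_eq_zero, ← map_sub, hc, map_mul, H.map_eq_zero, zero_mul]

/-- The module `R ⊕ (x) ⊕ (x)² ⊕ ⋯ ⊕ (x)ⁿ⁻¹`. -/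
abbrev PowSum {R : Type*} [CommRing R] (x : R) (n : ℕ) : Type _ :=
  ∀ i : Fin n, ↥(Ideal.span {x} ^ (i : ℕ))

namespace PowSum

variable {R k : Type*} [CommRing R] [Field k] {x : R} {n : ℕ} {ε : R →+* k}

theorem mem_span_pow {a : R} {i : ℕ} : a ∈ Ideal.span {x} ^ i ↔ x ^ i ∣ a := by
  rw [Ideal.span_singleton_pow, Ideal.mem_span_singleton]

theorem pow_sub_mul_mem (i j : ℕ) (a : R) {m : R} (hm : m ∈ Ideal.span {x} ^ j) :
    x ^ (i - j) * a * m ∈ Ideal.span {x} ^ i := by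
  rw [mem_span_pow] at hm ⊢
  obtain ⟨r, rfl⟩ := hm
  refine (pow_dvd_pow x (by omega : i ≤ i - j + j)).trans ⟨a * r, ?_⟩
  rw [pow_add]
  ring

/-- The endomorphism of `PowSum x n` that sends the `j`-th component to the `i`-th one by
multiplication by `x ^ (i - j) * a`, with truncated subtraction. -/
def entry (x : R) (i j : Fin n) (a : R) : Module.End R (PowSum x n) :=
  LinearMap.single R (fun i : Fin n => ↥(Ideal.span {x} ^ (i : ℕ))) i ∘ₗ
    ((LinearMap.mulLeft R (x ^ ((i : ℕ) - j) * a)).restrict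
      fun _ hm => pow_sub_mul_mem i j a hm) ∘ₗ LinearMap.proj j

theorem entry_apply (i j : Fin n) (a : R) (m : PowSum x n) (l : Fin n) :
    (entry x i j a m l : R) = if l = i then x ^ ((i : ℕ) - j) * a * (m j : R) else 0 := by
  by_cases h : l = i
  · subst h; simp [entry, mul_assoc]
  · simp [entry, h]

theorem ext_coe {m m' : PowSum x n} (h : ∀ i, (m i : R) = m' i) : m = m' :=
  funext fun i => Subtype.ext (h i)

theorem entry_mul_entry (i j l : Fin n) (a b : R) {c : R}
    (h : x ^ ((i : ℕ) - j) * a * (x ^ ((j : ℕ) - l) * b) = x ^ ((i : ℕ) - l) * c) :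
    entry x i j a * entry x j l b = entry x i l c := by
  refine LinearMap.ext fun m => ext_coe fun p => ?_
  rw [Module.End.mul_apply, entry_apply, entry_apply, entry_apply, if_pos rfl, ← h]
  split_ifs <;> ring

theorem entry_mul_entry_of_ne {i j j' l : Fin n} (hj : j ≠ j') (a b : R) :
    entry x i j a * entry x j' l b = 0 := by
  refine LinearMap.ext fun m => ext_coe fun p => ?_
  rw [Module.End.mul_apply, entry_apply, entry_apply, if_neg hj]
  simp

theorem exists_entry (H : IsTruncated x n ε) (f : Module.End R (PowSum x n)) (i j : Fin n) :
    ∃ a : R, ∀ m : PowSum x n,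
      (f (Pi.single j (m j)) i : R) = x ^ ((i : ℕ) - j) * a * (m j : R) := by
  let g : PowSum x n := Pi.single j ⟨x ^ (j : ℕ), mem_span_pow.2 dvd_rfl⟩
  have hg : x ^ (n - j) * (f g i : R) = 0 := by
    have h0 : x ^ (n - (j : ℕ)) • g = 0 := by
      rw [← Pi.single_smul]
      have : x ^ (n - (j : ℕ)) • (⟨x ^ (j : ℕ), mem_span_pow.2 dvd_rfl⟩ :
          ↥(Ideal.span {x} ^ (j : ℕ))) = 0 := by
        ext
        simp [← pow_add, H.pow_eq_zero, Nat.sub_add_cancel j.2.le]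
      rw [this, Pi.single_zero]
    have h1 : ((x ^ (n - (j : ℕ)) • f g) i : R) = 0 := by rw [← map_smul, h0, map_zero]; rfl
    simpa using h1
  have hj : x ^ (j : ℕ) ∣ (f g i : R) := by
    simpa [Nat.sub_sub_self j.2.le] using H.dvd_of_pow_mul_eq_zero _ (Nat.sub_le n j) _ hg
  have hi : x ^ (i : ℕ) ∣ (f g i : R) := mem_span_pow.1 (f g i).2
  have hij : x ^ ((i : ℕ) - j + j) ∣ (f g i : R) := by
    rcases le_total (i : ℕ) j with h | h
    · rwa [Nat.sub_eq_zero_of_le h, zero_add]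
    · rwa [Nat.sub_add_cancel h]
  obtain ⟨a, ha⟩ := hij
  refine ⟨a, fun m => ?_⟩
  obtain ⟨r, hr⟩ := mem_span_pow.1 (m j).2
  have hm : Pi.single j (m j) = r • g := by
    rw [← Pi.single_smul]
    congr 1
    ext
    simp [hr, mul_comm]
  rw [hm, map_smul, hr]
  simp only [Pi.smul_apply, Submodule.coe_smul, smul_eq_mul, ha, pow_add]
  ring

/-- Matrix coefficients of an endomorphism; see `coe_apply`. -/
def coeff (H : IsTruncated x n ε) (f : Module.End R (PowSum x n)) (i j : Fin n) : R :=
  (exists_entry H f i j).choose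

theorem coeff_spec (H : IsTruncated x n ε) (f : Module.End R (PowSum x n)) (i j : Fin n)
    (m : PowSum x n) :
    (f (Pi.single j (m j)) i : R) = x ^ ((i : ℕ) - j) * coeff H f i j * (m j : R) :=
  (exists_entry H f i j).choose_spec m

theorem coe_apply (H : IsTruncated x n ε) (f : Module.End R (PowSum x n)) (m : PowSum x n)
    (i : Fin n) : (f m i : R) = ∑ j : Fin n, x ^ ((i : ℕ) - j) * coeff H f i j * (m j : R) := by
  conv_lhs => rw [← Finset.univ_sum_single m, map_sum]
  rw [Finset.sum_apply, AddSubmonoidClass.coe_finsetSum]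
  exact Finset.sum_congr rfl fun j _ => coeff_spec H f i j m

theorem sum_entry (H : IsTruncated x n ε) (f : Module.End R (PowSum x n)) :
    ∑ p : Fin n × Fin n, entry x p.1 p.2 (coeff H f p.1 p.2) = f := by
  refine LinearMap.ext fun m => ext_coe fun l => ?_
  rw [coe_apply H f, LinearMap.sum_apply, Finset.sum_apply, AddSubmonoidClass.coe_finsetSum,
    Fintype.sum_prod_type]
  simp only [entry_apply]
  rw [Finset.sum_eq_single l (by intro b _ hb; simp [hb.symm]) (by simp)]
  simp

theorem map_coeff_eq (H : IsTruncated x n ε) (f : Module.End R (PowSum x n)) (i : Fin n) (a : R)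
    (h : ∀ m : PowSum x n, (f (Pi.single i (m i)) i : R) = a * (m i : R)) :
    ε (coeff H f i i) = ε a := by
  have h1 := coeff_spec H f i i (Pi.single i ⟨x ^ (i : ℕ), mem_span_pow.2 dvd_rfl⟩)
  rw [h] at h1
  refine H.map_eq_map i.2 ?_
  simpa [mul_comm] using h1.symm

theorem map_pow_eq_zero (H : IsTruncated x n ε) {i : ℕ} (hi : i ≠ 0) : ε (x ^ i) = 0 := by
  rw [map_pow, H.map_eq_zero, zero_pow hi]

/-- The diagonal matrix coefficients modulo `x`. -/
def diagHom (H : IsTruncated x n ε) : Module.End R (PowSum x n) →* (Fin n → k) where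
  toFun f i := ε (coeff H f i i)
  map_one' := by
    funext i
    rw [map_coeff_eq H 1 i 1 (fun m => by simp)]
    simp
  map_mul' f g := by
    funext i
    have := map_coeff_eq H (f * g) i
      (∑ j : Fin n, x ^ ((i : ℕ) - j) * coeff H f i j * (x ^ ((j : ℕ) - i) * coeff H g j i))
      (fun m => by
        rw [Module.End.mul_apply, coe_apply H, Finset.sum_mul]
        refine Finset.sum_congr rfl fun j _ => ?_
        rw [coeff_spec H]
        ring)
    rw [this, map_sum, Finset.sum_eq_single i]
    · simp
    · intro j _ hj
      have hj' : (j : ℕ) ≠ i := fun h => hj (Fin.ext h)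
      simp only [map_mul]
      rcases lt_or_gt_of_ne hj' with h | h
      · rw [map_pow_eq_zero H (by omega : (i : ℕ) - j ≠ 0)]; simp
      · rw [map_pow_eq_zero H (by omega : (j : ℕ) - i ≠ 0)]; simp
    · simp

/-- The weight filtration on `PowSum x n`, where `x ^ v` in component `i` has weight `2 v - i`. -/
def weightFiltration (x : R) (n t : ℕ) : AddSubgroup (PowSum x n) where
  carrier := {m | ∀ i : Fin n, x ^ ((t + i + 1) / 2) ∣ (m i : R)}
  zero_mem' := by simp
  add_mem' ha hb i := by simpa using dvd_add (ha i) (hb i)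
  neg_mem' ha i := by simpa using ha i

theorem weightFiltration_anti {s t : ℕ} (h : s ≤ t) :
    weightFiltration x n t ≤ weightFiltration x n s := fun _ hm i =>
  (pow_dvd_pow x (by omega)).trans (hm i)

theorem single_mem_weightFiltration {t : ℕ} {m : PowSum x n} (hm : m ∈ weightFiltration x n t)
    (j : Fin n) : (Pi.single j (m j) : PowSum x n) ∈ weightFiltration x n t := by
  intro i
  by_cases h : i = j
  · subst h; simpa using hm i
  · simp [h]

/-- The endomorphisms that raise the weight by at least `s`. -/
def endFiltration (x : R) (n s : ℕ) : AddSubgroup (Module.End R (PowSum x n)) where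
  carrier := {f | ∀ t, ∀ m ∈ weightFiltration x n t, f m ∈ weightFiltration x n (t + s)}
  zero_mem' _ _ _ := zero_mem _
  add_mem' ha hb t m hm := add_mem (ha t m hm) (hb t m hm)
  neg_mem' ha t m hm := neg_mem (ha t m hm)

theorem mul_mem_endFiltration (s t : ℕ) (f g : Module.End R (PowSum x n))
    (hf : f ∈ endFiltration x n s) (hg : g ∈ endFiltration x n t) :
    f * g ∈ endFiltration x n (s + t) := fun p m hm => by
  rw [Module.End.mul_apply, add_comm s, ← add_assoc]
  exact hf _ _ (hg _ _ hm)

/-- An endomorphism raises the weight by at least `s ≤ 1` as soon as its diagonal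
coefficients are divisible by `x ^ s`. -/
theorem mem_endFiltration_of_coeff (H : IsTruncated x n ε) {f : Module.End R (PowSum x n)} {s : ℕ}
    (hs : s ≤ 1) (hf : ∀ i, x ^ s ∣ coeff H f i i) : f ∈ endFiltration x n s := by
  intro t m hm i
  rw [coe_apply H]
  refine Finset.dvd_sum fun j _ => ?_
  obtain ⟨r, hr⟩ := hm j
  rw [hr]
  by_cases h : i = j
  · subst h
    obtain ⟨b, hb⟩ := hf i
    rw [hb]
    refine (pow_dvd_pow x (by omega : _ ≤ s + (t + i + 1) / 2)).trans ⟨b * r, ?_⟩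
    rw [pow_add, Nat.sub_self]
    ring
  · have h' : (i : ℕ) ≠ j := fun h' => h (Fin.ext h')
    refine (pow_dvd_pow x (by omega : _ ≤ ((i : ℕ) - j) + (t + j + 1) / 2)).trans
      ⟨coeff H f i j * r, ?_⟩
    rw [pow_add]
    ring

theorem eq_zero_of_mem_endFiltration (H : IsTruncated x n ε) (f : Module.End R (PowSum x n))
    (hf : f ∈ endFiltration x n (2 * n)) : f = 0 := by
  refine LinearMap.ext fun m => ext_coe fun i => ?_
  have hm : m ∈ weightFiltration x n 0 := fun i =>
    (pow_dvd_pow x (by omega)).trans (mem_span_pow.1 (m i).2)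
  have h := (pow_dvd_pow x (by omega : n ≤ _)).trans (hf 0 m hm i)
  rw [H.pow_eq_zero, zero_dvd_iff] at h
  simp [h]

theorem entry_coeff_mem_endFiltration (H : IsTruncated x n ε) {s : ℕ}
    {f : Module.End R (PowSum x n)} (hf : f ∈ endFiltration x n s) (i j : Fin n) :
    entry x i j (coeff H f i j) ∈ endFiltration x n s := by
  intro t m hm l
  rw [entry_apply]
  split_ifs with h
  · subst h
    rw [← coeff_spec H]
    exact hf t _ (single_mem_weightFiltration hm j) l
  · exact dvd_zero _

theorem entry_congr (i j : Fin n) {a b : R}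
    (h : x ^ ((i : ℕ) - j) * a * x ^ (j : ℕ) = x ^ ((i : ℕ) - j) * b * x ^ (j : ℕ)) :
    entry x i j a = entry x i j b := by
  refine LinearMap.ext fun m => ext_coe fun l => ?_
  rw [entry_apply, entry_apply]
  obtain ⟨r, hr⟩ := mem_span_pow.1 (m j).2
  rw [hr, ← mul_assoc, h, mul_assoc]

theorem entry_diag_coeff (H : IsTruncated x n ε) {f : Module.End R (PowSum x n)}
    (hf : f ∈ endFiltration x n 1) (i : Fin n) :
    ∃ b, entry x i i (coeff H f i i) = entry x i i (x * b) := by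
  let g : PowSum x n := Pi.single i ⟨x ^ (i : ℕ), mem_span_pow.2 dvd_rfl⟩
  have hg : g ∈ weightFiltration x n i := by
    intro l
    by_cases h : l = i
    · subst h
      simpa [g] using pow_dvd_pow x (by omega : ((l : ℕ) + l + 1) / 2 ≤ l)
    · simp [g, h]
  obtain ⟨b, hb⟩ := hf i _ (single_mem_weightFiltration hg i) i
  rw [coeff_spec H] at hb
  refine ⟨b, entry_congr i i ?_⟩
  rw [(by omega : ((i : ℕ) + 1 + i + 1) / 2 = i + 1)] at hb
  simp only [g, Pi.single_eq_same] at hb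
  rw [hb, Nat.sub_self]
  ring

theorem one_add_entry_mem_of_ne {c : R} (hc : IsUnit c) (hc1 : IsUnit (c - 1)) {i j : Fin n}
    (hij : i ≠ j) (a : R) :
    1 + entry x i j a ∈ commutatorUnits (Module.End R (PowSum x n)) :=
  one_add_mem_commutatorUnits (e := entry x i i 1) hc hc1 (entry_mul_entry _ _ _ _ _ (by simp))
    (entry_mul_entry _ _ _ _ _ (by simp)) (entry_mul_entry_of_ne hij.symm _ _)

theorem one_add_entry_diag_mem (H : IsTruncated x n ε) {c : R} (hc : IsUnit c)
    (hc1 : IsUnit (c - 1)) (a : R) (i : Fin n) :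
    1 + entry x i i (x * a) ∈ commutatorUnits (Module.End R (PowSum x n)) := by
  suffices h : ∀ d, ∀ i : Fin n, (i : ℕ) + 1 + d = n →
      1 + entry x i i (x * a) ∈ commutatorUnits (Module.End R (PowSum x n)) from
    h (n - (i + 1)) i (by omega)
  intro d
  induction d with
  | zero =>
    intro i hi
    have : entry x i i (x * a) = 0 := by
      refine LinearMap.ext fun m => ext_coe fun l => ?_
      obtain ⟨r, hr⟩ := mem_span_pow.1 (m i).2
      have h0 : x ^ ((i : ℕ) - i) * (x * a) * (x ^ (i : ℕ) * r) = x ^ ((i : ℕ) + 1) * (a * r) := by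
        rw [Nat.sub_self, pow_succ]; ring
      rw [entry_apply, hr, h0, (by omega : (i : ℕ) + 1 = n), H.pow_eq_zero]
      simp
    rw [this, add_zero]
    exact one_mem _
  | succ d ih =>
    intro i hi
    let j : Fin n := ⟨i + 1, by omega⟩
    have hj : (j : ℕ) = i + 1 := rfl
    have hij : i ≠ j := fun h => by have := congrArg Fin.val h; omega
    have h1 : (i : ℕ) - j = 0 := by omega
    have h2 : (j : ℕ) - i = 1 := by omega
    have hab : entry x i j a * entry x j i 1 = entry x i i (x * a) :=
      entry_mul_entry _ _ _ _ _ (by rw [h1, h2, Nat.sub_self]; ring)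
    have hba : entry x j i 1 * entry x i j a = entry x j j (x * a) :=
      entry_mul_entry _ _ _ _ _ (by rw [h1, h2, Nat.sub_self]; ring)
    rw [← hab]
    refine one_add_mul_mem_commutatorUnits (e := entry x i i 1) (f := entry x j j 1) hc hc1
      (entry_mul_entry _ _ _ _ _ (by simp)) (entry_mul_entry _ _ _ _ _ (by simp))
      (entry_mul_entry _ _ _ _ _ (by simp)) (entry_mul_entry_of_ne hij.symm _ _)
      (entry_mul_entry _ _ _ _ _ (by simp)) (entry_mul_entry_of_ne hij _ _) ?_
    rw [hba]
    exact ih j (by omega)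

theorem mem_commutatorUnits_of_diagHom_eq_one (H : IsTruncated x n ε) {c : R} (hc : IsUnit c)
    (hc1 : IsUnit (c - 1)) {f : Module.End R (PowSum x n)} (hf : diagHom H f = 1) :
    f ∈ commutatorUnits (Module.End R (PowSum x n)) := by
  have hf1 : f - 1 ∈ endFiltration x n 1 := by
    refine mem_endFiltration_of_coeff H le_rfl fun i => ?_
    rw [pow_one]
    refine H.dvd_of_map_eq_zero _ ?_
    rw [map_coeff_eq H (f - 1) i (coeff H f i i - 1) fun m => ?_]
    · rw [map_sub, map_one, sub_eq_zero]
      exact congrFun hf i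
    · simp [coeff_spec H, sub_mul]
  rw [← add_sub_cancel 1 f]
  refine one_add_mem_commutatorUnits_of_filtration (endFiltration x n)
    (fun s g hg t m hm => weightFiltration_anti (by omega) (hg t m hm)) mul_mem_endFiltration
    (fun g => mem_endFiltration_of_coeff H zero_le_one (by simp))
    (eq_zero_of_mem_endFiltration H) Finset.univ
    (fun (p : Fin n × Fin n) g => entry x p.1 p.2 (coeff H g p.1 p.2))
    (fun s g hg p => entry_coeff_mem_endFiltration H hg p.1 p.2) (sum_entry H) ?_ hf1
  rintro g hg ⟨i, j⟩
  by_cases hij : i = j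
  · subst hij
    obtain ⟨b, hb⟩ := entry_diag_coeff H hg i
    simp only [hb]
    exact one_add_entry_diag_mem H hc hc1 b i
  · exact one_add_entry_mem_of_ne hc hc1 hij _

/-- The diagonal endomorphism with the given coefficients. -/
def diagonal (x : R) (c : Fin n → R) : Module.End R (PowSum x n) :=
  LinearMap.pi fun i => c i • LinearMap.proj i

theorem diagonal_apply (c : Fin n → R) (m : PowSum x n) (i : Fin n) :
    (diagonal x c m i : R) = c i * (m i : R) := rfl

theorem diagonal_mul_diagonal (c d : Fin n → R) (h : ∀ i, c i * d i = 1) :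
    diagonal x c * diagonal x d = 1 := by
  refine LinearMap.ext fun m => ext_coe fun i => ?_
  rw [Module.End.mul_apply, diagonal_apply, diagonal_apply, ← mul_assoc, h, one_mul]
  rfl

/-- The diagonal residues of an automorphism. -/
def unitsDiagHom (H : IsTruncated x n ε) : (Module.End R (PowSum x n))ˣ →* (Fin n → kˣ) :=
  (MulEquiv.piUnits (M := fun _ : Fin n => k)).toMonoidHom.comp (Units.map (diagHom H))

theorem coe_unitsDiagHom (H : IsTruncated x n ε) (u : (Module.End R (PowSum x n))ˣ) (i : Fin n) :
    (unitsDiagHom H u i : k) = ε (coeff H u i i) := rfl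

theorem unitsDiagHom_surjective (H : IsTruncated x n ε) (C : k →+* R) (hC : ∀ a, ε (C a) = a) :
    Function.Surjective (unitsDiagHom H) := by
  intro c
  refine ⟨⟨diagonal x fun i => C (c i), diagonal x fun i => C (c i)⁻¹,
    diagonal_mul_diagonal _ _ fun i => by simp [← map_mul],
    diagonal_mul_diagonal _ _ fun i => by simp [← map_mul]⟩, ?_⟩
  funext i
  ext
  rw [coe_unitsDiagHom, map_coeff_eq H _ i (C (c i)) fun m => by simp [diagonal_apply], hC]

theorem ker_unitsDiagHom (H : IsTruncated x n ε) {c : R} (hc : IsUnit c) (hc1 : IsUnit (c - 1)) :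
    (unitsDiagHom H).ker = commutator (Module.End R (PowSum x n))ˣ := by
  refine le_antisymm (fun u hu => ?_) (Abelianization.commutator_subset_ker _)
  obtain ⟨v, hv, hvu⟩ := mem_commutatorUnits.1
    (mem_commutatorUnits_of_diagHom_eq_one H hc hc1 (f := u)
      (funext fun i =>
        congrArg Units.val (congrFun (MonoidHom.mem_ker.1 hu) i)))
  rwa [← Units.ext hvu]

end PowSum

theorem TruncPoly.exists_isTruncated (k : Type*) [Field k] {n : ℕ} (hn : 1 ≤ n) :
    ∃ ε : TruncPoly k n →+* k, (∀ a, ε (algebraMap k _ a) = a) ∧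
      IsTruncated (Ideal.Quotient.mk (Ideal.span {(Polynomial.X : Polynomial k) ^ n})
        Polynomial.X) n ε := by
  have h0 : n ≠ 0 := by omega
  refine ⟨Ideal.Quotient.lift _ Polynomial.constantCoeff fun a ha => ?_, fun a => ?_,
    ?_, ?_, ?_, ?_⟩
  · obtain ⟨b, rfl⟩ := Ideal.mem_span_singleton.1 ha
    simp [h0.symm]
  · exact (Ideal.Quotient.lift_mk _ _ _).trans (Polynomial.coeff_C_zero)
  · simp
  · intro a ha
    obtain ⟨p, rfl⟩ := Ideal.Quotient.mk_surjective a
    rw [Ideal.Quotient.lift_mk] at ha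
    exact map_dvd _ (Polynomial.X_dvd_iff.2 ha)
  · rw [← map_pow, Ideal.Quotient.eq_zero_iff_mem]
    exact Ideal.mem_span_singleton_self _
  · intro i hi a ha
    obtain ⟨p, rfl⟩ := Ideal.Quotient.mk_surjective a
    rw [← map_pow, ← map_mul, Ideal.Quotient.eq_zero_iff_mem, Ideal.mem_span_singleton,
      ← Nat.add_sub_of_le hi, pow_add] at ha
    rw [← map_pow]
    exact map_dvd _ (by
      simpa using (mul_dvd_mul_iff_left (pow_ne_zero i Polynomial.X_ne_zero)).1 ha)

/-- Let `k` be an algebraically closed field of characteristic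
not two, `n ≥ 1`, `R = k[X]/(Xⁿ)`, `𝔪 = (X)R`, and
`M = R ⊕ 𝔪 ⊕ 𝔪² ⊕ ⋯ ⊕ 𝔪^(n-1)`.  Then the abelianization of `Aut_R(M)` is
isomorphic to `(kˣ)^n`. -/
theorem stmt7 {k : Type u} [Field k] [IsAlgClosed k] (hchar : ringChar k ≠ 2)
    (n : ℕ) (hn : 1 ≤ n) :
    Nonempty
      (Abelianization
        (Module.End (TruncPoly k n)
          (∀ i : Fin n, ↥(TruncPoly.maxIdeal k n ^ (i : ℕ))))ˣ
        ≃* (Fin n → kˣ)) := by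
  obtain ⟨ε, hε, H⟩ := TruncPoly.exists_isTruncated k hn
  classical
  obtain ⟨c, hc⟩ := Set.Infinite.exists_notMem_finset (Set.infinite_univ (α := k)) 
    ({0, 1} : Finset k)
  simp only [Set.mem_univ, Finset.mem_insert, Finset.mem_singleton, not_or, true_and] at hc
  have hc0 : IsUnit (algebraMap k (TruncPoly k n) c) := (IsUnit.mk0 c hc.1).map _
  have hc1 : IsUnit (algebraMap k (TruncPoly k n) c - 1) := by
    rw [← map_one (algebraMap k (TruncPoly k n)), ← map_sub]
    exact (IsUnit.mk0 _ (sub_ne_zero.2 hc.2)).map _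
  exact ⟨(QuotientGroup.quotientMulEquivOfEq (PowSum.ker_unitsDiagHom H hc0 hc1).symm).trans
    (QuotientGroup.quotientKerEquivOfSurjective _
      (PowSum.unitsDiagHom_surjective H (algebraMap k _) hε))⟩

end
end

section
/- Let A be a Noetherian local Cohen–Macaulay integral domain of Krull dimension d > 1 that is an isolated singularity, i.e., the localization A_𝔭 is a regular local ring for every prime ideal 𝔭 different from the maximal ideal. Then for every ideal I of A of height one, the canonical ring homomorphism A → End_A(I), sending a ∈ A to the endomorphism of multiplication by a on I, is an isomorphism; in particular Hom_A(I, I) ≅ A. -/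
/-- A commutative ring is a regular local ring if it is Noetherian local and its
maximal ideal can be generated by a set of `d` elements, where `d` is the Krull
dimension. -/
def IsRegularLocal (S : Type*) [CommRing S] : Prop :=
  IsNoetherianRing S ∧ ∃ _ : IsLocalRing S,
    ∃ s : Finset S, Ideal.span (s : Set S) = IsLocalRing.maximalIdeal S ∧
      (s.card : WithBot ℕ∞) = ringKrullDim S

/-- A Noetherian local ring is Cohen–Macaulay if its maximal ideal contains a
regular sequence whose length is the Krull dimension (depth = dimension). -/
def IsCohenMacaulayLocal (A : Type*) [CommRing A] [IsLocalRing A] : Prop :=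
  ∃ rs : List A, (∀ r ∈ rs, r ∈ IsLocalRing.maximalIdeal A) ∧
    RingTheory.Sequence.IsRegular A rs ∧ (rs.length : WithBot ℕ∞) = ringKrullDim A

open IsLocalRing in
/-- If `n + 1` elements generate the maximal ideal of a local ring, then `n` elements generate the
maximal ideal of its quotient by an element outside the square of the maximal ideal. -/
theorem exists_finset_span_eq_maximalIdeal_quotient {R : Type*} [CommRing R] [IsLocalRing R]
    {n : ℕ} {s : Finset R} (hcard : s.card ≤ n + 1)
    (hs : Ideal.span (s : Set R) = maximalIdeal R) {t : R} (ht : t ∈ maximalIdeal R)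
    (ht2 : t ∉ maximalIdeal R ^ 2) [IsLocalRing (R ⧸ Ideal.span {t})] :
    ∃ s' : Finset (R ⧸ Ideal.span {t}), s'.card ≤ n ∧
      Ideal.span (s' : Set (R ⧸ Ideal.span {t})) = maximalIdeal (R ⧸ Ideal.span {t}) := by
  classical
  have hts : t ∈ Submodule.span R (s : Set R) := by
    change t ∈ Ideal.span (s : Set R)
    rwa [hs]
  obtain ⟨c, -, hc⟩ := Submodule.mem_span_finset.1 hts
  have hsm : ∀ x ∈ s, x ∈ maximalIdeal R := fun x hx => hs ▸ Ideal.subset_span hx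
  obtain ⟨x, hx, hcx⟩ : ∃ x ∈ s, IsUnit (c x) := by
    by_contra! h
    apply ht2
    rw [← hc, pow_two]
    exact Ideal.sum_mem _ fun x hx =>
      Ideal.mul_mem_mul ((mem_maximalIdeal _).2 (h x hx)) (hsm x hx)
  refine ⟨(s.erase x).image (Ideal.Quotient.mk _), ?_, ?_⟩
  · have := Finset.card_erase_of_mem hx
    exact Finset.card_image_le.trans (by omega)
  · have hsurj := Ideal.Quotient.mk_surjective (I := Ideal.span {t})
    have := IsLocalRing.map_maximalIdeal_of_surjective (Ideal.Quotient.mk (Ideal.span {t})) hsurj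
    rw [← this, ← hs, Ideal.map_span, Finset.coe_image]
    refine le_antisymm (Ideal.span_mono (Set.image_mono (by simp))) (Ideal.span_le.2 ?_)
    rintro _ ⟨y, hy, rfl⟩
    by_cases hyx : y = x
    · subst hyx
      have h0 : ∑ z ∈ s, Ideal.Quotient.mk (Ideal.span {t}) (c z * z) = 0 := by
        rw [← map_sum]
        simp only [smul_eq_mul] at hc
        rw [hc, Ideal.Quotient.eq_zero_iff_mem]
        exact Ideal.mem_span_singleton_self t
      rw [← Finset.add_sum_erase _ _ hx, map_mul] at h0
      refine (Ideal.unit_mul_mem_iff_mem _ (hcx.map (Ideal.Quotient.mk (Ideal.span {t})))).1 ?_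
      rw [eq_neg_of_add_eq_zero_left h0]
      refine neg_mem (Ideal.sum_mem _ fun z hz => ?_)
      rw [map_mul]
      exact Ideal.mul_mem_left _ _ (Ideal.subset_span ⟨z, hz, rfl⟩)
    · exact Ideal.subset_span ⟨y, by simpa [hyx] using hy, rfl⟩

open IsLocalRing in
/-- The Krull dimension of a Noetherian local ring drops by at most one modulo an element of the
maximal ideal. -/
theorem natCast_le_ringKrullDim_quotient_span_singleton {R : Type*} [CommRing R]
    [IsNoetherianRing R] [IsLocalRing R] {n : ℕ} (hn : ((n + 1 : ℕ) : WithBot ℕ∞) ≤ ringKrullDim R)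
    {t : R} (ht : t ∈ maximalIdeal R) :
    (n : WithBot ℕ∞) ≤ ringKrullDim (R ⧸ Ideal.span {t}) := by
  have h := Ideal.height_le_ringKrullDim_quotient_add_one ht
  rw [maximalIdeal_height_eq_ringKrullDim] at h
  have h' := hn.trans h
  rw [Nat.cast_add, Nat.cast_one] at h'
  cases hq : ringKrullDim (R ⧸ Ideal.span {t}) with
  | bot => rw [hq] at h'; simp at h'
  | coe m =>
    rw [hq] at h'
    have h2 : (n : ℕ∞) + 1 ≤ m + 1 := by exact_mod_cast h'
    exact_mod_cast (ENat.add_le_add_iff_right ENat.one_ne_top).1 h2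

open IsLocalRing in
theorem maximalIdeal_ne_bot_of_pos_le_ringKrullDim {R : Type*} [CommRing R]
    [IsLocalRing R] {n : ℕ} (hn : ((n + 1 : ℕ) : WithBot ℕ∞) ≤ ringKrullDim R) :
    maximalIdeal R ≠ ⊥ := by
  intro h
  rw [ringKrullDim_eq_zero_of_isField (isField_iff_maximalIdeal_eq.2 h)] at hn
  exact absurd (by exact_mod_cast hn : n + 1 ≤ 0) (by omega)

open IsLocalRing in
theorem not_maximalIdeal_le_sq {R : Type*} [CommRing R]
    [IsNoetherianRing R] [IsLocalRing R] (h : maximalIdeal R ≠ ⊥) :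
    ¬ maximalIdeal R ≤ maximalIdeal R ^ 2 := by
  intro hle
  refine h (Submodule.eq_bot_of_le_smul_of_le_jacobson_bot (maximalIdeal R) _
    (IsNoetherian.noetherian _) ?_ (maximalIdeal_le_jacobson _))
  rwa [smul_eq_mul, ← pow_two]

open IsLocalRing in
/-- A Noetherian local ring whose maximal ideal is generated by `dim R` elements is a domain. -/
theorem isDomain_of_span_eq_maximalIdeal (n : ℕ) {R : Type*} [CommRing R]
    [IsNoetherianRing R] [IsLocalRing R] {s : Finset R} (hcard : s.card ≤ n)
    (hs : Ideal.span (s : Set R) = maximalIdeal R)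
    (hn : (n : WithBot ℕ∞) ≤ ringKrullDim R) : IsDomain R := by
  induction n generalizing R with
  | zero =>
    have : s = ∅ := by simpa using hcard
    subst this
    exact (isField_iff_maximalIdeal_eq.2 (by simpa using hs.symm)).isDomain
  | succ n ih =>
    have hbot := maximalIdeal_ne_bot_of_pos_le_ringKrullDim hn
    have hmin : maximalIdeal R ∉ minimalPrimes R := by
      intro h
      have := Ideal.height_eq_zero_iff.2 h
      rw [← maximalIdeal_height_eq_ringKrullDim, this] at hn
      exact absurd (by exact_mod_cast hn : n + 1 ≤ 0) (by omega)
    obtain ⟨t, ht, htn⟩ : ∃ t ∈ maximalIdeal R,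
        ∀ J ∈ insert (maximalIdeal R ^ 2) (minimalPrimes R), t ∉ J := by
      by_contra! h
      have hfin : (insert (maximalIdeal R ^ 2) (minimalPrimes R)).Finite :=
        (minimalPrimes.finite_of_isNoetherianRing R).insert _
      obtain ⟨J, hJ, hle⟩ := (Ideal.subset_union_prime_finite hfin (f := id)
        (maximalIdeal R ^ 2) (maximalIdeal R ^ 2) (fun J hJ hne _ =>
          ((Set.mem_insert_iff.1 hJ).resolve_left hne).1.1)).1
        (fun x hx => by simpa using h x hx)
      rcases Set.mem_insert_iff.1 hJ with rfl | hJ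
      · exact not_maximalIdeal_le_sq hbot hle
      · have : maximalIdeal R = J := (maximalIdeal.isMaximal R).eq_of_le hJ.1.1.ne_top hle
        exact hmin (this ▸ hJ)
    have : Nontrivial (R ⧸ Ideal.span {t}) :=
      Ideal.Quotient.nontrivial_iff.2 fun h => (maximalIdeal.isMaximal R).ne_top
        (top_le_iff.1 (h ▸ (Ideal.span_singleton_le_iff_mem _).2 ht))
    have : IsLocalRing (R ⧸ Ideal.span {t}) :=
      .of_surjective' (Ideal.Quotient.mk _) Ideal.Quotient.mk_surjective
    obtain ⟨s', hcard', hs'⟩ := exists_finset_span_eq_maximalIdeal_quotient hcard hs ht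
      (htn _ (Set.mem_insert _ _))
    have hdom := ih hcard' hs' (natCast_le_ringKrullDim_quotient_span_singleton hn ht)
    have hprime : (Ideal.span {t}).IsPrime := (Ideal.Quotient.isDomain_iff_prime _).1 hdom
    obtain ⟨q, hq, hqt⟩ := Ideal.exists_minimalPrimes_le (bot_le (a := Ideal.span {t}))
    have hqp : q.IsPrime := hq.1.1
    have htq : t ∉ q := htn q (Set.mem_insert_of_mem _ hq)
    have hq0 : q = ⊥ := by
      refine Submodule.eq_bot_of_le_smul_of_le_jacobson_bot (maximalIdeal R) _
        (IsNoetherian.noetherian _) (fun x hx => ?_) (maximalIdeal_le_jacobson _)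
      obtain ⟨y, rfl⟩ := Ideal.mem_span_singleton.1 (hqt hx)
      exact Ideal.mul_mem_mul ht ((hqp.mem_or_mem hx).resolve_left htq)
    subst hq0
    exact IsDomain.of_bot_isPrime R

open IsLocalRing in
/-- The maximal ideal of a regular local ring which is not a field contains a nonzero prime
element. -/
theorem exists_prime_mem_maximalIdeal {R : Type*} [CommRing R]
    [IsNoetherianRing R] [IsLocalRing R] {s : Finset R}
    (hs : Ideal.span (s : Set R) = maximalIdeal R)
    (hcard : (s.card : WithBot ℕ∞) = ringKrullDim R) (hbot : maximalIdeal R ≠ ⊥) :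
    ∃ t ∈ maximalIdeal R, Prime t := by
  obtain ⟨t, ht, ht2⟩ := SetLike.not_le_iff_exists.1 (not_maximalIdeal_le_sq hbot)
  obtain ⟨n, hn⟩ : ∃ n, s.card = n + 1 := by
    refine Nat.exists_eq_succ_of_ne_zero fun h => hbot ?_
    rw [Finset.card_eq_zero] at h
    rw [← hs, h]
    simp
  have : Nontrivial (R ⧸ Ideal.span {t}) :=
    Ideal.Quotient.nontrivial_iff.2 fun h => (maximalIdeal.isMaximal R).ne_top
      (top_le_iff.1 (h ▸ (Ideal.span_singleton_le_iff_mem _).2 ht))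
  have : IsLocalRing (R ⧸ Ideal.span {t}) :=
    .of_surjective' (Ideal.Quotient.mk _) Ideal.Quotient.mk_surjective
  obtain ⟨s', hcard', hs'⟩ := exists_finset_span_eq_maximalIdeal_quotient hn.le hs ht ht2
  have hdom := isDomain_of_span_eq_maximalIdeal n hcard' hs'
    (natCast_le_ringKrullDim_quotient_span_singleton (hn ▸ hcard.le) ht)
  refine ⟨t, ht, (Ideal.span_singleton_prime ?_).1 ((Ideal.Quotient.isDomain_iff_prime _).1 hdom)⟩
  rintro rfl
  exact ht2 (zero_mem _)

open IsLocalRing in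
/-- In a regular local domain, a fraction `b / a` which sends the maximal ideal into the ring and
a nonzero ideal into itself lies in the ring. -/
theorem dvd_of_forall_mem_maximalIdeal_dvd {R : Type*} [CommRing R] [IsDomain R]
    [IsNoetherianRing R] [IsLocalRing R] {s : Finset R}
    (hs : Ideal.span (s : Set R) = maximalIdeal R)
    (hcard : (s.card : WithBot ℕ∞) = ringKrullDim R) {a b : R} (ha : a ≠ 0)
    (hab : ∀ r ∈ maximalIdeal R, a ∣ r * b) {I : Ideal R} (hI : I ≠ ⊥)
    (hIab : ∀ i ∈ I, ∃ j ∈ I, i * b = a * j) : a ∣ b := by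
  by_contra hnot
  by_cases hbot : maximalIdeal R = ⊥
  · have hau : IsUnit a := by
      by_contra h
      exact ha (by simpa [hbot] using (mem_maximalIdeal a).2 h)
    exact hnot hau.dvd
  obtain ⟨t, ht, htp⟩ := exists_prime_mem_maximalIdeal hs hcard hbot
  obtain ⟨c, hc⟩ := hab t ht
  have htc : ¬ t ∣ c := by
    rintro ⟨v, rfl⟩
    exact hnot ⟨v, mul_left_cancel₀ htp.ne_zero (by linear_combination hc)⟩
  have hdvd : ∀ r ∈ maximalIdeal R, t ∣ r := by
    intro r hr
    obtain ⟨d, hd⟩ := hab r hr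
    have : r * c = t * d := mul_left_cancel₀ ha (by linear_combination t * hd - r * hc)
    exact (htp.dvd_or_dvd (Dvd.intro d this.symm)).resolve_right htc
  have hcu : IsUnit c := by
    by_contra h
    exact htc (hdvd c ((mem_maximalIdeal c).2 h))
  refine hI (Submodule.eq_bot_of_le_smul_of_le_jacobson_bot (maximalIdeal R) I
    (IsNoetherian.noetherian _) (fun i hi => ?_) (maximalIdeal_le_jacobson _))
  obtain ⟨j, hj, hij⟩ := hIab i hi
  have : c * i = t * j := mul_left_cancel₀ ha (by linear_combination t * hij - i * hc)
  refine (Ideal.unit_mul_mem_iff_mem _ hcu).1 ?_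
  rw [this]
  exact Ideal.mul_mem_mul ht hj

/-- A Cohen–Macaulay local domain of dimension at least two has depth at least two. -/
theorem IsCohenMacaulayLocal.exists_mem_maximalIdeal {A : Type*} [CommRing A] [IsDomain A]
    [IsLocalRing A] (hCM : IsCohenMacaulayLocal A) (hdim : 1 < ringKrullDim A) :
    ∃ r ∈ IsLocalRing.maximalIdeal A, ∃ s ∈ IsLocalRing.maximalIdeal A,
      r ≠ 0 ∧ ∀ u, r ∣ s * u → r ∣ u := by
  obtain ⟨rs, hmem, hreg, hlen⟩ := hCM
  rw [← hlen] at hdim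
  have hlen' : 1 < rs.length := by exact_mod_cast hdim
  match rs, hlen' with
  | r :: s :: l, _ =>
    have h := (RingTheory.Sequence.isWeaklyRegular_cons_iff A r _).1 hreg.toIsWeaklyRegular
    have h' := ((RingTheory.Sequence.isWeaklyRegular_cons_iff _ s _).1 h.2).1
    refine ⟨r, hmem r (by simp), s, hmem s (by simp), ?_, fun u hu => ?_⟩
    · rintro rfl
      exact one_ne_zero (h.1 (by simp : (0 : A) • (1 : A) = (0 : A) • (0 : A)))
    have key : ∀ x : A, (Submodule.Quotient.mk x : QuotSMulTop r A) = 0 ↔ r ∣ x := by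
      intro x
      rw [Submodule.Quotient.mk_eq_zero, ← Submodule.ideal_span_singleton_smul, smul_eq_mul,
        Ideal.mul_top, Ideal.mem_span_singleton]
    refine (key u).1 (h' ?_)
    change s • (Submodule.Quotient.mk u : QuotSMulTop r A) =
      s • (0 : QuotSMulTop r A)
    rw [smul_zero, ← Submodule.Quotient.mk_smul, smul_eq_mul]
    exact (key _).2 hu

/-- In a Cohen–Macaulay local domain of dimension at least two with an isolated singularity, a
fraction `b / a` sending a nonzero ideal into itself lies in the ring. -/
theorem IsCohenMacaulayLocal.dvd_of_forall_mem {A : Type*} [CommRing A] [IsDomain A]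
    [IsNoetherianRing A] [IsLocalRing A]
    (hCM : IsCohenMacaulayLocal A) (hdim : 1 < ringKrullDim A)
    (hiso : ∀ (p : Ideal A) (_ : p.IsPrime), p ≠ IsLocalRing.maximalIdeal A →
      IsRegularLocal (Localization.AtPrime p))
    {I : Ideal A} (hI : I ≠ ⊥) {a b : A} (ha : a ≠ 0)
    (hIab : ∀ i ∈ I, ∃ j ∈ I, i * b = a * j) : a ∣ b := by
  by_contra hnot
  obtain ⟨p, hpp, c, hpc⟩ : ∃ p : Ideal A, p.IsPrime ∧ ∃ c : A, ∀ r, r ∈ p ↔ a ∣ r * (c * b) := by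
    let x : A ⧸ Ideal.span {a} := Ideal.Quotient.mk _ b
    have hx : (Submodule.span A {x} : Submodule A (A ⧸ Ideal.span {a})) ≠ ⊥ := by
      rwa [Ne, Submodule.span_singleton_eq_bot, Ideal.Quotient.eq_zero_iff_mem,
        Ideal.mem_span_singleton]
    obtain ⟨⟨y, hy⟩, hy0⟩ := Submodule.nonzero_mem_of_bot_lt (bot_lt_iff_ne_bot.2 hx)
    obtain ⟨p, hp, -⟩ := exists_le_isAssociatedPrime_of_isNoetherianRing A _ hy0
    obtain ⟨hpp, ⟨z, hz⟩, hpz⟩ := isAssociatedPrime_iff.1 hp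
    obtain ⟨c, rfl⟩ := Submodule.mem_span_singleton.1 hz
    refine ⟨p, hpp, c, fun r => ?_⟩
    rw [hpz, Submodule.mem_colon_singleton, Submodule.mem_bot, ← Ideal.mem_span_singleton,
      ← Ideal.Quotient.eq_zero_iff_mem, Subtype.ext_iff]
    rfl
  have hnot' : ¬ a ∣ c * b := fun h =>
    hpp.ne_top ((Ideal.eq_top_iff_one _).2 ((hpc 1).2 (by rwa [one_mul])))
  by_cases hpm : p = IsLocalRing.maximalIdeal A
  · obtain ⟨r, hr, s, hs, hr0, hrs⟩ := hCM.exists_mem_maximalIdeal hdim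
    obtain ⟨u, hu⟩ := (hpc r).1 (hpm ▸ hr)
    obtain ⟨v, hv⟩ := (hpc s).1 (hpm ▸ hs)
    have hsu : s * u = r * v := mul_left_cancel₀ ha (by linear_combination r * hv - s * hu)
    obtain ⟨w, rfl⟩ := hrs u (Dvd.intro v hsu.symm)
    exact hnot' ⟨w, mul_left_cancel₀ hr0 (by linear_combination hu)⟩
  · obtain ⟨hnoeth, hloc, s, hs, hcard⟩ := hiso p hpp hpm
    let f := algebraMap A (Localization.AtPrime p)
    have hdom : IsDomain (Localization.AtPrime p) :=
      IsLocalization.isDomain_localization p.primeCompl_le_nonZeroDivisors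
    have hinj : Function.Injective f :=
      IsLocalization.injective _ p.primeCompl_le_nonZeroDivisors
    have hdvd : f a ∣ f (c * b) := by
      refine dvd_of_forall_mem_maximalIdeal_dvd hs hcard (I := I.map f)
        ((map_ne_zero_iff f hinj).2 ha) (fun r hr => ?_)
        (fun h => hI ((Ideal.map_eq_bot_iff_of_injective hinj).1 h)) (fun i hi => ?_)
      · rw [← Localization.AtPrime.map_eq_maximalIdeal] at hr
        rw [← Ideal.mem_span_singleton]
        refine Submodule.span_induction (p := fun r _ => r * f (c * b) ∈ Ideal.span {f a})
          ?_ (by simp) (fun x y _ _ hx hy => by rw [add_mul]; exact add_mem hx hy)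
          (fun x y _ hy => by rw [smul_eq_mul, mul_assoc]; exact Ideal.mul_mem_left _ _ hy) hr
        rintro _ ⟨r, hr, rfl⟩
        rw [Ideal.mem_span_singleton, ← map_mul]
        exact map_dvd f ((hpc r).1 hr)
      · refine Submodule.span_induction
          (p := fun i _ => ∃ j ∈ I.map f, i * f (c * b) = f a * j) ?_
          ⟨0, zero_mem _, by simp⟩ ?_ ?_ hi
        · rintro _ ⟨i, hi, rfl⟩
          obtain ⟨j, hj, hij⟩ := hIab i hi
          refine ⟨f (c * j), Ideal.mem_map_of_mem f (I.mul_mem_left c hj), ?_⟩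
          rw [← map_mul, ← map_mul]
          exact congrArg f (by linear_combination c * hij)
        · rintro x y - - ⟨j, hj, hxj⟩ ⟨k, hk, hyk⟩
          exact ⟨j + k, add_mem hj hk, by rw [add_mul, mul_add, hxj, hyk]⟩
        · rintro x y - ⟨j, hj, hyj⟩
          exact ⟨x * j, Ideal.mul_mem_left _ _ hj, by
            rw [smul_eq_mul]; linear_combination x * hyj⟩
    obtain ⟨q, hq⟩ := hdvd
    obtain ⟨⟨g, d⟩, hgd⟩ := IsLocalization.surj p.primeCompl q
    refine d.2 ((hpc d).2 ⟨g, hinj ?_⟩)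
    change f (d * (c * b)) = f (a * g)
    rw [map_mul f d.1, map_mul f a, hq]
    linear_combination f a * hgd

/-- Let `A` be a Noetherian local Cohen–Macaulay integral
domain of Krull dimension `d > 1` which is an isolated singularity.  Then for
every ideal `I` of height one (the height being the infimum of the heights of
the primes containing `I`), the canonical ring homomorphism
`A → End_A I`, `a ↦ (a • ·)`, is an isomorphism; in particular
`Hom_A(I, I) ≅ A`. -/
theorem stmt11 {A : Type*} [CommRing A] [IsDomain A] [IsNoetherianRing A] [IsLocalRing A]
    (hCM : IsCohenMacaulayLocal A)
    (hdim : 1 < ringKrullDim A)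
    (hiso : ∀ (p : Ideal A) (_ : p.IsPrime), p ≠ IsLocalRing.maximalIdeal A →
      IsRegularLocal (Localization.AtPrime p))
    (I : Ideal A)
    (hht : (⨅ (p : PrimeSpectrum A) (_ : I ≤ p.asIdeal), Order.height p) = 1) :
    Function.Bijective (algebraMap A (Module.End A ↥I)) := by
  have hI : I ≠ ⊥ := by
    rintro rfl
    have h : (⨅ (p : PrimeSpectrum A) (_ : ⊥ ≤ p.asIdeal), Order.height p) ≤
        Order.height (⊥ : PrimeSpectrum A) := iInf₂_le _ bot_le
    rw [hht, Order.height_bot] at h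
    exact absurd h (by simp)
  obtain ⟨a, haI, ha⟩ := Submodule.exists_mem_ne_zero_of_ne_bot hI
  constructor
  · intro x y hxy
    have h := congrArg Subtype.val (LinearMap.congr_fun hxy ⟨a, haI⟩)
    exact mul_right_cancel₀ ha h
  · intro φ
    have hφ : ∀ i : I, (i : A) * φ ⟨a, haI⟩ = a * φ i := by
      intro i
      have h : i.1 • (⟨a, haI⟩ : I) = a • i := Subtype.ext (mul_comm _ _)
      have h' := congrArg (fun z => ((φ z : I) : A)) h
      simp only [map_smul] at h'
      exact h'
    obtain ⟨x, hx⟩ := hCM.dvd_of_forall_mem hdim hiso hI ha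
      (fun i hi => ⟨φ ⟨i, hi⟩, (φ ⟨i, hi⟩).2, hφ ⟨i, hi⟩⟩)
    refine ⟨x, LinearMap.ext fun i => Subtype.ext (mul_left_cancel₀ ha ?_)⟩
    change a * (x * i) = a * φ i
    rw [← hφ i, hx]
    ring
end

section
/- Let A be a Noetherian local Cohen–Macaulay integral domain of Krull dimension d > 1 that is an isolated singularity, i.e., the localization A_𝔭 is a regular local ring for every prime ideal 𝔭 different from the maximal ideal. Let I be an ideal of A of height one and let x ∈ I be a nonzero element. Then the colon ideal (xI :_A I) = { a ∈ A : aI ⊆ xI } equals the principal ideal xA. -/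
section

open IsLocalRing

/-- If the maximal ideal of a Noetherian local ring is not a minimal prime, it has an element
outside its square and all minimal primes. -/
theorem exists_mem_maximalIdeal_notMem_sq_notMem_minimalPrimes {R : Type*} [CommRing R]
    [IsNoetherianRing R] [IsLocalRing R] (h : maximalIdeal R ∉ minimalPrimes R) :
    ∃ x ∈ maximalIdeal R, x ∉ maximalIdeal R ^ 2 ∧ ∀ P ∈ minimalPrimes R, x ∉ P := by
  by_contra! H
  have hfin : (insert (maximalIdeal R ^ 2) (minimalPrimes R)).Finite :=
    (minimalPrimes.finite_of_isNoetherianRing R).insert _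
  have hsub : (maximalIdeal R : Set R) ⊆
      ⋃ i ∈ insert (maximalIdeal R ^ 2) (minimalPrimes R), (id i : Ideal R) := by
    intro x hx
    by_cases hx2 : x ∈ maximalIdeal R ^ 2
    · exact Set.mem_biUnion (Set.mem_insert _ _) hx2
    · obtain ⟨P, hP, hxP⟩ := H x hx hx2
      exact Set.mem_biUnion (Set.mem_insert_of_mem _ hP) hxP
  obtain ⟨J, hJ, hle⟩ := (Ideal.subset_union_prime_finite hfin (f := id)
    (maximalIdeal R ^ 2) (maximalIdeal R ^ 2)
    (fun i hi hne _ ↦ (hi.resolve_left hne).isPrime)).1 hsub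
  rcases hJ with rfl | hJ
  · have hbot : maximalIdeal R = ⊥ :=
      Submodule.eq_bot_of_le_smul_of_le_jacobson_bot (maximalIdeal R) _
        (IsNoetherian.noetherian _) (by simpa [sq] using hle) (maximalIdeal_le_jacobson _)
    refine h ⟨⟨inferInstance, bot_le⟩, fun q _ _ ↦ ?_⟩
    rw [hbot]; exact bot_le
  · have := hJ.isPrime
    have : maximalIdeal R = J := le_antisymm hle (le_maximalIdeal hJ.isPrime.ne_top)
    exact h (this ▸ hJ)

/-- An element of the maximal ideal outside its square is part of a generating set of the same
size as any given one. -/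
theorem exists_finset_card_lt_span_insert_eq_maximalIdeal {R : Type*} [CommRing R]
    [IsLocalRing R] {s : Finset R} (hs : Ideal.span (s : Set R) = maximalIdeal R) {x : R}
    (hx : x ∈ maximalIdeal R) (hx2 : x ∉ maximalIdeal R ^ 2) :
    ∃ t : Finset R, t.card < s.card ∧
      Ideal.span (insert x (t : Set R)) = maximalIdeal R := by
  classical
  have hmem : ∀ a ∈ s, a ∈ maximalIdeal R := fun a ha ↦ hs ▸ Ideal.subset_span ha
  obtain ⟨f, -, hf⟩ := Submodule.mem_span_finset.1 (hs.symm ▸ hx : x ∈ Ideal.span (s : Set R))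
  obtain ⟨a, ha, hfa⟩ : ∃ a ∈ s, IsUnit (f a) := by
    by_contra! H
    refine hx2 (hf ▸ Ideal.sum_mem _ fun a ha ↦ ?_)
    rw [sq, smul_eq_mul]
    exact Ideal.mul_mem_mul ((mem_maximalIdeal _).2 (H a ha)) (hmem a ha)
  refine ⟨s.erase a, Finset.card_erase_lt_of_mem ha, le_antisymm ?_ ?_⟩
  · rw [Ideal.span_le, Set.insert_subset_iff]
    exact ⟨hx, fun b hb ↦ hmem b (Finset.mem_of_mem_erase hb)⟩
  · rw [← hs, Ideal.span_le]
    have hin : ∀ b ∈ s.erase a,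
        b ∈ Ideal.span (insert x ((s.erase a : Finset R) : Set R)) :=
      fun b hb ↦ Ideal.subset_span (Set.mem_insert_of_mem _ hb)
    intro b hb
    by_cases hba : b = a
    · subst hba
      rw [← Finset.add_sum_erase _ _ hb] at hf
      refine (Ideal.unit_mul_mem_iff_mem _ hfa).1 ?_
      rw [← smul_eq_mul, eq_sub_of_add_eq hf]
      exact sub_mem (Ideal.subset_span (Set.mem_insert _ _))
        (Ideal.sum_mem _ fun c hc ↦ Ideal.mul_mem_left _ _ (hin c hc))
    · exact hin b (Finset.mem_erase.2 ⟨hba, hb⟩)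

/-- If the quotient of a Noetherian local ring by an element `x` of the maximal ideal avoiding
the minimal primes is a domain, then so is the ring. -/
theorem isDomain_of_isPrime_span_singleton {R : Type*} [CommRing R] [IsNoetherianRing R]
    [IsLocalRing R] {x : R} (hx : x ∈ maximalIdeal R) (hmin : ∀ P ∈ minimalPrimes R, x ∉ P)
    (hp : (Ideal.span {x}).IsPrime) : IsDomain R := by
  obtain ⟨P, hP, hPx⟩ := Ideal.exists_minimalPrimes_le (bot_le (a := Ideal.span {x}))
  have hPprime := hP.isPrime
  have hbot : P = ⊥ := by
    refine Submodule.eq_bot_of_le_smul_of_le_jacobson_bot (maximalIdeal R) P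
      (IsNoetherian.noetherian _) (fun y hy ↦ ?_) (maximalIdeal_le_jacobson _)
    obtain ⟨z, rfl⟩ := Ideal.mem_span_singleton.1 (hPx hy)
    exact Ideal.mul_mem_mul hx ((hPprime.mem_or_mem hy).resolve_left (hmin P hP))
  subst hbot
  exact IsDomain.of_bot_isPrime R

theorem maximalIdeal_notMem_minimalPrimes {R : Type*} [CommRing R] [IsLocalRing R]
    (h : 0 < ringKrullDim R) : maximalIdeal R ∉ minimalPrimes R := by
  intro hm
  rw [← Ideal.height_eq_zero_iff] at hm
  rw [← maximalIdeal_height_eq_ringKrullDim, hm] at h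
  exact lt_irrefl _ h

/-- Passing to the quotient by an element of the maximal ideal outside its square preserves
the property that the maximal ideal is generated by at most `dim R` elements. -/
theorem exists_span_eq_maximalIdeal_quotient {R : Type*} [CommRing R] [IsNoetherianRing R]
    [IsLocalRing R] {s : Finset R} (hs : Ideal.span (s : Set R) = maximalIdeal R)
    (hcard : (s.card : WithBot ℕ∞) ≤ ringKrullDim R) {x : R} (hx : x ∈ maximalIdeal R)
    (hx2 : x ∉ maximalIdeal R ^ 2) [IsLocalRing (R ⧸ Ideal.span {x})] :
    ∃ t : Finset (R ⧸ Ideal.span {x}), t.card < s.card ∧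
      Ideal.span (t : Set (R ⧸ Ideal.span {x})) = maximalIdeal (R ⧸ Ideal.span {x}) ∧
      (t.card : WithBot ℕ∞) ≤ ringKrullDim (R ⧸ Ideal.span {x}) := by
  classical
  obtain ⟨t, ht, hspan⟩ := exists_finset_card_lt_span_insert_eq_maximalIdeal hs hx hx2
  let π := Ideal.Quotient.mk (Ideal.span {x})
  have hπ : Function.Surjective π := Ideal.Quotient.mk_surjective
  have hle : (t.image π).card ≤ t.card := Finset.card_image_le
  refine ⟨t.image π, by omega, ?_, ?_⟩
  · rw [← map_maximalIdeal_of_surjective π hπ, ← hspan, Ideal.map_span, Set.image_insert_eq,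
      Finset.coe_image, Ideal.Quotient.eq_zero_iff_mem.2 (Ideal.mem_span_singleton_self x),
      Ideal.span_insert_zero]
  · have h1 := Ideal.height_le_ringKrullDim_quotient_add_one hx
    rw [maximalIdeal_height_eq_ringKrullDim] at h1
    have h2 : (((t.image π).card : ℕ) : WithBot ℕ∞) + 1 ≤
        ringKrullDim (R ⧸ Ideal.span {x}) + 1 := by
      refine le_trans ?_ (hcard.trans h1)
      exact_mod_cast (by omega : (t.image π).card + 1 ≤ s.card)
    exact ENat.WithBot.add_le_add_one_right_iff.1 h2

theorem isLocalRing_quotient_span_singleton {R : Type*} [CommRing R] [IsLocalRing R] {x : R}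
    (hx : x ∈ maximalIdeal R) : IsLocalRing (R ⧸ Ideal.span {x}) :=
  have : Nontrivial (R ⧸ Ideal.span {x}) :=
    Ideal.Quotient.nontrivial_iff.2 fun h ↦ hx (Ideal.span_singleton_eq_top.1 h)
  IsLocalRing.of_surjective' (Ideal.Quotient.mk _) Ideal.Quotient.mk_surjective

/-- A Noetherian local ring whose maximal ideal is generated by at most `dim R` elements is a
domain. -/
theorem isDomain_of_span_eq_maximalIdeal_of_card_le {R : Type*} [CommRing R] [IsNoetherianRing R]
    [IsLocalRing R] {s : Finset R} (hs : Ideal.span (s : Set R) = maximalIdeal R)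
    (hcard : (s.card : WithBot ℕ∞) ≤ ringKrullDim R) : IsDomain R := by
  induction hn : s.card using Nat.strong_induction_on generalizing R with
  | _ n ih =>
    rcases Nat.eq_zero_or_pos n with rfl | hpos
    · rw [Finset.card_eq_zero] at hn
      subst hn
      have hf : IsField R := isField_iff_maximalIdeal_eq.2 (by simpa using hs.symm)
      exact hf.isDomain
    · have hdim : 0 < ringKrullDim R := lt_of_lt_of_le (by rw [hn]; exact_mod_cast hpos) hcard
      obtain ⟨x, hx, hx2, hmin⟩ := exists_mem_maximalIdeal_notMem_sq_notMem_minimalPrimes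
        (maximalIdeal_notMem_minimalPrimes hdim)
      refine isDomain_of_isPrime_span_singleton hx hmin
        ((Ideal.Quotient.isDomain_iff_prime _).1 ?_)
      have := isLocalRing_quotient_span_singleton hx
      obtain ⟨t, ht, hspan, hle⟩ := exists_span_eq_maximalIdeal_quotient hs hcard hx hx2
      exact ih t.card (hn ▸ ht) hspan hle rfl

/-- In a regular local ring, elements of the maximal ideal outside its square are prime. -/
theorem isPrime_span_singleton_of_notMem_sq {R : Type*} [CommRing R] [IsNoetherianRing R]
    [IsLocalRing R] {s : Finset R} (hs : Ideal.span (s : Set R) = maximalIdeal R)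
    (hcard : (s.card : WithBot ℕ∞) ≤ ringKrullDim R) {x : R} (hx : x ∈ maximalIdeal R)
    (hx2 : x ∉ maximalIdeal R ^ 2) : (Ideal.span {x}).IsPrime := by
  have := isLocalRing_quotient_span_singleton hx
  obtain ⟨t, -, hspan, hle⟩ := exists_span_eq_maximalIdeal_quotient hs hcard hx hx2
  exact (Ideal.Quotient.isDomain_iff_prime _).1
    (isDomain_of_span_eq_maximalIdeal_of_card_le hspan hle)

/-- A regular local domain is either a principal ideal ring or has a regular sequence of
length two. -/
theorem isPrincipalIdealRing_or_exists_regular_pair {R : Type*} [CommRing R] [IsDomain R]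
    [IsNoetherianRing R] [IsLocalRing R] {s : Finset R}
    (hs : Ideal.span (s : Set R) = maximalIdeal R)
    (hcard : (s.card : WithBot ℕ∞) ≤ ringKrullDim R) :
    IsPrincipalIdealRing R ∨ ∃ r₁ ∈ maximalIdeal R, ∃ r₂ ∈ maximalIdeal R, r₁ ≠ 0 ∧
      ∀ c, r₁ ∣ r₂ * c → r₁ ∣ c := by
  by_cases hprin : (maximalIdeal R).IsPrincipal
  · exact .inl (((tfae_of_isNoetherianRing_of_isLocalRing_of_isDomain R).out 4 0).1 hprin)
  right
  have hdim : maximalIdeal R ∉ minimalPrimes R := by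
    intro h
    rw [IsDomain.minimalPrimes_eq_singleton_bot, Set.mem_singleton_iff] at h
    exact hprin (h ▸ inferInstance)
  obtain ⟨x, hx, hx2, hmin⟩ := exists_mem_maximalIdeal_notMem_sq_notMem_minimalPrimes hdim
  have hx0 : x ≠ 0 := by
    rintro rfl
    exact hx2 (zero_mem _)
  have hprime := isPrime_span_singleton_of_notMem_sq hs hcard hx hx2
  obtain ⟨y, hy, hyx⟩ : ∃ y ∈ maximalIdeal R, y ∉ Ideal.span {x} := by
    by_contra! H
    exact hprin ⟨x, le_antisymm H ((Ideal.span_singleton_le_iff_mem _).2 hx)⟩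
  refine ⟨x, hx, y, hy, hx0, fun c hc ↦ ?_⟩
  rw [← Ideal.mem_span_singleton] at hc ⊢
  exact (hprime.mem_or_mem hc).resolve_left hyx

theorem dvd_of_dvd_mul_of_regular_pair {R : Type*} [CommRing R] [IsDomain R] {r₁ r₂ x b : R}
    (hr₁ : r₁ ≠ 0) (hr : ∀ c, r₁ ∣ r₂ * c → r₁ ∣ c) (hx : x ≠ 0) (h₁ : x ∣ r₁ * b)
    (h₂ : x ∣ r₂ * b) : x ∣ b := by
  obtain ⟨c₁, h₁⟩ := h₁
  obtain ⟨c₂, h₂⟩ := h₂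
  obtain ⟨d, rfl⟩ := hr c₁ ⟨c₂, mul_left_cancel₀ hx (by linear_combination r₁ * h₂ - r₂ * h₁)⟩
  exact ⟨d, mul_left_cancel₀ hr₁ (by linear_combination h₁)⟩

/-- A Cohen–Macaulay local ring of dimension at least two has a regular sequence of length two. -/
theorem IsCohenMacaulayLocal.exists_regular_pair {A : Type*} [CommRing A] [IsLocalRing A]
    (hCM : IsCohenMacaulayLocal A) (hdim : 1 < ringKrullDim A) :
    ∃ r₁ ∈ maximalIdeal A, ∃ r₂ ∈ maximalIdeal A, r₁ ≠ 0 ∧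
      ∀ c, r₁ ∣ r₂ * c → r₁ ∣ c := by
  obtain ⟨rs, hmem, hreg, hlen⟩ := hCM
  rw [← hlen] at hdim
  match rs, hmem, hreg, hdim with
  | [], _, _, h => exact absurd h (by simp)
  | [_], _, _, h => simp at h
  | r₁ :: r₂ :: rs, hmem, hreg, _ =>
    rw [RingTheory.Sequence.isRegular_cons_iff, RingTheory.Sequence.isRegular_cons_iff] at hreg
    refine ⟨r₁, hmem _ (by simp), r₂, hmem _ (by simp), ?_, fun c hc ↦ ?_⟩
    · rintro rfl
      exact one_ne_zero (IsSMulRegular.zero_iff_subsingleton.1 hreg.1 |>.elim (1 : A) 0)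
    · have := (isSMulRegular_quotient_iff_mem_of_smul_mem _ _).1 hreg.2.1 c
      simpa [← Submodule.ideal_span_singleton_smul, Ideal.mem_span_singleton, hc] using this

/-- In a principal ideal domain, `xI : I = (x)` for a nonzero ideal `I`. -/
theorem dvd_of_forall_mul_mem_span_singleton_mul {R : Type*} [CommRing R] [IsDomain R]
    [IsPrincipalIdealRing R] {I : Ideal R} (hI : I ≠ ⊥) {a x : R}
    (h : ∀ i ∈ I, a * i ∈ Ideal.span {x} * I) : x ∣ a := by
  obtain ⟨g, rfl⟩ := IsPrincipalIdealRing.principal I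
  rw [Ideal.submodule_span_eq] at h hI
  have hg : g ≠ 0 := by simpa using hI
  have := h g (Ideal.mem_span_singleton_self g)
  rw [Ideal.span_singleton_mul_span_singleton, Ideal.mem_span_singleton] at this
  exact (mul_dvd_mul_iff_right hg).1 this

/-- The ideal quotient `(x) : (a)` is contained in a prime of the form `(x) : (b)`
unless `x ∣ a`. -/
theorem exists_isPrime_mem_iff_dvd_mul {A : Type*} [CommRing A] [IsNoetherianRing A] {x a : A}
    (h : ¬ x ∣ a) : ∃ (p : Ideal A) (b : A), p.IsPrime ∧ (∀ r, r ∈ p ↔ x ∣ r * b) ∧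
      ∀ r, x ∣ r * a → r ∈ p := by
  have hmk : ∀ y : A, Ideal.Quotient.mk (Ideal.span {x}) y = 0 ↔ x ∣ y := fun y ↦ by
    rw [Ideal.Quotient.eq_zero_iff_mem, Ideal.mem_span_singleton]
  have hcolon : ∀ r y : A, r ∈ (⊥ : Submodule A (A ⧸ Ideal.span {x})).colon
      {Ideal.Quotient.mk (Ideal.span {x}) y} ↔ x ∣ r * y := fun r y ↦ by
    rw [Submodule.mem_colon_singleton, Submodule.mem_bot, ← hmk, map_mul]
    rfl
  obtain ⟨p, hp, hle⟩ := exists_le_isAssociatedPrime_of_isNoetherianRing A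
    (Ideal.Quotient.mk (Ideal.span {x}) a) (by rwa [Ne, hmk])
  obtain ⟨hprime, b, rfl⟩ := isAssociatedPrime_iff.1 hp
  obtain ⟨b, rfl⟩ := Ideal.Quotient.mk_surjective b
  exact ⟨_, b, hprime, fun r ↦ hcolon r b, fun r hr ↦ hle ((hcolon r a).2 hr)⟩

/-- Divisibility in the localization at a prime. -/
theorem Localization.AtPrime.algebraMap_dvd_iff {A : Type*} [CommRing A] (p : Ideal A) [p.IsPrime]
    (x a : A) : algebraMap A (Localization.AtPrime p) x ∣ algebraMap A _ a ↔
      ∃ s ∉ p, x ∣ s * a := by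
  rw [← Ideal.mem_span_singleton, ← Set.image_singleton, ← Ideal.map_span,
    IsLocalization.algebraMap_mem_map_algebraMap_iff p.primeCompl]
  simp [Ideal.mem_span_singleton, Ideal.primeCompl]

end

/-- Let `A` be a Noetherian local Cohen–Macaulay integral
domain of Krull dimension `d > 1` which is an isolated singularity, `I` an
ideal of height one, and `x ∈ I` nonzero.  Then the colon ideal
`(xI :_A I) = { a ∈ A : a I ⊆ x I }` equals the principal ideal `xA`. -/
theorem stmt12 {A : Type*} [CommRing A] [IsDomain A] [IsNoetherianRing A] [IsLocalRing A]
    (hCM : IsCohenMacaulayLocal A)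
    (hdim : 1 < ringKrullDim A)
    (hiso : ∀ (p : Ideal A) (_ : p.IsPrime), p ≠ IsLocalRing.maximalIdeal A →
      IsRegularLocal (Localization.AtPrime p))
    (I : Ideal A)
    (hht : (⨅ (p : PrimeSpectrum A) (_ : I ≤ p.asIdeal), Order.height p) = 1)
    (x : A) (hxI : x ∈ I) (hx : x ≠ 0) :
    Submodule.colon (Ideal.span {x} * I) I = Ideal.span {x} := by
  have hI : I ≠ ⊥ := fun h ↦ hx (by simpa [h] using hxI)
  refine le_antisymm (fun a ha ↦ ?_) fun a ha ↦
    Submodule.mem_colon.2 fun i hi ↦ Ideal.mul_mem_mul ha hi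
  rw [Ideal.mem_span_singleton]
  by_contra hxa
  obtain ⟨p, b, hp, hpb, hpa⟩ := exists_isPrime_mem_iff_dvd_mul hxa
  have hxb : ¬ x ∣ b := fun h ↦ hp.ne_top ((Ideal.eq_top_iff_one _).2 ((hpb 1).2 (by simpa)))
  by_cases hpm : p = IsLocalRing.maximalIdeal A
  · obtain ⟨r₁, h₁, r₂, h₂, hr₁, hr⟩ := hCM.exists_regular_pair hdim
    exact hxb (dvd_of_dvd_mul_of_regular_pair hr₁ hr hx ((hpb _).1 (hpm ▸ h₁))
      ((hpb _).1 (hpm ▸ h₂)))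
  obtain ⟨_, _, s, hs, hcard⟩ := hiso p hp hpm
  let R := Localization.AtPrime p
  have : IsDomain R := IsLocalization.isDomain_localization p.primeCompl_le_nonZeroDivisors
  have hinj : Function.Injective (algebraMap A R) :=
    IsLocalization.injective R p.primeCompl_le_nonZeroDivisors
  rcases isPrincipalIdealRing_or_exists_regular_pair hs hcard.le with
    hpid | ⟨r₁, h₁, r₂, h₂, hr₁, hr⟩
  · have hIR : I.map (algebraMap A R) ≠ ⊥ := by
      rwa [Ne, Ideal.map_eq_bot_iff_of_injective hinj]
    have hdvd : algebraMap A R x ∣ algebraMap A R a := by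
      refine dvd_of_forall_mul_mem_span_singleton_mul hIR fun i hi ↦ ?_
      have hle : Ideal.span {a} * I ≤ Ideal.span {x} * I :=
        Ideal.span_singleton_mul_le_iff.2 (Submodule.mem_colon.1 ha)
      have := Ideal.map_mono (f := algebraMap A R) hle
      rw [Ideal.map_mul, Ideal.map_mul, Ideal.map_span, Ideal.map_span, Set.image_singleton,
        Set.image_singleton] at this
      exact this (Ideal.mul_mem_mul (Ideal.mem_span_singleton_self _) hi)
    obtain ⟨s, hsp, hsa⟩ := (Localization.AtPrime.algebraMap_dvd_iff p x a).1 hdvd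
    exact hsp (hpa s hsa)
  · have hmax : ∀ r ∈ IsLocalRing.maximalIdeal R, algebraMap A R x ∣ r * algebraMap A R b := by
      have hle : p.map (algebraMap A R) ≤
          (Ideal.span {algebraMap A R x}).colon {algebraMap A R b} := by
        refine Ideal.map_le_iff_le_comap.2 fun r hr ↦ ?_
        rw [Ideal.mem_comap, Submodule.mem_colon_singleton, smul_eq_mul, ← map_mul,
          Ideal.mem_span_singleton]
        exact map_dvd _ ((hpb r).1 hr)
      rw [Localization.AtPrime.map_eq_maximalIdeal] at hle
      intro r hr
      simpa [Ideal.mem_span_singleton] using Submodule.mem_colon_singleton.1 (hle hr)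
    obtain ⟨s, hsp, hsb⟩ := (Localization.AtPrime.algebraMap_dvd_iff p x b).1
      (dvd_of_dvd_mul_of_regular_pair hr₁ hr ((map_ne_zero_iff _ hinj).2 hx) (hmax _ h₁)
        (hmax _ h₂))
    exact hsp ((hpb s).2 hsb)
end

section
/- Let k be an algebraically closed field of characteristic not two and S = k[[x, y]] the formal power series ring in two variables over k. Let f_1, …, f_n ∈ (x, y) be prime elements of S that are pairwise non-associate, with f_i ∉ (x, y)² for all i, and set f = f_1⋯f_n, R = S/fS, and S_i = S/(f_1⋯f_i)S for 1 ≤ i ≤ n, each S_i viewed as an R-module. Let L be the R-module S_1 ⊕ ⋯ ⊕ S_n. Then the abelianization of the automorphism group of the R-module L is isomorphic to the product of unit groups (S/f_1S)ˣ × ⋯ × (S/f_nS)ˣ. -/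
set_option synthInstance.maxHeartbeats 1000000
set_option maxHeartbeats 1000000

section Peirce

open scoped commutatorElement

variable {E : Type*} [Ring E]

/-- `1 + x` as a unit, for `x` of square zero. -/
def unipotentUnit (x : E) (hx : x * x = 0) : Eˣ where
  val := 1 + x
  inv := 1 - x
  val_inv := by simp [add_mul, mul_sub, hx]
  inv_val := by simp [mul_add, sub_mul, hx]

theorem one_add_mem_commutator (h2 : IsUnit (2 : E)) {e x : E} (he : e * e = e)
    (hl : e * x = x) (hr : x * e = 0) (u : Eˣ) (hu : (u : E) = 1 + x) :
    u ∈ commutator Eˣ := by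
  obtain ⟨t, ht⟩ := h2
  have hc : ∀ a : E, (↑t⁻¹ : E) * a = a * ↑t⁻¹ := fun a ↦ by
    have : Commute a (t : E) := by rw [ht]; exact Commute.ofNat_right a 2
    exact (this.units_inv_right).eq.symm
  set z : E := ↑t⁻¹ * x with hz
  have hzz : z + z = x := by
    rw [← two_mul, ← ht, hz, Units.mul_inv_cancel_left]
  have hez : e * z = z := by rw [hz, ← mul_assoc, ← hc, mul_assoc, hl]
  have hze : z * e = 0 := by rw [hz, mul_assoc, hr, mul_zero]
  have hz2 : z * z = 0 := by
    calc z * z = z * (e * z) := by rw [hez]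
      _ = 0 := by rw [← mul_assoc, hze, zero_mul]
  have hd : (1 - 2 * e) * (1 - 2 * e) = 1 := by
    have : (1 - 2 * e) * (1 - 2 * e) = 1 - 4 * e + 4 * (e * e) := by noncomm_ring
    rw [this, he]; noncomm_ring
  let d : Eˣ := ⟨1 - 2 * e, 1 - 2 * e, hd, hd⟩
  let w : Eˣ := unipotentUnit z hz2
  have hcomm : u = ⁅w, d⁆ := by
    rw [commutatorElement_def, eq_mul_inv_iff_mul_eq, eq_mul_inv_iff_mul_eq]
    ext
    have h1 : (1 + x) * (1 - 2 * e) * (1 + z)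
        = 1 + x - 2 * e - 2 * (x * e) + z + x * z - 2 * (e * z) - 2 * (x * e) * z := by
      noncomm_ring
    have h2 : (1 + z) * (1 - 2 * e) = 1 - 2 * e + z - 2 * (z * e) := by noncomm_ring
    have h3 : x * z = 0 := by rw [← hzz, add_mul, hz2, add_zero]
    change (u : E) * (1 - 2 * e) * (1 + z) = (1 + z) * (1 - 2 * e)
    rw [hu, h1, h2, hr, hze, hez, h3, ← hzz]
    noncomm_ring
  rw [hcomm, commutator_def]
  exact Subgroup.commutator_mem_commutator (Subgroup.mem_top _) (Subgroup.mem_top _)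

theorem one_add_mem_commutator' (h2 : IsUnit (2 : E)) {e x : E} (he : e * e = e)
    (hl : e * x = 0) (hr : x * e = x) (u : Eˣ) (hu : (u : E) = 1 + x) :
    u ∈ commutator Eˣ := by
  refine one_add_mem_commutator h2 (e := 1 - e) ?_ ?_ ?_ u hu
  · simp [mul_sub, sub_mul, he]
  · rw [sub_mul, hl, one_mul, sub_zero]
  · rw [mul_sub, hr, mul_one, sub_self]

theorem Abelianization.of_eq_of_one_add_mul_swap (h2 : IsUnit (2 : E)) {e x y : E}
    (he : e * e = e) (hex : e * x = x) (hxe : x * e = 0) (hey : e * y = 0) (hye : y * e = y)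
    (a b : Eˣ) (ha : (a : E) = 1 + x * y) (hb : (b : E) = 1 + y * x) :
    Abelianization.of a = Abelianization.of b := by
  have hof : ∀ u : Eˣ, u ∈ commutator Eˣ → Abelianization.of u = 1 := fun u hu ↦
    (QuotientGroup.eq_one_iff u).2 hu
  have hxx : x * x = 0 := by
    calc x * x = x * (e * x) := by rw [hex]
      _ = 0 := by rw [← mul_assoc, hxe, zero_mul]
  have hyy : y * y = 0 := by
    calc y * y = y * e * y := by rw [hye]
      _ = 0 := by rw [mul_assoc, hey, mul_zero]
  set z : E := y * ↑a⁻¹ with hz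
  set w : E := x * ↑b⁻¹ with hw
  have hza : z + z * x * y = y := by
    calc z + z * x * y = z * a := by rw [ha]; noncomm_ring
      _ = y := by rw [hz, Units.inv_mul_cancel_right]
  have hez : e * z = 0 := by rw [hz, ← mul_assoc, hey, zero_mul]
  have hew : e * w = w := by rw [hw, ← mul_assoc, hex]
  have haw : (a : E) * w = x := by
    have : (a : E) * x = x * b := by rw [ha, hb]; noncomm_ring
    rw [hw, ← mul_assoc, this, Units.mul_inv_cancel_right]
  have hea : e * a = a * e := by
    rw [ha, mul_add, add_mul, ← mul_assoc, hex, mul_assoc x, hye, mul_one, one_mul]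
  have heb : e * b = b * e := by
    rw [hb, mul_add, add_mul, ← mul_assoc, hey, mul_assoc y, hxe, mul_one, one_mul,
      zero_mul, mul_zero]
  have hze : z * e = z := by
    have : (↑a⁻¹ : E) * e = e * ↑a⁻¹ := (Commute.units_inv_right (u := a) hea).eq.symm
    rw [hz, mul_assoc, this, ← mul_assoc, hye]
  have hwe : w * e = 0 := by
    have : (↑b⁻¹ : E) * e = e * ↑b⁻¹ := (Commute.units_inv_right (u := b) heb).eq.symm
    rw [hw, mul_assoc, this, ← mul_assoc, hxe, zero_mul]
  have hzz : z * z = 0 := by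
    calc z * z = z * e * z := by rw [hze]
      _ = 0 := by rw [mul_assoc, hez, mul_zero]
  have hww : w * w = 0 := by
    calc w * w = w * (e * w) := by rw [hew]
      _ = 0 := by rw [← mul_assoc, hwe, zero_mul]
  have hyz : y * z = 0 := by rw [← hye, mul_assoc, hez, mul_zero]
  have hxw : x * w = 0 := by rw [← hew, ← mul_assoc, hxe, zero_mul]
  have key : unipotentUnit x hxx * unipotentUnit y hyy
      = unipotentUnit z hzz * (a * b⁻¹) * unipotentUnit w hww := by
    have hbinv : (↑b⁻¹ : E) = 1 - z * x := by
      have h : (1 - z * x) * (b : E) = 1 := by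
        rw [hb]
        calc (1 - z * x) * (1 + y * x) = 1 + y * x - (z + z * x * y) * x := by noncomm_ring
          _ = 1 := by rw [hza]; noncomm_ring
      exact Units.inv_eq_of_mul_eq_one_left h
    have hyw : y * w = z * x := by
      calc y * w = z * (a * w) := by rw [← mul_assoc z, hz, Units.inv_mul_cancel_right]
        _ = z * x := by rw [haw]
    ext
    change (1 + x) * (1 + y) = (1 + z) * (a * ↑b⁻¹) * (1 + w)
    have haw' : w + x * y * w = x := by
      calc w + x * y * w = a * w := by rw [ha]; noncomm_ring
        _ = x := haw
    calc (1 + x) * (1 + y)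
        = 1 + x * y + y - z * x + x + y * w := by rw [hyw]; noncomm_ring
      _ = 1 + x * y + (z + z * x * y) - z * x + (w + x * y * w) + (z + z * x * y) * w
          - z * (x * w) := by rw [hza, haw', hxw]; noncomm_ring
      _ = (1 + z) * ((1 + x * y) * (1 - z * x)) * (1 + w) := by
        have h1 : (1 + z) * ((1 + x * y) * (1 - z * x)) * (1 + w)
          = 1 + x * y + (z + z * x * y) - z * x + (w + x * y * w) + (z + z * x * y) * w
          - z * (x * w) - x * (y * z) * x * (1 + w) - z * x * (y * z) * x * (1 + w)
          - (z * z) * x * (1 + w) := by noncomm_ring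
        rw [h1, hyz, hzz]; noncomm_ring
      _ = _ := by rw [ha, hbinv]
  have := congrArg Abelianization.of key
  simp only [map_mul] at this
  rw [hof _ (one_add_mem_commutator h2 he hex hxe _ rfl),
    hof _ (one_add_mem_commutator' h2 he hey hye _ rfl),
    hof (unipotentUnit z hzz) (one_add_mem_commutator' h2 he hez hze _ rfl),
    hof (unipotentUnit w hww) (one_add_mem_commutator h2 he hew hwe _ rfl)] at this
  simpa [eq_mul_inv_iff_mul_eq, eq_comm] using this

theorem exists_commute_of_corner_inverse (h2 : IsUnit (2 : E)) {ι : Type*} (e : ι → E)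
    (he : ∀ i, e i * e i = e i) (horth : ∀ i j, i ≠ j → e i * e j = 0)
    (hcorner : ∀ (u : Eˣ) (i : ι), ∃ v : E, e i * v = v ∧ v * e i = v ∧
      v * u * e i = e i ∧ e i * u * v = e i) (s : Finset ι) (u : Eˣ) :
    ∃ u' : Eˣ, Abelianization.of u' = Abelianization.of u ∧
      ∀ i ∈ s, (u' : E) * e i = e i * u' := by
  classical
  induction s using Finset.induction_on with
  | empty => exact ⟨u, rfl, by simp⟩
  | insert k s hk ih =>
    obtain ⟨u, hu, hs⟩ := ih
    obtain ⟨v, hev, hve, hvu, huv⟩ := hcorner u k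
    have hof : ∀ u : Eˣ, u ∈ commutator Eˣ → Abelianization.of u = 1 := fun u hu ↦
      (QuotientGroup.eq_one_iff u).2 hu
    set x : E := -((1 - e k) * u * v) with hx
    set y : E := -(v * u * (1 - e k)) with hy
    have hex : e k * x = 0 := by
      rw [hx, mul_neg, mul_assoc, ← mul_assoc, mul_sub, mul_one, he, sub_self, zero_mul, neg_zero]
    have hxe : x * e k = x := by rw [hx, neg_mul, mul_assoc, hve]
    have hey : e k * y = y := by rw [hy, mul_neg, ← mul_assoc, ← mul_assoc, hev]
    have hye : y * e k = 0 := by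
      rw [hy, neg_mul, mul_assoc, sub_mul, one_mul, he, sub_self, mul_zero, neg_zero]
    have hxx : x * x = 0 := by
      calc x * x = x * e k * x := by rw [hxe]
        _ = 0 := by rw [mul_assoc, hex, mul_zero]
    have hyy : y * y = 0 := by
      calc y * y = y * (e k * y) := by rw [hey]
        _ = 0 := by rw [← mul_assoc, hye, zero_mul]
    refine ⟨unipotentUnit x hxx * u * unipotentUnit y hyy, ?_, ?_⟩
    · rw [map_mul, map_mul, hof _ (one_add_mem_commutator' h2 (he k) hex hxe _ rfl),
        hof (unipotentUnit y hyy) (one_add_mem_commutator h2 (he k) hey hye _ rfl), one_mul, mul_one, hu]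
    · intro i hi
      change (1 + x) * u * (1 + y) * e i = e i * ((1 + x) * u * (1 + y))
      rcases Finset.mem_insert.1 hi with rfl | hi
      · have h1 : (1 + x) * u * (1 + y) * e i = e i * u * e i := by
          calc (1 + x) * u * (1 + y) * e i
              = u * e i + (1 + x) * u * (y * e i) - (1 - e i) * u * (v * u * e i) := by
                rw [hx]; noncomm_ring
            _ = e i * u * e i := by rw [hye, hvu]; noncomm_ring
        have h3 : e i * ((1 + x) * u * (1 + y)) = e i * u * e i := by
          calc e i * ((1 + x) * u * (1 + y))
              = e i * u + (e i * x) * u * (1 + y) - (e i * u * v) * u * (1 - e i) := by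
                rw [hy]; noncomm_ring
            _ = e i * u * e i := by rw [hex, huv]; noncomm_ring
        rw [h1, h3]
      · have hik : i ≠ k := fun h ↦ hk (h ▸ hi)
        have hui := hs i hi
        have hvi : v * e i = 0 := by rw [← hve, mul_assoc, horth _ _ hik.symm, mul_zero]
        have hiv : e i * v = 0 := by rw [← hev, ← mul_assoc, horth _ _ hik, zero_mul]
        have hxi : x * e i = 0 := by rw [hx, neg_mul, mul_assoc, hvi, mul_zero, neg_zero]
        have hix : e i * x = 0 := by
          calc e i * x = -((e i * u) * v - (e i * e k) * u * v) := by rw [hx]; noncomm_ring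
            _ = 0 := by rw [← hui, horth _ _ hik, mul_assoc, hiv]; noncomm_ring
        have hiy : e i * y = 0 := by
          rw [hy, mul_neg, ← mul_assoc, ← mul_assoc, hiv, zero_mul, zero_mul, neg_zero]
        have hyi : y * e i = 0 := by
          calc y * e i = -(v * (u * e i) - v * u * (e k * e i)) := by rw [hy]; noncomm_ring
            _ = 0 := by rw [hui, horth _ _ hik.symm, ← mul_assoc, hvi]; noncomm_ring
        calc (1 + x) * u * (1 + y) * e i
            = u * e i + x * (u * e i) + (1 + x) * u * (y * e i) := by noncomm_ring
          _ = e i * u + (e i * u) * y := by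
            rw [hyi, hui, ← mul_assoc x, hxi, ← hui, mul_assoc (u : E), hiy]; noncomm_ring
          _ = e i * u + e i * u * y + (e i * x) * u * (1 + y) := by rw [hix]; noncomm_ring
          _ = _ := by noncomm_ring

end Peirce

section Chain

variable {S : Type*} [CommRing S] {n : ℕ} (f : Fin n → S)

/-- The hypersurface ring `S ⧸ (∏ f l)`. -/
abbrev HypersurfaceRing : Type _ := S ⧸ Ideal.span {∏ l, f l}

/-- The module `S ⧸ (f 1 ⋯ f i)` over the hypersurface ring. -/
abbrev ChainQuotient (i : Fin n) : Type _ :=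
  HypersurfaceRing f ⧸ Ideal.span
    {Ideal.Quotient.mk (Ideal.span {∏ l, f l}) (∏ l ∈ Finset.Iic i, f l)}

/-- The endomorphism ring of the direct sum of the `ChainQuotient f i`. -/
abbrev ChainEnd : Type _ := Module.End (HypersurfaceRing f) (∀ i, ChainQuotient f i)

/-- The projection of `S ^ n` onto the direct sum of the `ChainQuotient f i`. -/
def chainMk (t : Fin n → S) : ∀ i, ChainQuotient f i :=
  fun i ↦ Ideal.Quotient.mk _ (Ideal.Quotient.mk _ (t i))

variable {f}

theorem chainMk_surjective : Function.Surjective (chainMk f) := fun x ↦ by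
  choose y hy using fun i ↦ Ideal.Quotient.mk_surjective (x i)
  choose z hz using fun i ↦ Ideal.Quotient.mk_surjective (y i)
  exact ⟨z, funext fun i ↦ by rw [chainMk, hz, hy]⟩

theorem chainMk_add (s t : Fin n → S) : chainMk f (s + t) = chainMk f s + chainMk f t := by
  funext i; simp [chainMk]

theorem chainMk_smul (a : S) (t : Fin n → S) :
    chainMk f (a • t) = (Ideal.Quotient.mk _ a : HypersurfaceRing f) • chainMk f t := by
  funext i
  simp only [chainMk, Pi.smul_apply, smul_eq_mul, map_mul]
  rfl

theorem chainMk_eq_iff {s t : Fin n → S} :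
    chainMk f s = chainMk f t ↔ ∀ i, ∏ l ∈ Finset.Iic i, f l ∣ s i - t i := by
  rw [funext_iff]
  refine forall_congr' fun i ↦ ?_
  rw [chainMk, chainMk, Ideal.Quotient.mk_eq_mk_iff_sub_mem, ← map_sub,
    Ideal.mem_span_singleton', ← Ideal.mem_span_singleton]
  constructor
  · rintro ⟨a, ha⟩
    obtain ⟨a, rfl⟩ := Ideal.Quotient.mk_surjective a
    rw [← map_mul, Ideal.Quotient.mk_eq_mk_iff_sub_mem, Ideal.mem_span_singleton] at ha
    rw [Ideal.mem_span_singleton]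
    have h := (Finset.prod_dvd_prod_of_subset _ _ f (Finset.subset_univ (Finset.Iic i))).trans ha
    exact (dvd_sub_right (Dvd.intro_left a rfl)).1 h
  · intro h
    rw [Ideal.mem_span_singleton] at h
    obtain ⟨a, ha⟩ := h
    exact ⟨Ideal.Quotient.mk _ a, by rw [ha, ← map_mul, mul_comm]⟩

/-- The endomorphism `φ` is induced by the matrix `A`. -/
def IsInducedBy (φ : ChainEnd f) (A : Matrix (Fin n) (Fin n) S) : Prop :=
  ∀ t, φ (chainMk f t) = chainMk f (A.mulVec t)

namespace IsInducedBy

variable {φ ψ : ChainEnd f} {A B : Matrix (Fin n) (Fin n) S}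

theorem mul (hφ : IsInducedBy φ A) (hψ : IsInducedBy ψ B) : IsInducedBy (φ * ψ) (A * B) :=
  fun t ↦ by rw [Module.End.mul_apply, hψ, hφ, Matrix.mulVec_mulVec]

theorem add (hφ : IsInducedBy φ A) (hψ : IsInducedBy ψ B) : IsInducedBy (φ + ψ) (A + B) :=
  fun t ↦ by rw [LinearMap.add_apply, hψ, hφ, Matrix.add_mulVec, chainMk_add]

theorem one : IsInducedBy (1 : ChainEnd f) 1 := fun t ↦ by
  rw [Matrix.one_mulVec, Module.End.one_apply]

theorem ext (hφ : IsInducedBy φ A) (hψ : IsInducedBy ψ A) : φ = ψ :=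
  LinearMap.ext fun x ↦ by
    obtain ⟨t, rfl⟩ := chainMk_surjective x
    rw [hφ, hψ]

theorem congr (hφ : IsInducedBy φ A)
    (h : ∀ r c, ∏ l ∈ Finset.Iic r, f l ∣ A r c - B r c) : IsInducedBy φ B := fun t ↦ by
  rw [hφ, chainMk_eq_iff]
  intro r
  rw [← Pi.sub_apply, ← Matrix.sub_mulVec, Matrix.mulVec, dotProduct]
  exact Finset.dvd_sum fun c _ ↦ (h r c).mul_right _

theorem dvd_sub (hφ : IsInducedBy φ A) (hψ : IsInducedBy φ B) (r c : Fin n) :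
    ∏ l ∈ Finset.Iic r, f l ∣ A r c - B r c := by
  simpa using chainMk_eq_iff.1 ((hφ (Pi.single c 1)).symm.trans (hψ (Pi.single c 1))) r

theorem dvd_mul (hφ : IsInducedBy φ A) (r c : Fin n) :
    ∏ l ∈ Finset.Iic r, f l ∣ A r c * ∏ l ∈ Finset.Iic c, f l := by
  have h0 : chainMk f (Pi.single c (∏ l ∈ Finset.Iic c, f l)) = chainMk f 0 := by
    rw [chainMk_eq_iff]
    intro i
    rcases eq_or_ne i c with rfl | h
    · simp
    · simp [h]
  have := (hφ _).symm.trans ((congrArg φ h0).trans (hφ 0))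
  simpa [Matrix.mulVec_single] using chainMk_eq_iff.1 this r

theorem dvd [IsDomain S] (hf : ∀ i, f i ≠ 0) (hφ : IsInducedBy φ A) {r c i : Fin n}
    (hci : c < i) (hir : i ≤ r) : f i ∣ A r c := by
  have hsub : Finset.Iic c ⊆ Finset.Iic r :=
    Finset.Iic_subset_Iic.2 (hci.le.trans hir)
  have h := hφ.dvd_mul r c
  rw [← Finset.prod_sdiff hsub] at h
  have h := (mul_dvd_mul_iff_right (Finset.prod_ne_zero_iff.2 fun i _ ↦ hf i)).1 h
  exact (Finset.dvd_prod_of_mem f (by simp [hci, hir])).trans h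

end IsInducedBy

theorem exists_isInducedBy (φ : ChainEnd f) : ∃ A, IsInducedBy φ A := by
  choose a ha using fun c ↦ chainMk_surjective (φ (chainMk f (Pi.single c 1)))
  refine ⟨Matrix.of fun r c ↦ a c r, fun t ↦ ?_⟩
  let Q : (Fin n → S) →+ (∀ i, ChainQuotient f i) := AddMonoidHom.mk' (chainMk f) chainMk_add
  have h1 : t = ∑ c, t c • Pi.single c (1 : S) := by
    funext i; simp [Finset.sum_apply, Pi.single_apply]
  have h2 : (Matrix.of fun r c ↦ a c r).mulVec t = ∑ c, t c • a c := by
    funext i; simp [Matrix.mulVec, dotProduct, Finset.sum_apply, mul_comm]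
  have hQ : ∀ t, chainMk f t = Q t := fun _ ↦ rfl
  rw [h2]
  conv_lhs => rw [h1]
  rw [hQ, hQ, map_sum, map_sum, map_sum]
  refine Finset.sum_congr rfl fun c _ ↦ ?_
  rw [← hQ, ← hQ, chainMk_smul, chainMk_smul, map_smul, ha]

theorem exists_end_isInducedBy (A : Matrix (Fin n) (Fin n) S)
    (hA : ∀ r c, ∏ l ∈ Finset.Iic r, f l ∣ A r c * ∏ l ∈ Finset.Iic c, f l) :
    ∃ φ : ChainEnd f, IsInducedBy φ A := by
  have hwd : ∀ s t : Fin n → S, chainMk f s = chainMk f t →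
      chainMk f (A.mulVec s) = chainMk f (A.mulVec t) := by
    intro s t h
    rw [chainMk_eq_iff] at h ⊢
    intro r
    rw [← Pi.sub_apply, ← Matrix.mulVec_sub]
    rw [Matrix.mulVec, dotProduct]
    refine Finset.dvd_sum fun c _ ↦ (hA r c).trans (mul_dvd_mul_left _ (h c))
  let g := Function.surjInv (chainMk_surjective (f := f))
  have hg : ∀ x, chainMk f (g x) = x := Function.surjInv_eq _
  refine ⟨{ toFun := fun x ↦ chainMk f (A.mulVec (g x)), map_add' := fun x y ↦ ?_,
            map_smul' := fun a x ↦ ?_ }, fun t ↦ hwd _ _ (hg _)⟩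
  · rw [← chainMk_add, ← Matrix.mulVec_add]
    exact hwd _ _ (by rw [chainMk_add, hg, hg, hg])
  · obtain ⟨a, rfl⟩ := Ideal.Quotient.mk_surjective a
    rw [RingHom.id_apply, ← chainMk_smul, ← Matrix.mulVec_smul]
    exact hwd _ _ (by rw [chainMk_smul, hg, hg])

variable (f) in
/-- The diagonal endomorphisms. -/
def diagEnd : (Fin n → S) →* ChainEnd f where
  toFun d :=
    { toFun := fun x r ↦ (Ideal.Quotient.mk _ (d r) : HypersurfaceRing f) • x r
      map_add' := fun x y ↦ funext fun r ↦ smul_add _ _ _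
      map_smul' := fun a x ↦ funext fun r ↦ by
        change (Ideal.Quotient.mk _ (d r) : HypersurfaceRing f) • a • x r =
          a • (Ideal.Quotient.mk _ (d r) : HypersurfaceRing f) • x r
        rw [smul_smul, smul_smul, mul_comm] }
  map_one' := LinearMap.ext fun x ↦ funext fun r ↦ by
    change (Ideal.Quotient.mk _ (1 : S) : HypersurfaceRing f) • x r = x r
    rw [map_one, one_smul]
  map_mul' d e := LinearMap.ext fun x ↦ funext fun r ↦ by
    change (Ideal.Quotient.mk _ (d r * e r) : HypersurfaceRing f) • x r =
      (Ideal.Quotient.mk _ (d r) : HypersurfaceRing f) •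
        (Ideal.Quotient.mk _ (e r) : HypersurfaceRing f) • x r
    rw [map_mul, mul_smul]

theorem isInducedBy_diagEnd (d : Fin n → S) :
    IsInducedBy (diagEnd f d) (Matrix.diagonal d) := fun t ↦ by
  funext r
  rw [chainMk, Matrix.mulVec_diagonal, map_mul, map_mul]
  rfl

theorem isUnit_diag [IsDomain S] [IsLocalRing S] (hf : ∀ i, f i ≠ 0) (hm : ∀ i, ¬ IsUnit (f i))
    (u : (ChainEnd f)ˣ) {A : Matrix (Fin n) (Fin n) S} (hA : IsInducedBy (u : ChainEnd f) A)
    (i : Fin n) : IsUnit (A i i) := by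
  obtain ⟨B, hB⟩ := exists_isInducedBy (↑u⁻¹ : ChainEnd f)
  have hmem : ∀ j, ∀ a, f j ∣ a → a ∈ IsLocalRing.maximalIdeal S := fun j a h ↦
    fun ha ↦ hm j (isUnit_of_dvd_unit h ha)
  have h1 : IsInducedBy (1 : ChainEnd f) (A * B) := by
    rw [← u.mul_inv]; exact hA.mul hB
  have h2 := hmem i _ ((Finset.dvd_prod_of_mem f (by simp)).trans (h1.dvd_sub .one i i))
  have h3 : ∑ l ∈ Finset.univ.erase i, A i l * B l i ∈ IsLocalRing.maximalIdeal S := by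
    refine Ideal.sum_mem _ fun l hl ↦ ?_
    rcases lt_or_gt_of_ne (Finset.ne_of_mem_erase hl) with h | h
    · exact hmem i _ ((hA.dvd hf h le_rfl).mul_right _)
    · exact hmem l _ ((hB.dvd hf h le_rfl).mul_left _)
  rw [Matrix.mul_apply, ← Finset.add_sum_erase _ _ (Finset.mem_univ i), Matrix.one_apply_eq] at h2
  by_contra h
  have h4 : A i i * B i i ∈ IsLocalRing.maximalIdeal S := Ideal.mul_mem_right _ _ h
  have h5 : (1 : S) ∈ IsLocalRing.maximalIdeal S := by
    simpa using Ideal.sub_mem _ (Ideal.add_mem _ h4 h3) h2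
  exact h5 isUnit_one

/-- The determinant modulo `f i` of the lower right block starting at `i`. -/
def blockDet (i : Fin n) (A : Matrix (Fin n) (Fin n) S) : S ⧸ Ideal.span {f i} :=
  ((A.map (Ideal.Quotient.mk (Ideal.span {f i}))).submatrix
    (Subtype.val : {r // i ≤ r} → Fin n) Subtype.val).det

theorem blockDet_congr (i : Fin n) {A B : Matrix (Fin n) (Fin n) S}
    (h : ∀ r c, ∏ l ∈ Finset.Iic r, f l ∣ A r c - B r c) :
    blockDet (f := f) i A = blockDet i B := by
  rw [blockDet, blockDet]
  congr 1
  ext r c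
  rw [Matrix.submatrix_apply, Matrix.submatrix_apply, Matrix.map_apply, Matrix.map_apply,
    Ideal.Quotient.mk_eq_mk_iff_sub_mem, Ideal.mem_span_singleton]
  exact (Finset.dvd_prod_of_mem f (Finset.mem_Iic.2 r.2)).trans (h r c)

theorem blockDet_mul (i : Fin n) {A B : Matrix (Fin n) (Fin n) S}
    (h : ∀ r c, c < i → i ≤ r → f i ∣ A r c) :
    blockDet (f := f) i (A * B) = blockDet i A * blockDet i B := by
  rw [blockDet, blockDet, blockDet, ← Matrix.det_mul]
  congr 1
  ext r c
  rw [Matrix.submatrix_apply, Matrix.map_apply, Matrix.mul_apply, Matrix.mul_apply, map_sum,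
    ← Fintype.sum_subtype_add_sum_subtype (fun l ↦ i ≤ l), add_eq_left.2]
  · simp
  · refine Finset.sum_eq_zero fun l _ ↦ ?_
    rw [Ideal.Quotient.eq_zero_iff_mem, Ideal.mem_span_singleton]
    exact (h r l (not_le.1 l.2) r.2).mul_right _

theorem blockDet_diagonal (i : Fin n) (d : Fin n → S) :
    blockDet (f := f) i (Matrix.diagonal d) = Ideal.Quotient.mk _ (∏ r ∈ Finset.Ici i, d r) := by
  rw [blockDet, Matrix.diagonal_map (map_zero _),
    Matrix.submatrix_diagonal _ _ Subtype.val_injective, Matrix.det_diagonal, map_prod]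
  exact (Finset.prod_subtype (Finset.Ici i) (fun x ↦ Finset.mem_Ici)
    (fun r ↦ Ideal.Quotient.mk (Ideal.span {f i}) (d r))).symm

/-- `blockDet` as a multiplicative map on endomorphisms. -/
noncomputable def detHom [IsDomain S] (hf : ∀ i, f i ≠ 0) (i : Fin n) :
    ChainEnd f →* S ⧸ Ideal.span {f i} where
  toFun φ := blockDet i (exists_isInducedBy φ).choose
  map_one' := by
    rw [blockDet_congr i ((exists_isInducedBy (1 : ChainEnd f)).choose_spec.dvd_sub .one),
      ← Matrix.diagonal_one, blockDet_diagonal]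
    simp
  map_mul' φ ψ := by
    rw [← blockDet_mul i fun r c hc hr ↦ (exists_isInducedBy φ).choose_spec.dvd hf hc hr]
    exact blockDet_congr i ((exists_isInducedBy (φ * ψ)).choose_spec.dvd_sub
      ((exists_isInducedBy φ).choose_spec.mul (exists_isInducedBy ψ).choose_spec))

theorem detHom_apply [IsDomain S] (hf : ∀ i, f i ≠ 0) (i : Fin n) {φ : ChainEnd f}
    {A : Matrix (Fin n) (Fin n) S} (h : IsInducedBy φ A) : detHom hf i φ = blockDet i A :=
  blockDet_congr i ((exists_isInducedBy φ).choose_spec.dvd_sub h)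

variable (f) in
/-- The diagonal automorphisms. -/
def diagAut : (Fin n → Sˣ) →* (ChainEnd f)ˣ :=
  (Units.map (diagEnd f)).comp MulEquiv.piUnits.symm.toMonoidHom

theorem isInducedBy_diagAut (d : Fin n → Sˣ) :
    IsInducedBy (diagAut f d : ChainEnd f) (Matrix.diagonal fun i ↦ (d i : S)) :=
  isInducedBy_diagEnd _

theorem isUnit_two_chainEnd (h2 : IsUnit (2 : S)) : IsUnit (2 : ChainEnd f) := by
  convert (h2.map (Pi.constMonoidHom (Fin n) S)).map (diagEnd f) using 1
  refine IsInducedBy.ext (A := 1 + 1) ?_ ?_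
  · rw [← one_add_one_eq_two]; exact IsInducedBy.one.add .one
  · convert isInducedBy_diagEnd _ using 1
    ext r c
    rcases eq_or_ne r c with rfl | h
    · simp [one_add_one_eq_two]
    · simp [h]

theorem diagonal_single_mul_mul_diagonal_single (A : Matrix (Fin n) (Fin n) S) (i : Fin n)
    (a b : S) : Matrix.diagonal (Pi.single i a) * A * Matrix.diagonal (Pi.single i b) =
      Matrix.diagonal (Pi.single i (a * A i i * b)) := by
  ext r c
  rw [Matrix.mul_diagonal, Matrix.diagonal_mul, Matrix.diagonal_apply]
  by_cases hr : r = i <;> by_cases hc : c = i <;> by_cases h : r = c <;> grind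

theorem exists_diagAut [IsDomain S] [IsLocalRing S] (hf : ∀ i, f i ≠ 0)
    (hm : ∀ i, ¬ IsUnit (f i)) (h2 : IsUnit (2 : S)) (u : (ChainEnd f)ˣ) :
    ∃ d, Abelianization.of (diagAut f d) = Abelianization.of u := by
  have hsingle : ∀ (i : Fin n) (a b : S), diagEnd f (Pi.single i a) * diagEnd f (Pi.single i b)
      = diagEnd f (Pi.single i (a * b)) := fun i a b ↦ by
    rw [← map_mul, ← Pi.single_mul]
  obtain ⟨u', hu', hc⟩ := exists_commute_of_corner_inverse (isUnit_two_chainEnd h2)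
    (fun i : Fin n ↦ diagEnd f (Pi.single i 1)) (fun i ↦ by rw [hsingle, one_mul])
    (fun i j hij ↦ by
      rw [← map_mul]
      refine IsInducedBy.ext (isInducedBy_diagEnd _) (fun t ↦ ?_)
      rw [LinearMap.zero_apply]
      funext r
      have : (Pi.single i 1 * Pi.single j 1 : Fin n → S) = 0 := by
        ext l
        rcases eq_or_ne l i with rfl | h
        · simp [hij]
        · simp [h]
      rw [this]
      simp [chainMk])
    (fun u i ↦ by
      obtain ⟨A, hA⟩ := exists_isInducedBy (u : ChainEnd f)
      obtain ⟨t, ht⟩ := isUnit_diag hf hm u hA i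
      refine ⟨diagEnd f (Pi.single i ↑t⁻¹), by rw [hsingle, one_mul], by rw [hsingle, mul_one],
        ?_, ?_⟩
      · refine IsInducedBy.ext (((isInducedBy_diagEnd _).mul hA).mul (isInducedBy_diagEnd _)) ?_
        rw [diagonal_single_mul_mul_diagonal_single, ← ht, Units.inv_mul, one_mul]
        exact isInducedBy_diagEnd _
      · refine IsInducedBy.ext (((isInducedBy_diagEnd _).mul hA).mul (isInducedBy_diagEnd _)) ?_
        rw [diagonal_single_mul_mul_diagonal_single, ← ht, one_mul, Units.mul_inv]
        exact isInducedBy_diagEnd _)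
    Finset.univ u
  obtain ⟨A, hA⟩ := exists_isInducedBy (u' : ChainEnd f)
  choose d hd using isUnit_diag hf hm u' hA
  refine ⟨d, ?_⟩
  rw [← hu']
  congr 1
  ext1
  refine (isInducedBy_diagAut d).ext (hA.congr fun r c ↦ ?_)
  rcases eq_or_ne r c with rfl | h
  · simp [hd]
  · have h1 := hA.mul (isInducedBy_diagEnd (Pi.single c 1))
    rw [hc c (Finset.mem_univ c)] at h1
    simpa [Matrix.mul_diagonal, Matrix.diagonal_mul, h] using
      h1.dvd_sub ((isInducedBy_diagEnd (Pi.single c 1)).mul hA) r c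

/-- The partial products of the entries with index at least `i`. -/
def tailProd {G : Type*} [CommGroup G] (d : Fin n → G) (i : Fin n) : G := ∏ r ∈ Finset.Ici i, d r

/-- The entry with the next index, or `1` if there is none. -/
def shiftOne {G : Type*} [CommGroup G] (p : Fin n → G) (i : Fin n) : G :=
  if h : i.val + 1 < n then p ⟨i.val + 1, h⟩ else 1

theorem tailProd_eq {G : Type*} [CommGroup G] (d : Fin n → G) (i : Fin n) :
    tailProd d i = d i * shiftOne (tailProd d) i := by
  rw [tailProd, ← Finset.mul_prod_erase _ _ (Finset.mem_Ici.2 le_rfl), shiftOne]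
  congr 1
  split_ifs with h
  · rw [tailProd]
    refine Finset.prod_congr ?_ fun _ _ ↦ rfl
    ext r
    simp only [Finset.mem_erase, Finset.mem_Ici, Fin.le_def, ne_eq, Fin.ext_iff]
    omega
  · refine Finset.prod_eq_one fun r hr ↦ ?_
    simp only [Finset.mem_erase, Finset.mem_Ici, Fin.le_def, ne_eq, Fin.ext_iff] at hr
    omega

/-- The tuple with prescribed tail products. -/
def tailQuot (G : Type*) [CommGroup G] (n : ℕ) : (Fin n → G) →* (Fin n → G) where
  toFun p i := p i / shiftOne p i
  map_one' := by funext i; simp [shiftOne]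
  map_mul' p q := by
    funext i
    simp only [shiftOne, Pi.mul_apply]
    split_ifs
    · exact mul_div_mul_comm _ _ _ _
    · simp

theorem tailQuot_tailProd {G : Type*} [CommGroup G] (d : Fin n → G) :
    tailQuot G n (tailProd d) = d := by
  funext i
  change tailProd d i / shiftOne (tailProd d) i = d i
  rw [div_eq_iff_eq_mul, tailProd_eq]

theorem tailProd_tailQuot {G : Type*} [CommGroup G] (p : Fin n → G) :
    tailProd (tailQuot G n p) = p := by
  funext i
  induction i using WellFoundedGT.induction with
  | ind i ih =>
    rw [tailProd_eq]
    change p i / shiftOne p i * _ = p i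
    rw [div_mul_eq_mul_div, div_eq_iff_eq_mul]
    congr 1
    rw [shiftOne, shiftOne]
    split_ifs with h
    · exact ih _ (by simp [Fin.lt_def])
    · rfl

theorem one_add_single (d : Sˣ) (i : Fin n) :
    (1 + Matrix.single i i ((d : S) - 1) : Matrix (Fin n) (Fin n) S) =
      Matrix.diagonal fun r ↦ ((Pi.mulSingle i d : Fin n → Sˣ) r : S) := by
  ext r c
  rw [Matrix.add_apply, Matrix.one_apply, Matrix.single_apply, Matrix.diagonal_apply]
  by_cases hr : r = i <;> by_cases hc : c = i <;> by_cases h : r = c <;>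
    grind [Units.val_one]

theorem of_diagAut_mulSingle_succ (h2 : IsUnit (2 : S)) (i j : Fin n) (hij : i.val + 1 = j.val)
    (a : Sˣ) (ha : f j ∣ a - 1) :
    Abelianization.of (diagAut f (Pi.mulSingle i a)) =
      Abelianization.of (diagAut f (Pi.mulSingle j a)) := by
  have hj : Finset.Iic j = insert j (Finset.Iic i) := by
    ext r
    simp only [Finset.mem_insert, Finset.mem_Iic, Fin.le_def, Fin.ext_iff]
    omega
  have hF : ∏ l ∈ Finset.Iic j, f l = f j * ∏ l ∈ Finset.Iic i, f l := by
    have hni : j ∉ Finset.Iic i := by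
      rw [Finset.mem_Iic, Fin.le_def]
      omega
    rw [hj, Finset.prod_insert hni]
  have hne : i ≠ j := by rintro rfl; omega
  obtain ⟨x, hx⟩ := exists_end_isInducedBy (f := f) (Matrix.single i j 1) fun r c ↦ by
    rw [Matrix.single_apply]
    split_ifs with h
    · rw [← h.1, ← h.2, hF, one_mul]
      exact Dvd.intro_left _ rfl
    · simp
  obtain ⟨y, hy⟩ := exists_end_isInducedBy (f := f) (Matrix.single j i ((a : S) - 1))
    fun r c ↦ by
      rw [Matrix.single_apply]
      split_ifs with h
      · rw [← h.1, ← h.2, hF]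
        exact mul_dvd_mul_right ha _
      · simp
  have he := isInducedBy_diagEnd (f := f) (Pi.single i 1)
  rw [Matrix.diagonal_single] at he
  have h0 : IsInducedBy (0 : ChainEnd f) 0 := fun t ↦ by
    rw [LinearMap.zero_apply, Matrix.zero_mulVec]
    funext r
    simp [chainMk]
  refine Abelianization.of_eq_of_one_add_mul_swap (isUnit_two_chainEnd h2)
    (e := diagEnd f (Pi.single i 1)) (x := x) (y := y) ?_ ?_ ?_ ?_ ?_ _ _ ?_ ?_
  · exact (he.mul he).ext (by simpa using he)
  · exact (he.mul hx).ext (by simpa using hx)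
  · exact (hx.mul he).ext (by simpa [hne.symm] using h0)
  · exact (he.mul hy).ext (by simpa [hne] using h0)
  · exact (hy.mul he).ext (by simpa using hy)
  · refine (isInducedBy_diagAut _).ext ?_
    rw [← one_add_single]
    simpa using IsInducedBy.one.add (hx.mul hy)
  · refine (isInducedBy_diagAut _).ext ?_
    rw [← one_add_single]
    simpa using IsInducedBy.one.add (hy.mul hx)

theorem of_diagAut_tailQuot_mulSingle (h2 : IsUnit (2 : S)) (j : Fin n) (a : Sˣ)
    (ha : f j ∣ a - 1) :
    Abelianization.of (diagAut f (tailQuot Sˣ n (Pi.mulSingle j a))) = 1 := by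
  by_cases hj : j.val = 0
  · have h1 : tailQuot Sˣ n (Pi.mulSingle j a) = Pi.mulSingle j a := by
      funext i
      change (Pi.mulSingle j a : Fin n → Sˣ) i / shiftOne (Pi.mulSingle j a) i = _
      rw [div_eq_self, shiftOne]
      split_ifs with h
      · exact Pi.mulSingle_eq_of_ne (by simp [Fin.ext_iff, hj]) _
      · rfl
    have h3 : diagAut f (Pi.mulSingle j a) = 1 := by
      ext1
      refine (isInducedBy_diagAut _).ext (IsInducedBy.one.congr fun r c ↦ ?_)
      rw [← one_add_single, Matrix.add_apply, sub_add_cancel_left, dvd_neg, Matrix.single_apply]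
      split_ifs with h
      · have : Finset.Iic r = {j} := by
          ext l
          simp only [Finset.mem_Iic, Finset.mem_singleton, Fin.le_def, Fin.ext_iff, ← h.1]
          omega
        rwa [this, Finset.prod_singleton]
      · simp
    rw [h1, h3, map_one]
  · let i : Fin n := ⟨j.val - 1, by omega⟩
    have hij : i.val + 1 = j.val := by simp only [i]; omega
    have h1 : tailQuot Sˣ n (Pi.mulSingle j a) = Pi.mulSingle j a / Pi.mulSingle i a := by
      funext l
      change (Pi.mulSingle j a : Fin n → Sˣ) l / shiftOne (Pi.mulSingle j a) l =
        (Pi.mulSingle j a : Fin n → Sˣ) l / (Pi.mulSingle i a : Fin n → Sˣ) l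
      congr 1
      rw [shiftOne]
      split_ifs with h
      · simp only [Pi.mulSingle_apply, Fin.ext_iff]
        congr 1
        simp only [eq_iff_iff]
        omega
      · rw [Pi.mulSingle_eq_of_ne]
        rw [ne_eq, Fin.ext_iff]
        omega
    rw [h1, map_div, map_div, of_diagAut_mulSingle_succ h2 i j hij a ha, div_self']

theorem nonempty_abelianization_chainEnd_units [IsDomain S] [IsLocalRing S]
    (h2 : IsUnit (2 : S)) (hf : ∀ i, f i ≠ 0) (hm : ∀ i, ¬ IsUnit (f i)) :
    Nonempty (Abelianization (ChainEnd f)ˣ ≃* ∀ i, (S ⧸ Ideal.span {f i})ˣ) := by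
  let Φ : (ChainEnd f)ˣ →* ∀ i, (S ⧸ Ideal.span {f i})ˣ :=
    MonoidHom.pi fun i ↦ Units.map (detHom hf i)
  have hΦ : ∀ d i, ((Φ (diagAut f d) i : (S ⧸ Ideal.span {f i})ˣ) : S ⧸ Ideal.span {f i}) =
      Ideal.Quotient.mk _ ((tailProd d i : Sˣ) : S) := fun d i ↦ by
    rw [tailProd, Units.coe_prod, ← blockDet_diagonal]
    exact detHom_apply hf i (isInducedBy_diagAut d)
  refine ⟨MulEquiv.ofBijective (Abelianization.lift Φ) ⟨?_, ?_⟩⟩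
  · rw [injective_iff_map_eq_one]
    intro x
    induction x using QuotientGroup.induction_on with | H u => ?_
    intro hu
    obtain ⟨d, hd⟩ := exists_diagAut hf hm h2 u
    change Abelianization.of u = 1
    change Abelianization.lift Φ (Abelianization.of u) = 1 at hu
    rw [← hd] at hu ⊢
    rw [Abelianization.lift_apply_of] at hu
    let g : (Fin n → Sˣ) →* Abelianization (ChainEnd f)ˣ :=
      Abelianization.of.comp ((diagAut f).comp (tailQuot Sˣ n))
    rw [← tailQuot_tailProd d]
    change g (tailProd d) = 1
    rw [← Finset.univ_prod_mulSingle (tailProd d), map_prod]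
    refine Finset.prod_eq_one fun j _ ↦ of_diagAut_tailQuot_mulSingle h2 j _ ?_
    have := hΦ d j
    rw [hu, Pi.one_apply, Units.val_one, ← map_one (Ideal.Quotient.mk _), eq_comm,
      Ideal.Quotient.mk_eq_mk_iff_sub_mem, Ideal.mem_span_singleton] at this
    exact this
  · intro v
    have hsurj : ∀ i, ∃ p : Sˣ, (v i : S ⧸ Ideal.span {f i}) = Ideal.Quotient.mk _ (p : S) := by
      intro i
      have : Nontrivial (S ⧸ Ideal.span {f i}) :=
        Ideal.Quotient.nontrivial_iff.2 (by rw [ne_eq, Ideal.span_singleton_eq_top]; exact hm i)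
      obtain ⟨s, hs⟩ := Ideal.Quotient.mk_surjective (v i : S ⧸ Ideal.span {f i})
      have : IsLocalHom (Ideal.Quotient.mk (Ideal.span {f i})) :=
        IsLocalHom.of_surjective _ Ideal.Quotient.mk_surjective
      obtain ⟨p, hp⟩ := isUnit_of_map_unit (Ideal.Quotient.mk (Ideal.span {f i})) s
        (by rw [hs]; exact (v i).isUnit)
      exact ⟨p, by rw [hp, hs]⟩
    choose p hp using hsurj
    refine ⟨Abelianization.of (diagAut f (tailQuot Sˣ n p)), ?_⟩
    rw [Abelianization.lift_apply_of]
    funext i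
    ext
    rw [hΦ, tailProd_tailQuot, hp]

end Chain

/-- Let `k` be an algebraically closed field of characteristic
not two, `S = k[[x, y]]`, and `f 1, …, f n ∈ (x, y)` pairwise non-associate
prime elements with `f i ∉ (x, y)²`.  Put `f = f 1 ⋯ f n`, `R = S/(f)`, and
`S i = S/(f 1 ⋯ f i)` (realized as the `R`-module `R/(f 1 ⋯ f i)R`), and let
`L = S 1 ⊕ ⋯ ⊕ S n`.  Then the abelianization of `Aut_R(L)` is isomorphic to
`(S/(f 1))ˣ × ⋯ × (S/(f n))ˣ`. -/
theorem stmt15 {k : Type*} [Field k] [IsAlgClosed k] (hchar : ringChar k ≠ 2)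
    (n : ℕ) (f : Fin n → MvPowerSeries (Fin 2) k)
    (hprime : ∀ i, Prime (f i))
    (hmem : ∀ i, f i ∈ (Ideal.span {MvPowerSeries.X 0, MvPowerSeries.X 1} :
      Ideal (MvPowerSeries (Fin 2) k)))
    (hnassoc : ∀ i j, i ≠ j → ¬ Associated (f i) (f j))
    (hnotsq : ∀ i, f i ∉ (Ideal.span {MvPowerSeries.X 0, MvPowerSeries.X 1} :
      Ideal (MvPowerSeries (Fin 2) k)) ^ 2) :
    Nonempty
      (Abelianization
        (Module.End (MvPowerSeries (Fin 2) k ⧸ Ideal.span {∏ l, f l})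
          (∀ i : Fin n,
            (MvPowerSeries (Fin 2) k ⧸ Ideal.span {∏ l, f l}) ⧸
              Ideal.span
                {Ideal.Quotient.mk (Ideal.span {∏ l, f l}) (∏ l ∈ Finset.Iic i, f l)}))ˣ
        ≃* (∀ i : Fin n, (MvPowerSeries (Fin 2) k ⧸ Ideal.span {f i})ˣ)) := by
  have : IsDomain (MvPowerSeries (Fin 2) k) := NoZeroDivisors.to_isDomain _
  refine nonempty_abelianization_chainEnd_units ?_ (fun i ↦ (hprime i).ne_zero)
    fun i ↦ (hprime i).not_isUnit
  have h2 : IsUnit (2 : k) := (Ring.two_ne_zero hchar).isUnit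
  rw [← map_ofNat (MvPowerSeries.C (σ := Fin 2) (R := k)) 2]
  exact h2.map _
end

section
/- Let k be an algebraically closed field whose characteristic is not 2, 3 or 5, let n ≥ 1, and let S = k[[x, y]] be the formal power series ring in two variables over k. Let R = S/((x−yⁿ)(x+yⁿ))S be the one-dimensional singularity of type A_{2n−1}, and let L be the R-module S/(x−yⁿ)S ⊕ R. Then the abelianization of the automorphism group of the R-module L is isomorphic to (S/(x−yⁿ)S)ˣ × (S/(x+yⁿ)S)ˣ, which in turn is isomorphic to the direct sum of two copies of the unit group k[[X]]ˣ of the formal power series ring in one variable over k. -/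
set_option synthInstance.maxHeartbeats 4000000
set_option maxHeartbeats 4000000

namespace CurveSingularity

section Abelianization

open scoped commutatorElement

variable {R : Type*} [CommRing R] {f g : R}

/-- The `R`-module `R/(f) ⊕ R`. -/
abbrev Rep (f : R) : Type _ := (R ⧸ Ideal.span {f}) × R

theorem end_apply_mk (φ : Module.End R (Rep f)) (p r : R) :
    φ (Ideal.Quotient.mk _ p, r) = p • φ (1, 0) + r • φ (0, 1) := by
  rw [← map_smul, ← map_smul, ← map_add]
  congr 1
  ext
  · simp [Algebra.smul_def]
  · simp

theorem end_ext {φ ψ : Module.End R (Rep f)} (h₁ : φ (1, 0) = ψ (1, 0))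
    (h₂ : φ (0, 1) = ψ (0, 1)) : φ = ψ := by
  refine LinearMap.ext fun ⟨x, r⟩ => ?_
  obtain ⟨p, rfl⟩ := Ideal.Quotient.mk_surjective x
  rw [end_apply_mk, end_apply_mk, h₁, h₂]

theorem dvd_snd (hann : ∀ x, f * x = 0 → g ∣ x) (φ : Module.End R (Rep f)) :
    g ∣ (φ (1, 0)).2 := by
  refine hann _ ?_
  have h : f • ((1, 0) : Rep f) = 0 := by
    ext
    · simp [Algebra.smul_def]
    · simp
  simpa using congrArg Prod.snd ((map_smul φ f _).symm.trans ((congrArg φ h).trans (map_zero φ)))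

/-- The determinant over `R/(f)` of an endomorphism of `R/(f) ⊕ R`. -/
def detHom (f : R) : Module.End R (Rep f) →* R ⧸ Ideal.span {f} where
  toFun φ := (φ (1, 0)).1 * Ideal.Quotient.mk _ (φ (0, 1)).2 -
    (φ (0, 1)).1 * Ideal.Quotient.mk _ (φ (1, 0)).2
  map_one' := by simp
  map_mul' φ ψ := by
    simp only [Module.End.mul_apply]
    obtain ⟨p, hp⟩ := Ideal.Quotient.mk_surjective (ψ (1, 0)).1
    obtain ⟨q, hq⟩ := Ideal.Quotient.mk_surjective (ψ (0, 1)).1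
    have h₁ : ψ (1, 0) = (Ideal.Quotient.mk _ p, (ψ (1, 0)).2) := by rw [hp]
    have h₂ : ψ (0, 1) = (Ideal.Quotient.mk _ q, (ψ (0, 1)).2) := by rw [hq]
    rw [← hp, ← hq, h₁, h₂, end_apply_mk, end_apply_mk]
    simp only [Prod.fst_add, Prod.snd_add, Prod.smul_fst, Prod.smul_snd]
    simp only [Algebra.smul_def, map_add, map_mul, Ideal.Quotient.algebraMap_eq,
      Algebra.algebraMap_self, RingHom.id_apply]
    ring

/-- The scalar by which an endomorphism of `R/(f) ⊕ R` acts on `R/(g)`, when the annihilator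
of `f` is contained in `(g)`. -/
def scalarHom (hann : ∀ x, f * x = 0 → g ∣ x) :
    Module.End R (Rep f) →* R ⧸ Ideal.span {g} where
  toFun φ := Ideal.Quotient.mk _ (φ (0, 1)).2
  map_one' := by simp
  map_mul' φ ψ := by
    simp only [Module.End.mul_apply]
    obtain ⟨q, hq⟩ := Ideal.Quotient.mk_surjective (ψ (0, 1)).1
    have h₂ : ψ (0, 1) = (Ideal.Quotient.mk _ q, (ψ (0, 1)).2) := by rw [hq]
    rw [h₂, end_apply_mk, ← map_mul, Ideal.Quotient.mk_eq_mk_iff_sub_mem,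
      Ideal.mem_span_singleton]
    obtain ⟨c, hc⟩ := dvd_snd hann φ
    refine ⟨q * c, ?_⟩
    simp only [Prod.snd_add, Prod.smul_snd, hc, smul_eq_mul]
    ring

/-- The endomorphism `(x, r) ↦ (x + r b, r)`. -/
def upperEnd (f b : R) : Module.End R (Rep f) :=
  LinearMap.id + (LinearMap.inl R _ _).comp
    ((LinearMap.toSpanSingleton R _ (Ideal.Quotient.mk (Ideal.span {f}) b)).comp
      (LinearMap.snd R _ _))

theorem upperEnd_apply (b p r : R) :
    upperEnd f b (Ideal.Quotient.mk _ p, r) = (Ideal.Quotient.mk _ (p + r * b), r) := by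
  ext <;> simp [upperEnd, Algebra.smul_def]

/-- Multiplication by `g c` as a map `R/(f) → R`. -/
def mulQuot (hfg : f * g = 0) (c : R) : (R ⧸ Ideal.span {f}) →ₗ[R] R :=
  Submodule.liftQ (Ideal.span {f}) (LinearMap.mulLeft R (g * c)) <| by
    rw [Ideal.span, Submodule.span_le, Set.singleton_subset_iff]
    simp only [SetLike.mem_coe, LinearMap.mem_ker, LinearMap.mulLeft_apply]
    linear_combination c * hfg

theorem mulQuot_mk (hfg : f * g = 0) (c p : R) :
    mulQuot hfg c (Ideal.Quotient.mk _ p) = g * c * p := rfl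

/-- The endomorphism `(x, r) ↦ (x, r + g c x)`. -/
def lowerEnd (hfg : f * g = 0) (c : R) : Module.End R (Rep f) :=
  LinearMap.id + (LinearMap.inr R _ _).comp ((mulQuot hfg c).comp (LinearMap.fst R _ _))

theorem lowerEnd_apply (hfg : f * g = 0) (c p r : R) :
    lowerEnd hfg c (Ideal.Quotient.mk _ p, r) = (Ideal.Quotient.mk _ p, r + g * c * p) := by
  ext <;> simp [lowerEnd, mulQuot_mk]

/-- The endomorphism `(x, r) ↦ (a x, d r)`. -/
def diagEnd (a : R ⧸ Ideal.span {f}) (d : R) : Module.End R (Rep f) :=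
  LinearMap.prodMap (LinearMap.mulLeft R a) (LinearMap.mulLeft R d)

theorem diagEnd_apply (a : R ⧸ Ideal.span {f}) (d : R) (x : Rep f) :
    diagEnd a d x = (a * x.1, d * x.2) := rfl

theorem one_zero_eq : ((1, 0) : Rep f) = (Ideal.Quotient.mk _ 1, 0) := by simp

theorem zero_one_eq : ((0, 1) : Rep f) = (Ideal.Quotient.mk _ 0, 1) := by simp

theorem upperEnd_mul (b b' : R) : upperEnd f b * upperEnd f b' = upperEnd f (b + b') := by
  apply end_ext <;> simp only [one_zero_eq, zero_one_eq, Module.End.mul_apply, upperEnd_apply] <;>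
    ring_nf

theorem lowerEnd_mul (hfg : f * g = 0) (c c' : R) :
    lowerEnd hfg c * lowerEnd hfg c' = lowerEnd hfg (c + c') := by
  apply end_ext <;> simp only [one_zero_eq, zero_one_eq, Module.End.mul_apply, lowerEnd_apply] <;>
    ring_nf

theorem upperEnd_zero : upperEnd f 0 = 1 := by
  apply end_ext <;> simp [one_zero_eq, zero_one_eq, upperEnd_apply]

theorem lowerEnd_zero (hfg : f * g = 0) : lowerEnd hfg 0 = 1 := by
  apply end_ext <;> simp only [one_zero_eq, zero_one_eq, lowerEnd_apply] <;> simp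

/-- The automorphism `(x, r) ↦ (x + r b, r)`. -/
def upper (f b : R) : (Module.End R (Rep f))ˣ where
  val := upperEnd f b
  inv := upperEnd f (-b)
  val_inv := by rw [upperEnd_mul, add_neg_cancel, upperEnd_zero]
  inv_val := by rw [upperEnd_mul, neg_add_cancel, upperEnd_zero]

/-- The automorphism `(x, r) ↦ (x, r + g c x)`. -/
def lower (hfg : f * g = 0) (c : R) : (Module.End R (Rep f))ˣ where
  val := lowerEnd hfg c
  inv := lowerEnd hfg (-c)
  val_inv := by rw [lowerEnd_mul, add_neg_cancel, lowerEnd_zero]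
  inv_val := by rw [lowerEnd_mul, neg_add_cancel, lowerEnd_zero]

/-- The automorphism `(x, r) ↦ (a x, d r)`. -/
def diag (a : (R ⧸ Ideal.span {f})ˣ) (d : Rˣ) : (Module.End R (Rep f))ˣ where
  val := diagEnd a d
  inv := diagEnd ↑a⁻¹ ↑d⁻¹
  val_inv := by apply end_ext <;> simp [diagEnd_apply]
  inv_val := by apply end_ext <;> simp [diagEnd_apply]

theorem upper_mem_commutator {u : R} (hu : IsUnit u) (hu₁ : IsUnit (u - 1)) (b : R) :
    upper f b ∈ commutator (Module.End R (Rep f))ˣ := by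
  obtain ⟨u, rfl⟩ := hu
  obtain ⟨v, hv⟩ := hu₁
  have h : upper f b =
      ⁅diag (Units.map (Ideal.Quotient.mk (Ideal.span {f})).toMonoidHom u) 1,
        upper f (↑v⁻¹ * b)⁆ := by
    rw [commutatorElement_def, eq_mul_inv_iff_mul_eq, eq_mul_inv_iff_mul_eq]
    have hb : (u : R) * (↑v⁻¹ * b) = b + ↑v⁻¹ * b := by
      linear_combination (↑v⁻¹ * b) * (-hv) + b * v.inv_mul
    ext1
    apply end_ext
    · simp [one_zero_eq, upper, diag, upperEnd_apply, diagEnd_apply, ← map_mul, -map_one]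
    · simp only [zero_one_eq, upper, diag, Units.val_mul, Module.End.mul_apply, upperEnd_apply,
        diagEnd_apply, Units.coe_map, RingHom.toMonoidHom_eq_coe, MonoidHom.coe_coe, ← map_mul,
        Units.val_one]
      refine Prod.ext (congrArg (Ideal.Quotient.mk _) ?_) rfl
      linear_combination -hb
  rw [h]
  exact Subgroup.commutator_mem_commutator (Subgroup.mem_top _) (Subgroup.mem_top _)

theorem lower_mem_commutator (hfg : f * g = 0) {u : R} (hu : IsUnit u) (hu₁ : IsUnit (u - 1))
    (c : R) : lower hfg c ∈ commutator (Module.End R (Rep f))ˣ := by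
  obtain ⟨u, rfl⟩ := hu
  obtain ⟨v, hv⟩ := hu₁
  have h : lower hfg c = ⁅diag (f := f) 1 u, lower hfg (↑v⁻¹ * c)⁆ := by
    rw [commutatorElement_def, eq_mul_inv_iff_mul_eq, eq_mul_inv_iff_mul_eq]
    have hc : (u : R) * (↑v⁻¹ * c) = c + ↑v⁻¹ * c := by
      linear_combination (↑v⁻¹ * c) * (-hv) + c * v.inv_mul
    ext1
    apply end_ext
    · simp only [one_zero_eq, lower, diag, Units.val_mul, Module.End.mul_apply, lowerEnd_apply,
        diagEnd_apply, Units.val_one, one_mul]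
      refine Prod.ext rfl ?_
      linear_combination -g * hc
    · simp only [zero_one_eq, lower, diag, Units.val_mul, Module.End.mul_apply, lowerEnd_apply,
        diagEnd_apply, Units.val_one, one_mul]
      refine Prod.ext rfl ?_
      ring
  rw [h]
  exact Subgroup.commutator_mem_commutator (Subgroup.mem_top _) (Subgroup.mem_top _)

/-- The diagonal automorphism `(x, r) ↦ (d⁻¹ x, d r)`. -/
def diagInv (f : R) (d : Rˣ) : (Module.End R (Rep f))ˣ :=
  diag (Units.map (Ideal.Quotient.mk (Ideal.span {f})).toMonoidHom d⁻¹) d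

theorem eq_upper_mul_lower_mul_diagInv (hfg : f * g = 0) {φ : (Module.End R (Rep f))ˣ}
    {a b c : R} {d : Rˣ} (h₁ : φ.val (1, 0) = (Ideal.Quotient.mk _ a, g * c))
    (h₂ : φ.val (0, 1) = (Ideal.Quotient.mk _ b, (d : R)))
    (hdet : detHom f φ.val = 1) :
    φ = upper f (b * ↑d⁻¹) * lower hfg (c * d) * diagInv f d := by
  have hd : Ideal.Quotient.mk (Ideal.span {f}) (a * d - b * (g * c)) = 1 := by
    simpa [detHom, h₁, h₂] using hdet
  ext1
  apply end_ext
  · rw [h₁]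
    simp only [one_zero_eq, upper, lower, diag, diagInv, Units.val_mul, Module.End.mul_apply,
      lowerEnd_apply, upperEnd_apply, diagEnd_apply, Units.coe_map, RingHom.toMonoidHom_eq_coe,
      MonoidHom.coe_coe, ← map_mul]
    refine Prod.ext ?_ ?_
    · have hinv : Ideal.Quotient.mk (Ideal.span {f}) d * Ideal.Quotient.mk _ (↑d⁻¹ : R) = 1 := by
        rw [← map_mul, d.mul_inv, map_one]
      simp only [map_add, map_mul, map_sub, map_one, map_zero] at hd ⊢
      linear_combination (Ideal.Quotient.mk (Ideal.span {f}) (↑d⁻¹ : R)) * hd -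
        (Ideal.Quotient.mk (Ideal.span {f}) a + Ideal.Quotient.mk (Ideal.span {f}) g *
          Ideal.Quotient.mk (Ideal.span {f}) c * Ideal.Quotient.mk (Ideal.span {f}) b *
          Ideal.Quotient.mk (Ideal.span {f}) (↑d⁻¹ : R)) * hinv
    · dsimp only
      linear_combination (-g * c) * d.mul_inv
  · rw [h₂]
    simp only [zero_one_eq, upper, lower, diag, diagInv, Units.val_mul, Module.End.mul_apply,
      lowerEnd_apply, upperEnd_apply, diagEnd_apply, Units.coe_map, RingHom.toMonoidHom_eq_coe,
      MonoidHom.coe_coe, ← map_mul]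
    refine Prod.ext (congrArg (Ideal.Quotient.mk _) ?_) ?_
    · linear_combination (-b) * d.inv_mul
    · ring

theorem isUnit_of_isUnit_mk [IsLocalRing R] (hg : ¬ IsUnit g) {r : R}
    (hr : IsUnit (Ideal.Quotient.mk (Ideal.span {g}) r)) : IsUnit r := by
  obtain ⟨s, hs⟩ := hr.exists_right_inv
  obtain ⟨s, rfl⟩ := Ideal.Quotient.mk_surjective s
  rw [← map_mul, ← map_one (Ideal.Quotient.mk _), Ideal.Quotient.mk_eq_mk_iff_sub_mem,
    Ideal.mem_span_singleton] at hs
  obtain ⟨c, hc⟩ := hs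
  have h : IsUnit (r * s + -(g * c)) := by
    rw [show r * s + -(g * c) = 1 by linear_combination hc]
    exact isUnit_one
  rcases IsLocalRing.isUnit_or_isUnit_of_isUnit_add h with h | h
  · exact isUnit_of_mul_isUnit_left h
  · exact absurd (isUnit_of_mul_isUnit_left ((IsUnit.neg_iff _).1 h)) hg

/-- The pair consisting of the determinant over `R/(f)` and the scalar action on `R/(g)`. -/
def detScalarHom (hann : ∀ x, f * x = 0 → g ∣ x) :
    (Module.End R (Rep f))ˣ →* (R ⧸ Ideal.span {f})ˣ × (R ⧸ Ideal.span {g})ˣ :=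
  (Units.map (detHom f)).prod (Units.map (scalarHom hann))

theorem detScalarHom_surjective [IsLocalRing R] (hann : ∀ x, f * x = 0 → g ∣ x)
    (hg : ¬ IsUnit g) : Function.Surjective (detScalarHom hann) := by
  rintro ⟨α, β⟩
  obtain ⟨r, hr⟩ := Ideal.Quotient.mk_surjective β.val
  obtain ⟨d, rfl⟩ := isUnit_of_isUnit_mk hg (hr ▸ β.isUnit)
  refine ⟨diag (α * Units.map (Ideal.Quotient.mk (Ideal.span {f})).toMonoidHom d⁻¹) d, ?_⟩
  refine Prod.ext (Units.ext ?_) (Units.ext ?_)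
  · simp [detScalarHom, detHom, diag, diagEnd_apply, mul_assoc, ← map_mul]
  · simpa [detScalarHom, scalarHom, diag, diagEnd_apply] using hr

theorem ker_detScalarHom [IsLocalRing R] (hfg : f * g = 0) (hann : ∀ x, f * x = 0 → g ∣ x)
    (hg : ¬ IsUnit g) {u : R} (hu : IsUnit u) (hu₁ : IsUnit (u - 1)) :
    (detScalarHom hann).ker = commutator (Module.End R (Rep f))ˣ := by
  refine le_antisymm (fun φ hφ => ?_) (Abelianization.commutator_subset_ker _)
  obtain ⟨hdet, hsc⟩ := Prod.ext_iff.1 hφ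
  replace hdet : detHom f φ.val = 1 := congrArg Units.val hdet
  replace hsc : Ideal.Quotient.mk (Ideal.span {g}) (φ.val (0, 1)).2 = 1 := congrArg Units.val hsc
  obtain ⟨a, ha⟩ := Ideal.Quotient.mk_surjective (φ.val (1, 0)).1
  obtain ⟨b, hb⟩ := Ideal.Quotient.mk_surjective (φ.val (0, 1)).1
  obtain ⟨c, hc⟩ := dvd_snd hann φ.val
  obtain ⟨d, hd⟩ := isUnit_of_isUnit_mk hg (hsc ▸ isUnit_one)
  rw [← hd, ← map_one (Ideal.Quotient.mk _), Ideal.Quotient.mk_eq_mk_iff_sub_mem,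
    Ideal.mem_span_singleton] at hsc
  obtain ⟨e, he⟩ := hsc
  have hU := upper_mem_commutator (f := f) hu hu₁
  have hL := lower_mem_commutator hfg hu hu₁
  have hD : diagInv f d ∈ commutator (Module.End R (Rep f))ˣ := by
    have h := eq_upper_mul_lower_mul_diagInv hfg (φ := lower hfg e * upper f 1)
      (a := 1) (b := 1) (c := e) (d := d)
      (by simp only [one_zero_eq, lower, upper, Units.val_mul, Module.End.mul_apply,
            lowerEnd_apply, upperEnd_apply]
          exact Prod.ext (congrArg (Ideal.Quotient.mk _) (by ring)) (by ring))
      (by simp only [zero_one_eq, lower, upper, Units.val_mul, Module.End.mul_apply,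
            lowerEnd_apply, upperEnd_apply]
          refine Prod.ext (congrArg (Ideal.Quotient.mk _) (by ring)) ?_
          linear_combination -he)
      (by
        have h : lower hfg e * upper f 1 ∈ (detScalarHom hann).ker :=
          Abelianization.commutator_subset_ker _ (mul_mem (hL _) (hU _))
        exact congrArg Units.val (Prod.ext_iff.1 h).1)
    rw [← inv_mul_eq_iff_eq_mul] at h
    rw [← h]
    exact mul_mem (inv_mem (mul_mem (hU _) (hL _))) (mul_mem (hL _) (hU _))
  rw [eq_upper_mul_lower_mul_diagInv hfg (Prod.ext ha.symm hc) (Prod.ext hb.symm hd.symm) hdet]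
  exact mul_mem (mul_mem (hU _) (hL _)) hD

/-- The abelianization of the automorphism group of `R/(f) ⊕ R`. -/
noncomputable def abelianizationEquiv [IsLocalRing R] (hfg : f * g = 0)
    (hann : ∀ x, f * x = 0 → g ∣ x) (hg : ¬ IsUnit g) {u : R} (hu : IsUnit u)
    (hu₁ : IsUnit (u - 1)) :
    Abelianization (Module.End R (Rep f))ˣ ≃*
      (R ⧸ Ideal.span {f})ˣ × (R ⧸ Ideal.span {g})ˣ :=
  (QuotientGroup.quotientMulEquivOfEq (ker_detScalarHom hfg hann hg hu hu₁).symm).trans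
    (QuotientGroup.quotientKerEquivOfSurjective _ (detScalarHom_surjective hann hg))

end Abelianization

section Branch

open MvPowerSeries

variable {k : Type*} [Field k]

theorem hasSubst_shear (c : k) {n : ℕ} (hn : n ≠ 0) :
    HasSubst (![X 0 + C c * X 1 ^ n, X 1] : Fin 2 → MvPowerSeries (Fin 2) k) := by
  refine hasSubst_of_constantCoeff_zero fun s => ?_
  fin_cases s <;> simp [hn]

/-- The endomorphism `x ↦ x + c yⁿ`, `y ↦ y` of `k[[x, y]]`. -/
noncomputable def shear (c : k) {n : ℕ} (hn : n ≠ 0) :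
    MvPowerSeries (Fin 2) k →ₐ[k] MvPowerSeries (Fin 2) k :=
  substAlgHom (hasSubst_shear c hn)

theorem shear_X_zero (c : k) {n : ℕ} (hn : n ≠ 0) :
    shear c hn (X 0) = X 0 + C c * X 1 ^ n :=
  substAlgHom_X _ _

theorem shear_X_one (c : k) {n : ℕ} (hn : n ≠ 0) : shear c hn (X 1) = X 1 :=
  substAlgHom_X _ _

theorem shear_shear {c c' : k} (h : c + c' = 0) {n : ℕ} (hn : n ≠ 0)
    (p : MvPowerSeries (Fin 2) k) : shear c hn (shear c' hn p) = p := by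
  have hC (a : k) : shear c hn (C a) = C a := (shear c hn).commutes a
  have hX : (fun s => subst (![X 0 + C c * X 1 ^ n, X 1] : Fin 2 → MvPowerSeries (Fin 2) k)
      ((![X 0 + C c' * X 1 ^ n, X 1] : Fin 2 → MvPowerSeries (Fin 2) k) s)) = X := by
    rw [← coe_substAlgHom (R := k) (hasSubst_shear c hn)]
    funext s
    change shear c hn _ = _
    fin_cases s
    · simp only [Fin.zero_eta, Matrix.cons_val_zero, map_add, map_mul, map_pow, hC,
        shear_X_zero, shear_X_one]
      rw [add_assoc, ← add_mul, ← map_add, h]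
      simp
    · simpa using shear_X_one c hn
  rw [shear, shear, substAlgHom_apply, substAlgHom_apply,
    subst_comp_subst_apply (hasSubst_shear c' hn) (hasSubst_shear c hn), hX, subst_self, id]

/-- The automorphism `x ↦ x + c yⁿ`, `y ↦ y` of `k[[x, y]]`. -/
noncomputable def shearEquiv (c : k) {n : ℕ} (hn : n ≠ 0) :
    MvPowerSeries (Fin 2) k ≃+* MvPowerSeries (Fin 2) k :=
  RingEquiv.ofRingHom (shear c hn).toRingHom (shear (-c) hn).toRingHom
    (RingHom.ext fun p => shear_shear (add_neg_cancel c) hn p)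
    (RingHom.ext fun p => shear_shear (neg_add_cancel c) hn p)

/-- The embedding of the variable `y` into the set of variables `x, y`. -/
def yEmb : Unit ↪ Fin 2 := ⟨fun _ => 1, fun _ _ _ => rfl⟩

theorem ker_killCompl_yEmb :
    RingHom.ker (killCompl (R := k) yEmb) = Ideal.span {(X 0 : MvPowerSeries (Fin 2) k)} := by
  ext p
  rw [RingHom.mem_ker, Ideal.mem_span_singleton, X_dvd_iff]
  constructor
  · intro h m hm
    have hm' : m = Finsupp.embDomain yEmb (Finsupp.single () (m 1)) := by
      rw [Finsupp.embDomain_single]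
      ext i
      fin_cases i
      · exact hm.trans (Finsupp.single_eq_of_ne (by decide)).symm
      · exact Finsupp.single_eq_same.symm
    rw [hm', ← coeff_killCompl, h, map_zero]
  · intro h
    refine MvPowerSeries.ext fun m => ?_
    rw [coeff_killCompl, map_zero]
    refine h _ (Finsupp.embDomain_of_notMem_range _ _ _ ?_)
    rintro ⟨_, h⟩
    exact one_ne_zero h

/-- The smooth branch `x + c yⁿ = 0` has coordinate ring `k[[X]]`. -/
noncomputable def branchEquiv (c : k) {n : ℕ} (hn : n ≠ 0) :
    (MvPowerSeries (Fin 2) k ⧸ Ideal.span {(X 0 + C c * X 1 ^ n : MvPowerSeries (Fin 2) k)}) ≃+*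
      PowerSeries k :=
  (Ideal.quotientEquiv _ _ (shearEquiv c hn) (by
    change _ = Ideal.map _ (RingHom.ker (killCompl (R := k) yEmb))
    rw [ker_killCompl_yEmb, Ideal.map_span, Set.image_singleton]
    exact congrArg (fun x => Ideal.span {x}) (shear_X_zero c hn).symm)).symm.trans
  (RingHom.quotientKerEquivOfSurjective (f := killCompl (R := k) yEmb)
    fun p => ⟨rename yEmb p, killCompl_rename_app p⟩)

theorem X_zero_add_ne_zero (c : k) {n : ℕ} (hn : n ≠ 0) :
    (X 0 + C c * X 1 ^ n : MvPowerSeries (Fin 2) k) ≠ 0 := by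
  rw [← shear_X_zero c hn]
  refine (map_ne_zero_iff _ (shearEquiv c hn).injective).2 fun h => ?_
  simpa [h] using coeff_index_single_self_X (R := k) (0 : Fin 2)

end Branch

/-- The third isomorphism theorem for principal ideals. -/
noncomputable def quotQuotSpanEquiv {S : Type*} [CommRing S] {a b : S} (h : b ∣ a) :
    ((S ⧸ Ideal.span {a}) ⧸ Ideal.span {Ideal.Quotient.mk (Ideal.span {a}) b}) ≃+*
      S ⧸ Ideal.span {b} :=
  (Ideal.quotEquivOfEq (by rw [Ideal.map_span, Set.image_singleton])).trans
    (DoubleQuot.quotQuotEquivQuotOfLE (Ideal.span_singleton_le_span_singleton.2 h))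

theorem dvd_mk_of_mk_mul_eq_zero {S : Type*} [CommRing S] [NoZeroDivisors S] {a b : S} (ha : a ≠ 0)
    (x : S ⧸ Ideal.span {a * b}) (hx : Ideal.Quotient.mk _ a * x = 0) :
    Ideal.Quotient.mk _ b ∣ x := by
  obtain ⟨p, rfl⟩ := Ideal.Quotient.mk_surjective x
  rw [← map_mul, Ideal.Quotient.eq_zero_iff_mem, Ideal.mem_span_singleton] at hx
  obtain ⟨c, hc⟩ := hx
  exact map_dvd _ ⟨c, mul_left_cancel₀ ha (hc.trans (mul_assoc _ _ _))⟩

end CurveSingularity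

/-- Let `k` be an algebraically closed field of characteristic
not `2`, `3` or `5`, `n ≥ 1`, `S = k[[x, y]]` and `R = S/((x - yⁿ)(x + yⁿ))`
the `A_{2n-1}` curve singularity.  Let `L = S/(x - yⁿ) ⊕ R` (the first summand
realized as the `R`-module `R/(x - yⁿ)R`).  Then the abelianization of
`Aut_R(L)` is isomorphic to `(S/(x - yⁿ))ˣ × (S/(x + yⁿ))ˣ`, which in turn is
isomorphic to `k[[X]]ˣ × k[[X]]ˣ`. -/
theorem stmt16 {k : Type*} [Field k] [IsAlgClosed k]
    (h2 : ringChar k ≠ 2) (h3 : ringChar k ≠ 3) (h5 : ringChar k ≠ 5)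
    (n : ℕ) (hn : 1 ≤ n) :
    Nonempty
      (Abelianization
        (Module.End
          (MvPowerSeries (Fin 2) k ⧸
            Ideal.span {((MvPowerSeries.X 0 - MvPowerSeries.X 1 ^ n) *
              (MvPowerSeries.X 0 + MvPowerSeries.X 1 ^ n) : MvPowerSeries (Fin 2) k)})
          (((MvPowerSeries (Fin 2) k ⧸
              Ideal.span {((MvPowerSeries.X 0 - MvPowerSeries.X 1 ^ n) *
                (MvPowerSeries.X 0 + MvPowerSeries.X 1 ^ n) : MvPowerSeries (Fin 2) k)}) ⧸
            Ideal.span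
              {Ideal.Quotient.mk
                (Ideal.span {((MvPowerSeries.X 0 - MvPowerSeries.X 1 ^ n) *
                  (MvPowerSeries.X 0 + MvPowerSeries.X 1 ^ n) : MvPowerSeries (Fin 2) k)})
                (MvPowerSeries.X 0 - MvPowerSeries.X 1 ^ n)}) ×
           (MvPowerSeries (Fin 2) k ⧸
            Ideal.span {((MvPowerSeries.X 0 - MvPowerSeries.X 1 ^ n) *
              (MvPowerSeries.X 0 + MvPowerSeries.X 1 ^ n) : MvPowerSeries (Fin 2) k)})))ˣ
        ≃* ((MvPowerSeries (Fin 2) k ⧸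
              Ideal.span {(MvPowerSeries.X 0 - MvPowerSeries.X 1 ^ n :
                MvPowerSeries (Fin 2) k)})ˣ ×
            (MvPowerSeries (Fin 2) k ⧸
              Ideal.span {(MvPowerSeries.X 0 + MvPowerSeries.X 1 ^ n :
                MvPowerSeries (Fin 2) k)})ˣ)) ∧
    Nonempty
      (((MvPowerSeries (Fin 2) k ⧸
            Ideal.span {(MvPowerSeries.X 0 - MvPowerSeries.X 1 ^ n :
              MvPowerSeries (Fin 2) k)})ˣ ×
          (MvPowerSeries (Fin 2) k ⧸
            Ideal.span {(MvPowerSeries.X 0 + MvPowerSeries.X 1 ^ n :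
              MvPowerSeries (Fin 2) k)})ˣ)
        ≃* ((PowerSeries k)ˣ × (PowerSeries k)ˣ)) := by
  have hn' : n ≠ 0 := Nat.one_le_iff_ne_zero.1 hn
  have e₁ := CurveSingularity.branchEquiv (-1 : k) hn'
  have e₂ := CurveSingularity.branchEquiv (1 : k) hn'
  have hf := CurveSingularity.X_zero_add_ne_zero (-1 : k) hn'
  rw [map_neg, map_one, neg_one_mul, ← sub_eq_add_neg] at e₁ hf
  rw [map_one, one_mul] at e₂
  refine ⟨?_, ⟨(Units.mapEquiv e₁.toMulEquiv).prodCongr (Units.mapEquiv e₂.toMulEquiv)⟩⟩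
  generalize hfdef : (MvPowerSeries.X 0 - MvPowerSeries.X 1 ^ n : MvPowerSeries (Fin 2) k) = f
    at hf ⊢
  generalize hgdef : (MvPowerSeries.X 0 + MvPowerSeries.X 1 ^ n : MvPowerSeries (Fin 2) k) = g
  have hg : MvPowerSeries.constantCoeff g = 0 := by simp [← hgdef, hn']
  have hgu : ¬ IsUnit (Ideal.Quotient.mk (Ideal.span {f * g}) g) := by
    intro h
    obtain ⟨s, hs⟩ := h.exists_right_inv
    obtain ⟨s, rfl⟩ := Ideal.Quotient.mk_surjective s
    rw [← map_mul, ← map_one (Ideal.Quotient.mk _), Ideal.Quotient.mk_eq_mk_iff_sub_mem,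
      Ideal.mem_span_singleton] at hs
    obtain ⟨c, hc⟩ := hs
    simpa [hg] using congrArg MvPowerSeries.constantCoeff hc
  have : Nontrivial (MvPowerSeries (Fin 2) k ⧸ Ideal.span {f * g}) := by
    by_contra h
    rw [not_nontrivial_iff_subsingleton] at h
    exact hgu (isUnit_of_subsingleton _)
  have : IsLocalRing (MvPowerSeries (Fin 2) k ⧸ Ideal.span {f * g}) :=
    IsLocalRing.of_surjective' _ Ideal.Quotient.mk_surjective
  have : Infinite k := IsAlgClosed.instInfinite
  classical
  obtain ⟨u, hu⟩ := Infinite.exists_notMem_finset ({0, 1} : Finset k)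
  simp only [Finset.mem_insert, Finset.mem_singleton, not_or] at hu
  let ι := (Ideal.Quotient.mk (Ideal.span {f * g})).comp MvPowerSeries.C
  have hu₀ : IsUnit (ι u) := (isUnit_iff_ne_zero.2 hu.1).map ι
  have hu₁ : IsUnit (ι u - 1) := by
    rw [← map_one ι, ← map_sub]
    exact (isUnit_iff_ne_zero.2 (sub_ne_zero.2 hu.2)).map ι
  have hfg : Ideal.Quotient.mk (Ideal.span {f * g}) f * Ideal.Quotient.mk _ g = 0 := by
    rw [← map_mul, Ideal.Quotient.eq_zero_iff_mem]
    exact Ideal.mem_span_singleton_self _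
  exact ⟨(CurveSingularity.abelianizationEquiv hfg
    (CurveSingularity.dvd_mk_of_mk_mul_eq_zero hf) hgu hu₀ hu₁).trans
    ((Units.mapEquiv (CurveSingularity.quotQuotSpanEquiv (dvd_mul_right f g)).toMulEquiv).prodCongr
      (Units.mapEquiv (CurveSingularity.quotQuotSpanEquiv (dvd_mul_left g f)).toMulEquiv))⟩
end

section
/- Let k be an algebraically closed field whose characteristic is not 2, 3 or 5, let n ≥ 2, and let S = k[[x, y]] be the formal power series ring in two variables over k. Let R = S/((x−y^{n−1})·y·(x+y^{n−1}))S be the one-dimensional singularity of type D_{2n}, and let L be the R-module S/(x−y^{n−1})S ⊕ S/((x−y^{n−1})y)S ⊕ R. Then the abelianization of the automorphism group of the R-module L is isomorphic to (S/(x−y^{n−1})S)ˣ × (S/(y)S)ˣ × (S/(x+y^{n−1})S)ˣ, which in turn is isomorphic to the direct sum of three copies of the unit group k[[X]]ˣ of the formal power series ring in one variable over k. -/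
set_option synthInstance.maxHeartbeats 4000000
set_option maxHeartbeats 4000000

section PowerSeriesQuotients

open MvPowerSeries

variable {k : Type*} [Field k]

theorem MvPowerSeries.nonempty_quotient_span_X_ringEquiv (i : Fin 2) :
    Nonempty ((MvPowerSeries (Fin 2) k ⧸
      Ideal.span {(X i : MvPowerSeries (Fin 2) k)}) ≃+* PowerSeries k) := by
  obtain ⟨j, hj⟩ : ∃ j : Fin 2, ∀ l, l ≠ i ↔ l = j := by
    fin_cases i
    · exact ⟨1, by decide⟩
    · exact ⟨0, by decide⟩
  let e : Unit ↪ Fin 2 := ⟨fun _ => j, fun _ _ _ => rfl⟩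
  have hsurj : Function.Surjective
      ((killCompl (R := k) e : _ →ₐ[k] PowerSeries k) : _ →+* PowerSeries k) :=
    fun p => ⟨rename e p, killCompl_rename_app p⟩
  have hker : RingHom.ker ((killCompl (R := k) e : _ →ₐ[k] PowerSeries k) : _ →+* PowerSeries k) =
      Ideal.span {(X i : MvPowerSeries (Fin 2) k)} := by
    ext f
    rw [RingHom.mem_ker, Ideal.mem_span_singleton, X_dvd_iff]
    constructor
    · intro hf m hm
      obtain ⟨x, rfl⟩ : m ∈ Set.range (Finsupp.embDomain e) := by
        rw [Finsupp.mem_range_embDomain_iff]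
        intro l hl
        have hli : l ≠ i := by
          rintro rfl
          simp [hm] at hl
        exact ⟨(), ((hj l).1 hli).symm⟩
      rw [← coeff_killCompl]
      exact congrArg (coeff x) hf
    · intro hf
      refine MvPowerSeries.ext fun x => ?_
      refine (coeff_killCompl f x).trans (hf _ ?_)
      refine Finsupp.embDomain_of_notMem_range _ _ _ ?_
      rintro ⟨_, h⟩
      exact (hj i).2 h.symm rfl
  exact ⟨(Ideal.quotEquivOfEq hker.symm).trans
    (RingHom.quotientKerEquivOfSurjective hsurj)⟩

theorem MvPowerSeries.hasSubst_shear (c : k) {m : ℕ} (hm : m ≠ 0) :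
    HasSubst (![X 0 + C c * X 1 ^ m, X 1] : Fin 2 → MvPowerSeries (Fin 2) k) := by
  refine hasSubst_of_constantCoeff_zero fun s => ?_
  fin_cases s <;> simp [hm]

theorem MvPowerSeries.substAlgHom_shear_shear (c d : k) {m : ℕ} (hm : m ≠ 0) (hcd : c + d = 0)
    (f : MvPowerSeries (Fin 2) k) :
    substAlgHom (R := k) (hasSubst_shear d hm) (substAlgHom (R := k) (hasSubst_shear c hm) f) =
      f := by
  rw [coe_substAlgHom, coe_substAlgHom,
    subst_comp_subst_apply (hasSubst_shear c hm) (hasSubst_shear d hm)]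
  have h : (fun s => subst (![X 0 + C d * X 1 ^ m, X 1] : Fin 2 → MvPowerSeries (Fin 2) k)
      ((![X 0 + C c * X 1 ^ m, X 1] : Fin 2 → MvPowerSeries (Fin 2) k) s)) = X := by
    funext s
    rw [← coe_substAlgHom (R := k) (hasSubst_shear d hm)]
    fin_cases s
    · have hC : substAlgHom (R := k) (hasSubst_shear d hm) (C c) = C c := by
        exact (substAlgHom (R := k) (hasSubst_shear d hm)).commutes c
      simp only [Fin.zero_eta, Matrix.cons_val_zero, map_add, map_mul, map_pow, hC,
        substAlgHom_X, Matrix.cons_val_one]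
      rw [add_assoc, ← add_mul, ← map_add, add_comm d c, hcd]
      simp
    · exact substAlgHom_X (R := k) (hasSubst_shear d hm) 1
  rw [h, subst_self, id]

theorem MvPowerSeries.nonempty_quotient_span_shear_ringEquiv (c : k) {m : ℕ} (hm : m ≠ 0) :
    Nonempty ((MvPowerSeries (Fin 2) k ⧸
      Ideal.span {(X 0 + C c * X 1 ^ m : MvPowerSeries (Fin 2) k)}) ≃+* PowerSeries k) := by
  obtain ⟨e⟩ := nonempty_quotient_span_X_ringEquiv (k := k) 0
  let σ : MvPowerSeries (Fin 2) k ≃+* MvPowerSeries (Fin 2) k :=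
    RingEquiv.ofRingHom
      (substAlgHom (R := k) (hasSubst_shear c hm) : _ →+* _)
      (substAlgHom (R := k) (hasSubst_shear (-c) hm) : _ →+* _)
      (RingHom.ext fun f => substAlgHom_shear_shear (-c) c hm (by simp) f)
      (RingHom.ext fun f => substAlgHom_shear_shear c (-c) hm (by simp) f)
  have hσ : σ (X 0) = X 0 + C c * X 1 ^ m :=
    (substAlgHom_X (R := k) (hasSubst_shear c hm) 0).trans rfl
  refine ⟨(Ideal.quotientEquiv _ _ σ ?_).symm.trans e⟩
  rw [Ideal.map_span, Set.image_singleton]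
  exact congrArg (fun z => Ideal.span {z}) hσ.symm

end PowerSeriesQuotients

/-- The abelianization of `G` can be computed from a surjection `π : H → G` and a surjection `f`
from `H` onto a commutative group, when `f` factors through `π` and every element of its kernel dies in
the abelianization of `G`. -/
theorem Abelianization.nonempty_mulEquiv_of_surjective {H G D : Type*} [Group H] [Group G]
    [CommGroup D] (π : H →* G) (f : H →* D) (hπ : Function.Surjective π)
    (hf : Function.Surjective f) (h₁ : π.ker ≤ f.ker)
    (h₂ : ∀ h, f h = 1 → Abelianization.of (π h) = 1) :
    Nonempty (Abelianization G ≃* D) := by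
  let F : G →* D := π.liftOfSurjective hπ ⟨f, h₁⟩
  have hF : ∀ h, F (π h) = f h := fun h =>
    MonoidHom.liftOfRightInverse_comp_apply π _ (Function.rightInverse_surjInv hπ) ⟨f, h₁⟩ h
  refine ⟨MulEquiv.ofBijective (Abelianization.lift F) ⟨?_, fun d => ?_⟩⟩
  · rw [injective_iff_map_eq_one]
    intro α hα
    obtain ⟨g, rfl⟩ := QuotientGroup.mk_surjective α
    obtain ⟨h, rfl⟩ := hπ g
    exact h₂ h ((hF h).symm.trans hα)
  · obtain ⟨h, rfl⟩ := hf d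
    exact ⟨Abelianization.of (π h), (Abelianization.lift_apply_of F _).trans (hF h)⟩

theorem Ideal.Quotient.exists_units_map_eq {R : Type*} [CommRing R] [IsLocalRing R] {I : Ideal R}
    (hI : I ≠ ⊤) (α : (R ⧸ I)ˣ) : ∃ u : Rˣ, Ideal.Quotient.mk I u = α := by
  obtain ⟨x, hx⟩ := Ideal.Quotient.mk_surjective (α : R ⧸ I)
  obtain ⟨y, hy⟩ := Ideal.Quotient.mk_surjective ((α⁻¹ : (R ⧸ I)ˣ) : R ⧸ I)
  have h : Ideal.Quotient.mk I (x * y - 1) = 0 := by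
    rw [map_sub, map_mul, hx, hy, map_one, Units.mul_inv, sub_self]
  have h' := IsLocalRing.le_maximalIdeal hI (Ideal.Quotient.eq_zero_iff_mem.1 h)
  have hxy : IsUnit (x * y) := by
    by_contra hxy
    have := Ideal.sub_mem _ ((IsLocalRing.mem_maximalIdeal _).2 hxy) h'
    rw [sub_sub_cancel] at this
    exact (IsLocalRing.mem_maximalIdeal _).1 this isUnit_one
  obtain ⟨u, rfl⟩ := isUnit_of_mul_isUnit_left hxy
  exact ⟨u, hx⟩

namespace FlagOrder

variable {R : Type*} [CommRing R]

/-- Matrices whose entries below the diagonal satisfy the divisibility conditions that make them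
act on `R/(a) × R/(ab) × R`, where `abc = 0`. -/
def order (b c : R) : Submonoid (Matrix (Fin 3) (Fin 3) R) where
  carrier := {M | b ∣ M 1 0 ∧ b * c ∣ M 2 0 ∧ c ∣ M 2 1}
  one_mem' := by simp
  mul_mem' := by
    rintro M N ⟨⟨x, hx⟩, ⟨y, hy⟩, ⟨z, hz⟩⟩ ⟨⟨x', hx'⟩, ⟨y', hy'⟩, ⟨z', hz'⟩⟩
    simp only [Set.mem_ofPred_eq, Matrix.mul_apply, Fin.sum_univ_three, hx, hy, hz, hx', hy', hz']
    exact ⟨⟨x * N 0 0 + M 1 1 * x' + M 1 2 * c * y', by ring⟩,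
      ⟨y * N 0 0 + z * x' + M 2 2 * y', by ring⟩,
      ⟨b * y * N 0 1 + z * N 1 1 + M 2 2 * z', by ring⟩⟩

theorem mem_order {b c : R} {M : Matrix (Fin 3) (Fin 3) R} :
    M ∈ order b c ↔ b ∣ M 1 0 ∧ b * c ∣ M 2 0 ∧ c ∣ M 2 1 := Iff.rfl

theorem exists_unit_of_isUnit_det {b c : R} {M : Matrix (Fin 3) (Fin 3) R} (hM : M ∈ order b c)
    (hdet : IsUnit M.det) : ∃ u : (order b c)ˣ, ((u : order b c) : Matrix _ _ R) = M := by
  have hadj : M⁻¹ ∈ order b c := by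
    obtain ⟨⟨x, hx⟩, ⟨y, hy⟩, ⟨z, hz⟩⟩ := mem_order.1 hM
    rw [Matrix.inv_def, mem_order]
    simp only [Matrix.smul_apply, smul_eq_mul]
    refine ⟨Dvd.dvd.mul_left ?_ _, Dvd.dvd.mul_left ?_ _, Dvd.dvd.mul_left ?_ _⟩
    · rw [Matrix.adjugate_fin_three]
      simp only [Matrix.of_apply, Matrix.cons_val]
      rw [hx, hy]
      exact ⟨-x * M 2 2 + M 1 2 * c * y, by ring⟩
    · rw [Matrix.adjugate_fin_three]
      simp only [Matrix.of_apply, Matrix.cons_val]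
      rw [hx, hy, hz]
      exact ⟨x * z - M 1 1 * y, by ring⟩
    · rw [Matrix.adjugate_fin_three]
      simp only [Matrix.of_apply, Matrix.cons_val]
      rw [hy, hz]
      exact ⟨-M 0 0 * z + M 0 1 * b * y, by ring⟩
  exact ⟨⟨⟨M, hM⟩, ⟨M⁻¹, hadj⟩, Subtype.ext (Matrix.mul_nonsing_inv M hdet),
    Subtype.ext (Matrix.nonsing_inv_mul M hdet)⟩, rfl⟩

/-- The determinants of an element of the order over `R/(a)`, `R/(b)` and `R/(c)`, taken on the
summands of `R/(a) × R/(ab) × R` that survive generically there. -/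
def dets (a b c : R) : order b c →*
    (R ⧸ Ideal.span {a}) × (R ⧸ Ideal.span {b}) × (R ⧸ Ideal.span {c}) where
  toFun M := (Ideal.Quotient.mk _ M.1.det,
    Ideal.Quotient.mk _ (M.1 1 1 * M.1 2 2 - M.1 1 2 * M.1 2 1), Ideal.Quotient.mk _ (M.1 2 2))
  map_one' := by simp
  map_mul' := by
    rintro M N
    obtain ⟨x, hx⟩ := M.2.1
    obtain ⟨y, hy⟩ := M.2.2.1
    obtain ⟨z, hz⟩ := M.2.2.2
    obtain ⟨z', hz'⟩ := N.2.2.2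
    refine Prod.ext ?_ (Prod.ext ?_ ?_)
    · simp
    · simp only [Submonoid.coe_mul, Prod.mk_mul_mk, ← map_mul]
      rw [Ideal.Quotient.eq, Ideal.mem_span_singleton]
      simp only [Matrix.mul_apply, Fin.sum_univ_three, hx, hy, hz, hz']
      exact ⟨(x * c * z - M.1 1 1 * c * y) * (N.1 0 1 * N.1 1 2 - N.1 0 2 * N.1 1 1) +
        (x * M.1 2 2 - M.1 1 2 * c * y) * (N.1 0 1 * N.1 2 2 - N.1 0 2 * c * z'), by ring⟩
    · simp only [Submonoid.coe_mul, Prod.mk_mul_mk, ← map_mul]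
      rw [Ideal.Quotient.eq, Ideal.mem_span_singleton]
      simp only [Matrix.mul_apply, Fin.sum_univ_three, hy, hz]
      exact ⟨b * y * N.1 0 2 + z * N.1 1 2, by ring⟩

section Reduction

variable {b c : R} {A : Type*} [CommGroup A] (q : (order b c)ˣ →* A)

/-- `M` is the matrix of a unit of the order lying in the kernel of `q`. -/
def InKer (M : Matrix (Fin 3) (Fin 3) R) : Prop :=
  ∃ u : (order b c)ˣ, ((u : order b c) : Matrix _ _ R) = M ∧ q u = 1

variable {q}

theorem InKer.mul {M N : Matrix (Fin 3) (Fin 3) R} (hM : InKer q M) (hN : InKer q N) :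
    InKer q (M * N) := by
  obtain ⟨u, rfl, hu⟩ := hM
  obtain ⟨v, rfl, hv⟩ := hN
  exact ⟨u * v, rfl, by rw [map_mul, hu, hv, one_mul]⟩

theorem InKer.map_eq_one {u : (order b c)ˣ} (h : InKer q ((u : order b c) : Matrix _ _ R)) :
    q u = 1 := by
  obtain ⟨v, hv, hq⟩ := h
  rwa [Units.ext (Subtype.ext hv)] at hq

theorem inKer_of_commute {D U M : Matrix (Fin 3) (Fin 3) R} (hD : D ∈ order b c)
    (hU : U ∈ order b c) (hM : M ∈ order b c) (hD' : IsUnit D.det) (hU' : IsUnit U.det)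
    (h : D * U = M * U * D) : InKer q M := by
  have hM' : IsUnit M.det := by
    have := congrArg Matrix.det h
    simp only [Matrix.det_mul] at this
    rw [mul_assoc] at this
    exact isUnit_of_mul_isUnit_left (this ▸ hD'.mul hU')
  obtain ⟨d, rfl⟩ := exists_unit_of_isUnit_det hD hD'
  obtain ⟨u, rfl⟩ := exists_unit_of_isUnit_det hU hU'
  obtain ⟨m, rfl⟩ := exists_unit_of_isUnit_det hM hM'
  refine ⟨m, rfl, ?_⟩
  have h' : d * u = m * u * d := Units.ext (Subtype.ext h)
  have h'' := congrArg q h'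
  simp only [map_mul] at h''
  rw [mul_assoc, mul_comm (q d)] at h''
  exact mul_eq_right.1 h''.symm

theorem inKer_upper (h2 : IsUnit (2 : R))
    (x y z : R) : InKer q !![1, x, y; 0, 1, z; 0, 0, 1] := by
  obtain ⟨t, ht⟩ := h2.exists_left_inv
  have h01 : InKer q !![1, x, 0; 0, 1, 0; 0, 0, 1] := by
    refine inKer_of_commute (D := !![-1, 0, 0; 0, 1, 0; 0, 0, 1])
      (U := !![1, -(t * x), 0; 0, 1, 0; 0, 0, 1]) ?_ ?_ ?_ ?_ ?_ ?_
    · simp [mem_order]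
    · simp [mem_order]
    · simp [mem_order]
    · simp [Matrix.det_fin_three]
    · simp [Matrix.det_fin_three]
    · ext i j
      fin_cases i <;> fin_cases j <;> simp [Matrix.mul_apply, Fin.sum_univ_three]
      linear_combination x * ht
  have h02 : InKer q !![1, 0, y; 0, 1, 0; 0, 0, 1] := by
    refine inKer_of_commute (D := !![-1, 0, 0; 0, 1, 0; 0, 0, 1])
      (U := !![1, 0, -(t * y); 0, 1, 0; 0, 0, 1]) ?_ ?_ ?_ ?_ ?_ ?_
    · simp [mem_order]
    · simp [mem_order]
    · simp [mem_order]
    · simp [Matrix.det_fin_three]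
    · simp [Matrix.det_fin_three]
    · ext i j
      fin_cases i <;> fin_cases j <;> simp [Matrix.mul_apply, Fin.sum_univ_three]
      linear_combination y * ht
  have h12 : InKer q !![1, 0, 0; 0, 1, z; 0, 0, 1] := by
    refine inKer_of_commute (D := !![1, 0, 0; 0, -1, 0; 0, 0, 1])
      (U := !![1, 0, 0; 0, 1, -(t * z); 0, 0, 1]) ?_ ?_ ?_ ?_ ?_ ?_
    · simp [mem_order]
    · simp [mem_order]
    · simp [mem_order]
    · simp [Matrix.det_fin_three]
    · simp [Matrix.det_fin_three]
    · ext i j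
      fin_cases i <;> fin_cases j <;> simp [Matrix.mul_apply, Fin.sum_univ_three]
      linear_combination z * ht
  convert (h12.mul h02).mul h01 using 1
  ext i j
  fin_cases i <;> fin_cases j <;> simp [Matrix.mul_apply, Fin.sum_univ_three]

theorem inKer_lower (h2 : IsUnit (2 : R))
    {x y z : R} (hx : b ∣ x) (hy : b * c ∣ y) (hz : c ∣ z) :
    InKer q !![1, 0, 0; x, 1, 0; y, z, 1] := by
  obtain ⟨t, ht⟩ := h2.exists_left_inv
  have h10 : InKer q !![1, 0, 0; x, 1, 0; 0, 0, 1] := by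
    refine inKer_of_commute (D := !![1, 0, 0; 0, -1, 0; 0, 0, 1])
      (U := !![1, 0, 0; -(t * x), 1, 0; 0, 0, 1]) ?_ ?_ ?_ ?_ ?_ ?_
    · simp [mem_order]
    · simpa [mem_order] using (hx.mul_left t)
    · simpa [mem_order] using hx
    · simp [Matrix.det_fin_three]
    · simp [Matrix.det_fin_three]
    · ext i j
      fin_cases i <;> fin_cases j <;> simp [Matrix.mul_apply, Fin.sum_univ_three]
      linear_combination x * ht
  have h20 : InKer q !![1, 0, 0; 0, 1, 0; y, 0, 1] := by
    refine inKer_of_commute (D := !![1, 0, 0; 0, 1, 0; 0, 0, -1])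
      (U := !![1, 0, 0; 0, 1, 0; -(t * y), 0, 1]) ?_ ?_ ?_ ?_ ?_ ?_
    · simp [mem_order]
    · simpa [mem_order] using (hy.mul_left t)
    · simpa [mem_order] using hy
    · simp [Matrix.det_fin_three]
    · simp [Matrix.det_fin_three]
    · ext i j
      fin_cases i <;> fin_cases j <;> simp [Matrix.mul_apply, Fin.sum_univ_three]
      linear_combination y * ht
  have h21 : InKer q !![1, 0, 0; 0, 1, 0; 0, z, 1] := by
    refine inKer_of_commute (D := !![1, 0, 0; 0, 1, 0; 0, 0, -1])
      (U := !![1, 0, 0; 0, 1, 0; 0, -(t * z), 1]) ?_ ?_ ?_ ?_ ?_ ?_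
    · simp [mem_order]
    · simpa [mem_order] using (hz.mul_left t)
    · simpa [mem_order] using hz
    · simp [Matrix.det_fin_three]
    · simp [Matrix.det_fin_three]
    · ext i j
      fin_cases i <;> fin_cases j <;> simp [Matrix.mul_apply, Fin.sum_univ_three]
      linear_combination z * ht
  convert (h10.mul h20).mul h21 using 1
  ext i j
  fin_cases i <;> fin_cases j <;> simp [Matrix.mul_apply, Fin.sum_univ_three]

theorem inKer_diagonal_snd_trd (h2 : IsUnit (2 : R))
    {v w : R} (hvw : v * w = 1) (hv : c ∣ v - 1) :
    InKer q !![1, 0, 0; 0, w, 0; 0, 0, v] := by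
  have hw : c ∣ w - 1 := by
    have : w - 1 = -w * (v - 1) := by linear_combination hvw
    exact this ▸ hv.mul_left _
  have hw' : c ∣ -((w - 1) * v) := (hw.mul_right v).neg_right
  convert (((inKer_lower h2 (q := q) (dvd_zero b) (dvd_zero (b * c)) hw').mul
    (inKer_upper h2 (q := q) 0 0 1)).mul
    (inKer_lower h2 (q := q) (dvd_zero b) (dvd_zero (b * c)) hw)).mul
    (inKer_upper h2 (q := q) 0 0 (-v)) using 1
  ext i j
  fin_cases i <;> fin_cases j <;> simp [Matrix.mul_apply, Fin.sum_univ_three] <;> grind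

theorem inKer_diagonal_fst_snd (h2 : IsUnit (2 : R))
    {v w : R} (hvw : v * w = 1) (hv : b ∣ v - 1) :
    InKer q !![w, 0, 0; 0, v, 0; 0, 0, 1] := by
  have hw : b ∣ w - 1 := by
    have : w - 1 = -w * (v - 1) := by linear_combination hvw
    exact this ▸ hv.mul_left _
  have hw' : b ∣ -((w - 1) * v) := (hw.mul_right v).neg_right
  convert (((inKer_lower h2 (q := q) hw' (dvd_zero (b * c)) (dvd_zero c)).mul
    (inKer_upper h2 (q := q) 1 0 0)).mul
    (inKer_lower h2 (q := q) hw (dvd_zero (b * c)) (dvd_zero c))).mul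
    (inKer_upper h2 (q := q) (-v) 0 0) using 1
  ext i j
  fin_cases i <;> fin_cases j <;> simp [Matrix.mul_apply, Fin.sum_univ_three] <;> grind

theorem exists_eq_mul_diagonal_mul (h2 : IsUnit (2 : R))
    [IsLocalRing R] (hb : ¬ IsUnit b) (hc : ¬ IsUnit c)
    {M : Matrix (Fin 3) (Fin 3) R} (hM : M ∈ order b c) (hdet : IsUnit M.det) :
    ∃ (A B : Matrix (Fin 3) (Fin 3) R) (u v w : Rˣ), InKer q A ∧ InKer q B ∧
      M = A * !![(u : R), 0, 0; 0, v, 0; 0, 0, w] * B := by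
  obtain ⟨hx, hy, hz⟩ := mem_order.1 hM
  have hres : ∀ {r s : R}, ¬ IsUnit r → r ∣ s → IsLocalRing.residue R s = 0 := fun hr hrs =>
    (IsLocalRing.residue_eq_zero_iff _).2
      ((IsLocalRing.mem_maximalIdeal _).2 fun hs => hr (isUnit_of_dvd_unit hrs hs))
  have hx0 := hres hb hx
  have hy0 := hres hb ((dvd_mul_right b c).trans hy)
  have hz0 := hres hc hz
  have hdet0 := (IsLocalRing.residue_ne_zero_iff_isUnit _).2 hdet
  rw [Matrix.det_fin_three] at hdet0
  simp only [map_add, map_sub, map_mul, hx0, hy0, hz0, mul_zero, zero_mul, sub_zero, add_zero]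
    at hdet0
  obtain ⟨w, hw⟩ := (IsLocalRing.residue_ne_zero_iff_isUnit (M 2 2)).1 (right_ne_zero_of_mul hdet0)
  obtain ⟨v, hv⟩ := (IsLocalRing.residue_ne_zero_iff_isUnit
    (M 1 1 - M 1 2 * ↑w⁻¹ * M 2 1)).1 (by
      simpa [hz0] using right_ne_zero_of_mul (left_ne_zero_of_mul hdet0))
  obtain ⟨u, hu⟩ := (IsLocalRing.residue_ne_zero_iff_isUnit
    (M 0 0 - M 0 2 * ↑w⁻¹ * M 2 0 - (M 0 1 - M 0 2 * ↑w⁻¹ * M 2 1) * ↑v⁻¹ *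
      (M 1 0 - M 1 2 * ↑w⁻¹ * M 2 0))).1 (by
      simpa [hx0, hy0] using left_ne_zero_of_mul (left_ne_zero_of_mul hdet0))
  refine ⟨_, _, u, v, w, inKer_upper h2 ((M 0 1 - M 0 2 * ↑w⁻¹ * M 2 1) * ↑v⁻¹) (M 0 2 * ↑w⁻¹)
    (M 1 2 * ↑w⁻¹), inKer_lower h2 (x := (M 1 0 - M 1 2 * ↑w⁻¹ * M 2 0) * ↑v⁻¹)
    (y := M 2 0 * ↑w⁻¹) (z := M 2 1 * ↑w⁻¹) ?_ (hy.mul_right _) (hz.mul_right _), ?_⟩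
  · exact (dvd_sub hx (((dvd_mul_right b c).trans hy).mul_left _)).mul_right _
  · have hvv := v.mul_inv
    have hww := w.mul_inv
    ext i j
    fin_cases i <;> fin_cases j <;>
      simp [Matrix.mul_apply, Fin.sum_univ_three] <;> grind

end Reduction

theorem map_eq_one_of_dets_eq_one {a b c : R} {A : Type*} [CommGroup A] (q : (order b c)ˣ →* A)
    (h2 : IsUnit (2 : R)) [IsLocalRing R] (hb : ¬ IsUnit b) (hc : ¬ IsUnit c)
    (hq : ∀ (g : (order b c)ˣ) (r : R), a ∣ r - 1 →
      ((g : order b c) : Matrix _ _ R) = !![r, 0, 0; 0, 1, 0; 0, 0, 1] → q g = 1)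
    (g : (order b c)ˣ) (hg : Units.map (dets a b c) g = 1) : q g = 1 := by
  obtain ⟨A, B, u, v, w, ⟨A, rfl, hA⟩, ⟨B, rfl, hB⟩, hM⟩ := exists_eq_mul_diagonal_mul
    (q := q.prod (Units.map (dets a b c))) h2 hb hc (g : order b c).2
      (((g.isUnit.map (order b c).subtype)).map Matrix.detMonoidHom)
  have hdiag : ∀ u v w : Rˣ, ∃ d : (order b c)ˣ, ((d : order b c) : Matrix _ _ R) =
      !![(u : R), 0, 0; 0, v, 0; 0, 0, w] := fun u v w =>
    exists_unit_of_isUnit_det (by simp [mem_order])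
      (by simp [Matrix.det_fin_three])
  obtain ⟨d, hd⟩ := hdiag u v w
  obtain ⟨d', hd'⟩ := hdiag (u * v * w) 1 1
  have hgd : g = A * d * B := Units.ext (Subtype.ext (by rw [hM, ← hd]; rfl))
  simp only [MonoidHom.prod_apply, Prod.mk_eq_one] at hA hB
  have hqd : q g = q d := by rw [hgd, map_mul, map_mul, hA.1, hB.1, one_mul, mul_one]
  have hdd : Units.map (dets a b c) d = 1 := by
    rw [← hg, hgd, map_mul, map_mul, hA.2, hB.2, one_mul, mul_one]
  have hdd' := congrArg Units.val hdd
  simp only [Units.coe_map, dets, MonoidHom.coe_mk, OneHom.coe_mk, hd,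
    Units.val_one, Prod.mk_eq_one] at hdd'
  obtain ⟨ha1, hb1, hc1⟩ := hdd'
  rw [← map_one (Ideal.Quotient.mk _), Ideal.Quotient.eq, Ideal.mem_span_singleton] at ha1 hb1 hc1
  simp [Matrix.det_fin_three] at ha1 hb1 hc1
  obtain ⟨e₁, he₁, hqe₁⟩ := inKer_diagonal_fst_snd (q := q) h2
    (v := v * w) (w := ↑w⁻¹ * ↑v⁻¹) (by simp [mul_assoc]) hb1
  obtain ⟨e₂, he₂, hqe₂⟩ := inKer_diagonal_snd_trd (q := q) h2 w.mul_inv hc1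
  have hde : d = d' * e₁ * e₂ := by
    refine Units.ext (Subtype.ext ?_)
    have h : ((d : order b c) : Matrix _ _ R) = (d' : order b c).1 * (e₁ : order b c).1 *
        (e₂ : order b c).1 := by
      rw [hd, hd', he₁, he₂]
      ext i j
      fin_cases i <;> fin_cases j <;> simp [Matrix.mul_apply, Fin.sum_univ_three, mul_assoc]
    exact h
  rw [hqd, hde, map_mul, map_mul, hqe₁, hqe₂, mul_one, mul_one]
  exact hq d' (u * v * w) ha1 (by simpa using hd')

end FlagOrder

namespace FlagOrder

variable {R : Type*} [CommRing R]

/-- The endomorphisms of a quotient of `R³` induced by the matrices in the order, provided that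
these preserve the relations. -/
theorem exists_endHom {b c : R} {L : Type*} [AddCommGroup L] [Module R L]
    (p : (Fin 3 → R) →ₗ[R] L) (hp : Function.Surjective p)
    (hker : ∀ M ∈ order b c, ∀ v, p v = 0 → p (M.mulVec v) = 0) :
    ∃ f : order b c →* Module.End R L, ∀ M v, f M (p v) = p (M.1.mulVec v) := by
  have key : ∀ M : order b c, ∃ φ : Module.End R L, ∀ v, φ (p v) = p (M.1.mulVec v) := by
    intro M
    refine ⟨((LinearMap.ker p).liftQ (p ∘ₗ Matrix.mulVecLin M.1) (fun v hv => hker M.1 M.2 v hv)) ∘ₗ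
      (p.quotKerEquivOfSurjective hp).symm.toLinearMap, fun v => ?_⟩
    have h : (p.quotKerEquivOfSurjective hp).symm (p v) = (LinearMap.ker p).mkQ v := by
      rw [LinearEquiv.symm_apply_eq]
      rfl
    rw [LinearMap.comp_apply, LinearEquiv.coe_coe, h]
    rfl
  choose f hf using key
  have ext : ∀ φ ψ : Module.End R L, (∀ v, φ (p v) = ψ (p v)) → φ = ψ := fun φ ψ h =>
    LinearMap.ext fun l => by
      obtain ⟨v, rfl⟩ := hp l
      exact h v
  exact ⟨⟨⟨f, ext _ _ fun v => by simp [hf]⟩, fun M N => ext _ _ fun v => by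
    simp [hf, Matrix.mulVec_mulVec]⟩, hf⟩

variable (a d : R)

/-- The projection of `R³` onto `R/(a) × R/(d) × R`. -/
def proj : (Fin 3 → R) →ₗ[R] ((R ⧸ Ideal.span {a}) × (R ⧸ Ideal.span {d}) × R) :=
  ((Ideal.span {a}).mkQ ∘ₗ LinearMap.proj 0).prod
    (((Ideal.span {d}).mkQ ∘ₗ LinearMap.proj 1).prod (LinearMap.proj 2))

theorem proj_surjective : Function.Surjective (proj a d) := by
  rintro ⟨x, y, z⟩
  obtain ⟨x, rfl⟩ := Submodule.mkQ_surjective _ x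
  obtain ⟨y, rfl⟩ := Submodule.mkQ_surjective _ y
  exact ⟨![x, y, z], rfl⟩

variable {a d}

theorem proj_eq_zero_iff {v : Fin 3 → R} : proj a d v = 0 ↔ a ∣ v 0 ∧ d ∣ v 1 ∧ v 2 = 0 := by
  simp [proj, Prod.ext_iff, Ideal.Quotient.eq_zero_iff_dvd]

theorem proj_mulVec_eq_zero {b c : R} (hd : d = a * b) (h0 : a * b * c = 0)
    {M : Matrix (Fin 3) (Fin 3) R} (hM : M ∈ order b c) {v : Fin 3 → R} (hv : proj a d v = 0) :
    proj a d (M.mulVec v) = 0 := by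
  obtain ⟨⟨x, hx⟩, ⟨y, hy⟩, ⟨z, hz⟩⟩ := hM
  obtain ⟨⟨s, hs⟩, ⟨t, ht⟩, h2⟩ := proj_eq_zero_iff.1 hv
  subst hd
  rw [proj_eq_zero_iff]
  simp only [Matrix.mulVec, dotProduct, Fin.sum_univ_three, hx, hy, hz, hs, ht, h2]
  exact ⟨⟨M 0 0 * s + M 0 1 * b * t, by ring⟩, ⟨x * s + M 1 1 * t, by ring⟩,
    by linear_combination (y * s + z * t) * h0⟩

theorem exists_matrix {b c : R} (hd : d = a * b)
    (h₁ : ∀ r, a * b ∣ a * r → b ∣ r) (h₂ : ∀ r, a * r = 0 → b * c ∣ r)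
    (h₃ : ∀ r, a * b * r = 0 → c ∣ r)
    (φ : Module.End R ((R ⧸ Ideal.span {a}) × (R ⧸ Ideal.span {d}) × R)) :
    ∃ M ∈ order b c, ∀ v, φ (proj a d v) = proj a d (M.mulVec v) := by
  choose N hN using fun j => proj_surjective a d (φ (proj a d (Pi.single j 1)))
  have hφ : ∀ v, φ (proj a d v) = proj a d ((Matrix.of N).transpose.mulVec v) := by
    intro v
    have hv : v = ∑ j, v j • (Pi.single j 1 : Fin 3 → R) := by
      simpa using (pi_eq_sum_univ' v)
    have hNv : (Matrix.of N).transpose.mulVec v = ∑ j, v j • N j := by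
      ext i
      simp [Matrix.mulVec, dotProduct, mul_comm]
    rw [hNv]
    conv_lhs => rw [hv]
    simp only [map_sum, map_smul, hN]
  have hcol : ∀ j r, proj a d (Pi.single j r) = 0 → proj a d (r • N j) = 0 := by
    intro j r h
    rw [map_smul, hN, ← map_smul, ← map_smul, ← Pi.single_smul, smul_eq_mul, mul_one, h, map_zero]
  have h0 := proj_eq_zero_iff.1 (hcol 0 a (proj_eq_zero_iff.2 (by simp)))
  have h1 := proj_eq_zero_iff.1 (hcol 1 d (proj_eq_zero_iff.2 (by simp)))
  subst hd
  exact ⟨_, ⟨h₁ _ h0.2.1, h₂ _ h0.2.2, h₃ _ h1.2.2⟩, hφ⟩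

theorem exists_units_surjective [IsLocalRing R] {b c : R} (hd : d = a * b) (h0 : a * b * c = 0)
    (ha : ¬ IsUnit a)
    (h₁ : ∀ r, a * b ∣ a * r → b ∣ r) (h₂ : ∀ r, a * r = 0 → b * c ∣ r)
    (h₃ : ∀ r, a * b * r = 0 → c ∣ r) :
    ∃ π : (order b c)ˣ →*
        (Module.End R ((R ⧸ Ideal.span {a}) × (R ⧸ Ideal.span {d}) × R))ˣ,
      Function.Surjective π ∧ ∀ g, π g = 1 ↔
        ∀ j, a ∣ ((g : order b c).1 - 1) 0 j ∧ a * b ∣ ((g : order b c).1 - 1) 1 j ∧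
          ((g : order b c).1 - 1) 2 j = 0 := by
  obtain ⟨f, hf⟩ := exists_endHom (b := b) (c := c) (proj a d) (proj_surjective a d)
    fun M hM v hv => proj_mulVec_eq_zero hd h0 hM hv
  have hone : ∀ M : order b c, f M = 1 ↔
      ∀ j, a ∣ (M.1 - 1) 0 j ∧ a * b ∣ (M.1 - 1) 1 j ∧ (M.1 - 1) 2 j = 0 := by
    intro M
    have h : f M = 1 ↔ ∀ v, proj a d ((M.1 - 1).mulVec v) = 0 := by
      rw [LinearMap.ext_iff, (proj_surjective a d).forall]
      simp [hf, Matrix.sub_mulVec, sub_eq_zero]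
    rw [h]
    subst hd
    constructor
    · intro h j
      simpa [proj_eq_zero_iff] using h (Pi.single j 1)
    · intro h v
      rw [proj_eq_zero_iff]
      simp only [Matrix.mulVec, dotProduct]
      exact ⟨Finset.dvd_sum fun j _ => (h j).1.mul_right _,
        Finset.dvd_sum fun j _ => (h j).2.1.mul_right _,
        Finset.sum_eq_zero fun j _ => by rw [(h j).2.2, zero_mul]⟩
  refine ⟨Units.map f, fun φ => ?_, fun g => ?_⟩
  · obtain ⟨M, hM, hφ⟩ := exists_matrix hd h₁ h₂ h₃ (φ : Module.End R _)
    obtain ⟨N, hN, hψ⟩ := exists_matrix hd h₁ h₂ h₃ ((φ⁻¹ : _ˣ) : Module.End R _)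
    have hfM : f ⟨M, hM⟩ = φ := LinearMap.ext fun l => by
      obtain ⟨v, rfl⟩ := proj_surjective a d l
      rw [hf, hφ]
    have hfN : f ⟨N, hN⟩ = (φ⁻¹ : _ˣ) := LinearMap.ext fun l => by
      obtain ⟨v, rfl⟩ := proj_surjective a d l
      rw [hf, hψ]
    have h := (hone (⟨M, hM⟩ * ⟨N, hN⟩)).1 (by rw [map_mul, hfM, hfN, Units.mul_inv])
    have hres : (IsLocalRing.residue R).mapMatrix (M * N) = 1 := by
      have ha0 : IsLocalRing.residue R a = 0 := (IsLocalRing.residue_eq_zero_iff _).2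
        ((IsLocalRing.mem_maximalIdeal _).2 ha)
      rw [← sub_eq_zero, ← map_one (IsLocalRing.residue R).mapMatrix, ← map_sub]
      ext i j
      obtain ⟨⟨x, hx⟩, ⟨y, hy⟩, hz⟩ := h j
      simp only [Submonoid.mk_mul_mk] at hx hy hz
      fin_cases i <;> simp [hx, hy, hz, ha0, -Matrix.sub_apply]
    have hdet : IsUnit M.det := by
      have := congrArg Matrix.det hres
      rw [← RingHom.map_det, Matrix.det_mul, map_mul, Matrix.det_one] at this
      exact (IsLocalRing.residue_ne_zero_iff_isUnit _).1 (left_ne_zero_of_mul_eq_one this)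
    obtain ⟨g, hg⟩ := exists_unit_of_isUnit_det hM hdet
    exact ⟨g, Units.ext (by rw [← hfM]; exact congrArg f (Subtype.ext hg))⟩
  · rw [← hone, Units.ext_iff]
    rfl

theorem units_map_dets_surjective [IsLocalRing R] {b c : R} (ha : ¬ IsUnit a) (hb : ¬ IsUnit b)
    (hc : ¬ IsUnit c) : Function.Surjective (Units.map (dets a b c)) := by
  intro δ
  obtain ⟨u, hu⟩ := Ideal.Quotient.exists_units_map_eq (Ideal.span_singleton_eq_top.not.2 ha)
    (MulEquiv.prodUnits δ).1
  obtain ⟨v, hv⟩ := Ideal.Quotient.exists_units_map_eq (Ideal.span_singleton_eq_top.not.2 hb)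
    (MulEquiv.prodUnits (MulEquiv.prodUnits δ).2).1
  obtain ⟨w, hw⟩ := Ideal.Quotient.exists_units_map_eq (Ideal.span_singleton_eq_top.not.2 hc)
    (MulEquiv.prodUnits (MulEquiv.prodUnits δ).2).2
  obtain ⟨g, hg⟩ := exists_unit_of_isUnit_det (b := b) (c := c)
    (M := !![(u * ↑v⁻¹ : R), 0, 0; 0, v * ↑w⁻¹, 0; 0, 0, w])
    (by simp [mem_order]) (by simp [Matrix.det_fin_three])
  have h : dets a b c g =
      (Ideal.Quotient.mk _ (u : R), Ideal.Quotient.mk _ (v : R), Ideal.Quotient.mk _ (w : R)) := by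
    simp only [dets, MonoidHom.coe_mk, OneHom.coe_mk, hg]
    simp [Matrix.det_fin_three, -map_mul, mul_assoc]
  refine ⟨g, Units.ext (h.trans ?_)⟩
  rw [hu, hv, hw]
  rfl

theorem dets_eq_one {b c : R} {M : order b c}
    (hM : ∀ j, a ∣ (M.1 - 1) 0 j ∧ a * b ∣ (M.1 - 1) 1 j ∧ (M.1 - 1) 2 j = 0) :
    dets a b c M = 1 := by
  have hdet : (Ideal.Quotient.mk (Ideal.span {a})).mapMatrix M.1 = 1 := by
    rw [← sub_eq_zero, ← map_one (Ideal.Quotient.mk (Ideal.span {a})).mapMatrix, ← map_sub]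
    ext i j
    obtain ⟨hx, hy, hz⟩ := hM j
    have hy' := (dvd_mul_right a b).trans hy
    rw [RingHom.mapMatrix_apply, Matrix.map_apply, Matrix.zero_apply,
      Ideal.Quotient.eq_zero_iff_dvd]
    fin_cases i
    · exact hx
    · exact hy'
    · exact hz ▸ dvd_zero a
  have h11 : Ideal.Quotient.mk (Ideal.span {b}) (M.1 1 1) = 1 := by
    rw [← map_one (Ideal.Quotient.mk (Ideal.span {b})), Ideal.Quotient.eq,
      Ideal.mem_span_singleton]
    simpa using (dvd_mul_left b a).trans (hM 1).2.1
  have h22 : M.1 2 2 = 1 := by simpa [sub_eq_zero] using (hM 2).2.2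
  have h21 : M.1 2 1 = 0 := by simpa using (hM 1).2.2
  refine Prod.ext ?_ (Prod.ext ?_ ?_)
  · have := congrArg Matrix.det hdet
    rwa [← RingHom.map_det, Matrix.det_one] at this
  · simp [dets, h11, h22, h21]
  · simp [dets, h22]

theorem nonempty_abelianization_mulEquiv [IsLocalRing R] {b c : R} (hd : d = a * b)
    (h0 : a * b * c = 0) (ha : ¬ IsUnit a) (hb : ¬ IsUnit b) (hc : ¬ IsUnit c)
    (h2 : IsUnit (2 : R)) (h₁ : ∀ r, a * b ∣ a * r → b ∣ r) (h₂ : ∀ r, a * r = 0 → b * c ∣ r)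
    (h₃ : ∀ r, a * b * r = 0 → c ∣ r) :
    Nonempty (Abelianization
        (Module.End R ((R ⧸ Ideal.span {a}) × (R ⧸ Ideal.span {d}) × R))ˣ ≃*
      (R ⧸ Ideal.span {a})ˣ × (R ⧸ Ideal.span {b})ˣ × (R ⧸ Ideal.span {c})ˣ) := by
  obtain ⟨π, hπ, hπ1⟩ := exists_units_surjective hd h0 ha h₁ h₂ h₃
  obtain ⟨E⟩ := Abelianization.nonempty_mulEquiv_of_surjective π (Units.map (dets a b c)) hπ
    (units_map_dets_surjective ha hb hc)
    (fun g hg => Units.ext (dets_eq_one ((hπ1 g).1 hg)))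
    (fun g hg => map_eq_one_of_dets_eq_one (Abelianization.of.comp π) h2 hb hc
      (fun g r hr hgr => by
        have : π g = 1 := (hπ1 g).2 fun j => by
          rw [hgr]
          fin_cases j <;> simp [hr]
        rw [MonoidHom.comp_apply, this, map_one]) g hg)
  exact ⟨E.trans (MulEquiv.prodUnits.trans ((MulEquiv.refl _).prodCongr MulEquiv.prodUnits))⟩

end FlagOrder

section HypersurfaceQuotient

variable {S : Type*} [CommRing S] [IsLocalRing S] [IsDomain S]

theorem nonempty_abelianization_mulEquiv_of_hypersurface {a b c f : S} (hf : f = a * b * c)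
    (ha : ¬ IsUnit a) (hb : ¬ IsUnit b) (hc : ¬ IsUnit c) (ha0 : a ≠ 0) (hb0 : b ≠ 0)
    (h2 : IsUnit (2 : S)) :
    Nonempty (Abelianization (Module.End (S ⧸ Ideal.span {f})
        (((S ⧸ Ideal.span {f}) ⧸ Ideal.span {Ideal.Quotient.mk (Ideal.span {f}) a}) ×
          ((S ⧸ Ideal.span {f}) ⧸ Ideal.span {Ideal.Quotient.mk (Ideal.span {f}) (a * b)}) ×
          (S ⧸ Ideal.span {f})))ˣ ≃*
      (S ⧸ Ideal.span {a})ˣ × (S ⧸ Ideal.span {b})ˣ × (S ⧸ Ideal.span {c})ˣ) := by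
  have hlift : ∀ {x y : S}, Ideal.Quotient.mk (Ideal.span {f}) x =
      Ideal.Quotient.mk (Ideal.span {f}) y ↔ f ∣ x - y := by
    intro x y
    rw [Ideal.Quotient.eq, Ideal.mem_span_singleton]
  have hunit : ∀ {x : S}, ¬ IsUnit x → x ∣ f →
      ¬ IsUnit (Ideal.Quotient.mk (Ideal.span {f}) x) := by
    intro x hx hxf h
    obtain ⟨y, hy⟩ := h.exists_right_inv
    obtain ⟨y, rfl⟩ := Ideal.Quotient.mk_surjective y
    rw [← map_mul, ← map_one (Ideal.Quotient.mk _), hlift] at hy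
    refine hx (isUnit_of_dvd_one ?_)
    simpa using dvd_sub (dvd_mul_right x y) (hxf.trans hy)
  have haf : a ∣ f := ⟨b * c, by rw [hf, mul_assoc]⟩
  have hbf : b ∣ f := ⟨a * c, by rw [hf]; ring⟩
  have hcf : c ∣ f := ⟨a * b, by rw [hf]; ring⟩
  have : Nontrivial (S ⧸ Ideal.span {f}) := Ideal.Quotient.nontrivial_iff.2
    (Ideal.span_singleton_eq_top.not.2 fun h => ha (isUnit_of_dvd_unit haf h))
  have : IsLocalRing (S ⧸ Ideal.span {f}) :=
    IsLocalRing.of_surjective' _ Ideal.Quotient.mk_surjective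
  have hquot : ∀ {x : S}, x ∣ f → Nonempty (((S ⧸ Ideal.span {f}) ⧸
      Ideal.span {Ideal.Quotient.mk (Ideal.span {f}) x}) ≃+* (S ⧸ Ideal.span {x})) := by
    intro x hx
    refine ⟨(Ideal.quotEquivOfEq ?_).trans
      (DoubleQuot.quotQuotEquivQuotOfLE (Ideal.span_singleton_le_span_singleton.2 hx))⟩
    rw [Ideal.map_span, Set.image_singleton]
  obtain ⟨ea⟩ := hquot haf
  obtain ⟨eb⟩ := hquot hbf
  obtain ⟨ec⟩ := hquot hcf
  obtain ⟨E⟩ := FlagOrder.nonempty_abelianization_mulEquiv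
    (a := Ideal.Quotient.mk (Ideal.span {f}) a) (b := Ideal.Quotient.mk (Ideal.span {f}) b)
    (c := Ideal.Quotient.mk (Ideal.span {f}) c) (map_mul (Ideal.Quotient.mk (Ideal.span {f})) a b)
    (by rw [← map_mul, ← map_mul, ← hf, Ideal.Quotient.eq_zero_iff_mem]
        exact Ideal.mem_span_singleton_self f)
    (hunit ha haf) (hunit hb hbf) (hunit hc hcf)
    (map_ofNat (Ideal.Quotient.mk (Ideal.span {f})) 2 ▸ h2.map _)
    (fun r ⟨s, hs⟩ => by
      obtain ⟨r, rfl⟩ := Ideal.Quotient.mk_surjective r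
      obtain ⟨s, rfl⟩ := Ideal.Quotient.mk_surjective s
      rw [← map_mul, ← map_mul, ← map_mul, hlift] at hs
      obtain ⟨t, ht⟩ := hs
      have : r = b * (s + c * t) := mul_left_cancel₀ ha0 (by rw [hf] at ht; linear_combination ht)
      exact map_dvd _ ⟨_, this⟩)
    (fun r hr => by
      obtain ⟨r, rfl⟩ := Ideal.Quotient.mk_surjective r
      rw [← map_mul, Ideal.Quotient.eq_zero_iff_dvd] at hr
      obtain ⟨t, ht⟩ := hr
      have : r = b * c * t := mul_left_cancel₀ ha0 (by rw [hf] at ht; linear_combination ht)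
      rw [← map_mul]
      exact map_dvd _ ⟨_, this⟩)
    (fun r hr => by
      obtain ⟨r, rfl⟩ := Ideal.Quotient.mk_surjective r
      rw [← map_mul, ← map_mul, Ideal.Quotient.eq_zero_iff_dvd] at hr
      obtain ⟨t, ht⟩ := hr
      have : r = c * t := mul_left_cancel₀ (mul_ne_zero ha0 hb0)
        (by rw [hf] at ht; linear_combination ht)
      exact map_dvd _ ⟨_, this⟩)
  exact ⟨E.trans ((Units.mapEquiv ea.toMulEquiv).prodCongr
    ((Units.mapEquiv eb.toMulEquiv).prodCongr (Units.mapEquiv ec.toMulEquiv)))⟩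

end HypersurfaceQuotient


/-- Let `k` be an algebraically closed field of characteristic
not `2`, `3` or `5`, `n ≥ 2`, `S = k[[x, y]]` and
`R = S/((x - y^(n-1)) · y · (x + y^(n-1)))` the `D_{2n}` curve singularity.
Let `L = S/(x - y^(n-1)) ⊕ S/((x - y^(n-1))y) ⊕ R` (the first two summands
realized as `R`-module quotients of `R`).  Then the abelianization of
`Aut_R(L)` is isomorphic to
`(S/(x - y^(n-1)))ˣ × (S/(y))ˣ × (S/(x + y^(n-1)))ˣ`, which in turn is
isomorphic to `k[[X]]ˣ × k[[X]]ˣ × k[[X]]ˣ`. -/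
theorem stmt17 {k : Type*} [Field k] [IsAlgClosed k]
    (h2 : ringChar k ≠ 2) (h3 : ringChar k ≠ 3) (h5 : ringChar k ≠ 5)
    (n : ℕ) (hn : 2 ≤ n) :
    Nonempty
      (Abelianization
        (Module.End
          (MvPowerSeries (Fin 2) k ⧸
            Ideal.span {((MvPowerSeries.X 0 - MvPowerSeries.X 1 ^ (n - 1)) *
              MvPowerSeries.X 1 *
              (MvPowerSeries.X 0 + MvPowerSeries.X 1 ^ (n - 1)) :
                MvPowerSeries (Fin 2) k)})
          (((MvPowerSeries (Fin 2) k ⧸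
              Ideal.span {((MvPowerSeries.X 0 - MvPowerSeries.X 1 ^ (n - 1)) *
                MvPowerSeries.X 1 *
                (MvPowerSeries.X 0 + MvPowerSeries.X 1 ^ (n - 1)) :
                  MvPowerSeries (Fin 2) k)}) ⧸
            Ideal.span
              {Ideal.Quotient.mk
                (Ideal.span {((MvPowerSeries.X 0 - MvPowerSeries.X 1 ^ (n - 1)) *
                  MvPowerSeries.X 1 *
                  (MvPowerSeries.X 0 + MvPowerSeries.X 1 ^ (n - 1)) :
                    MvPowerSeries (Fin 2) k)})
                (MvPowerSeries.X 0 - MvPowerSeries.X 1 ^ (n - 1))}) ×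
           (((MvPowerSeries (Fin 2) k ⧸
              Ideal.span {((MvPowerSeries.X 0 - MvPowerSeries.X 1 ^ (n - 1)) *
                MvPowerSeries.X 1 *
                (MvPowerSeries.X 0 + MvPowerSeries.X 1 ^ (n - 1)) :
                  MvPowerSeries (Fin 2) k)}) ⧸
            Ideal.span
              {Ideal.Quotient.mk
                (Ideal.span {((MvPowerSeries.X 0 - MvPowerSeries.X 1 ^ (n - 1)) *
                  MvPowerSeries.X 1 *
                  (MvPowerSeries.X 0 + MvPowerSeries.X 1 ^ (n - 1)) :
                    MvPowerSeries (Fin 2) k)})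
                ((MvPowerSeries.X 0 - MvPowerSeries.X 1 ^ (n - 1)) *
                  MvPowerSeries.X 1)}) ×
           (MvPowerSeries (Fin 2) k ⧸
            Ideal.span {((MvPowerSeries.X 0 - MvPowerSeries.X 1 ^ (n - 1)) *
              MvPowerSeries.X 1 *
              (MvPowerSeries.X 0 + MvPowerSeries.X 1 ^ (n - 1)) :
                MvPowerSeries (Fin 2) k)}))))ˣ
        ≃* ((MvPowerSeries (Fin 2) k ⧸
              Ideal.span {(MvPowerSeries.X 0 - MvPowerSeries.X 1 ^ (n - 1) :
                MvPowerSeries (Fin 2) k)})ˣ ×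
            (MvPowerSeries (Fin 2) k ⧸
              Ideal.span {(MvPowerSeries.X 1 : MvPowerSeries (Fin 2) k)})ˣ ×
            (MvPowerSeries (Fin 2) k ⧸
              Ideal.span {(MvPowerSeries.X 0 + MvPowerSeries.X 1 ^ (n - 1) :
                MvPowerSeries (Fin 2) k)})ˣ)) ∧
    Nonempty
      (((MvPowerSeries (Fin 2) k ⧸
            Ideal.span {(MvPowerSeries.X 0 - MvPowerSeries.X 1 ^ (n - 1) :
              MvPowerSeries (Fin 2) k)})ˣ ×
          (MvPowerSeries (Fin 2) k ⧸
            Ideal.span {(MvPowerSeries.X 1 : MvPowerSeries (Fin 2) k)})ˣ ×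
          (MvPowerSeries (Fin 2) k ⧸
            Ideal.span {(MvPowerSeries.X 0 + MvPowerSeries.X 1 ^ (n - 1) :
              MvPowerSeries (Fin 2) k)})ˣ)
        ≃* ((PowerSeries k)ˣ × (PowerSeries k)ˣ × (PowerSeries k)ˣ)) := by
  have hn1 : n - 1 ≠ 0 := by omega
  have h2k : (2 : k) ≠ 0 := fun h => h2
    ((Nat.prime_two.eq_one_or_self_of_dvd _ (ringChar.dvd (by exact_mod_cast h))).resolve_left
      (CharP.ringChar_ne_one))
  have hnonunit : ∀ {f : MvPowerSeries (Fin 2) k}, MvPowerSeries.constantCoeff f = 0 →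
      ¬ IsUnit f := by
    intro f hf h
    rw [MvPowerSeries.isUnit_iff_constantCoeff, hf] at h
    exact not_isUnit_zero h
  have ha0 : (MvPowerSeries.X 0 - MvPowerSeries.X 1 ^ (n - 1) : MvPowerSeries (Fin 2) k) ≠ 0 := by
    intro h
    have h' := congrArg (MvPowerSeries.coeff (Finsupp.single (0 : Fin 2) 1)) h
    rw [map_sub, MvPowerSeries.coeff_index_single_self_X, MvPowerSeries.coeff_X_pow, if_neg,
      sub_zero, map_zero] at h'
    · exact one_ne_zero h'
    · intro h''
      simpa using DFunLike.congr_fun h'' 0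
  have hb0 : (MvPowerSeries.X 1 : MvPowerSeries (Fin 2) k) ≠ 0 := by
    intro h
    have h' := congrArg (MvPowerSeries.coeff (Finsupp.single (1 : Fin 2) 1)) h
    rw [MvPowerSeries.coeff_index_single_self_X, map_zero] at h'
    exact one_ne_zero h'
  have : IsDomain (MvPowerSeries (Fin 2) k) := NoZeroDivisors.to_isDomain _
  refine ⟨nonempty_abelianization_mulEquiv_of_hypersurface rfl (hnonunit (by simp [hn1]))
    (hnonunit (by simp)) (hnonunit (by simp [hn1])) ha0 hb0 ?_, ?_⟩
  · rw [MvPowerSeries.isUnit_iff_constantCoeff, map_ofNat]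
    exact h2k.isUnit
  · obtain ⟨ea⟩ := MvPowerSeries.nonempty_quotient_span_shear_ringEquiv (-1 : k) hn1
    obtain ⟨eb⟩ := MvPowerSeries.nonempty_quotient_span_X_ringEquiv (k := k) 1
    obtain ⟨ec⟩ := MvPowerSeries.nonempty_quotient_span_shear_ringEquiv (1 : k) hn1
    exact ⟨(Units.mapEquiv ((Ideal.quotEquivOfEq (by simp [sub_eq_add_neg])).trans
        ea).toMulEquiv).prodCongr ((Units.mapEquiv eb.toMulEquiv).prodCongr
      (Units.mapEquiv ((Ideal.quotEquivOfEq (by simp)).trans ec).toMulEquiv))⟩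
end
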